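/- Every simple graph in which every vertex has degree at most 4 and which has at least one vertex of degree at most 3 admits a strong edge-coloring using at most 21 colors. -/

import Mathlib

/-- Two edges of `G` conflict in a strong edge-coloring: they share an endpoint,
or some endpoint of one is adjacent in `G` to some endpoint of the other. -/
def StrongConflict {V : Type*} (G : SimpleGraph V) (e f : Sym2 V) : Prop :=
  (∃ v, v ∈ e ∧ v ∈ f) ∨ (∃ u v, u ∈ e ∧ v ∈ f ∧ G.Adj u v)

/-- A strong edge-coloring of `G` with `k` colors: conflicting distinct edges
receive different colors. -/
def IsStrongEdgeColoring {V : Type*} (G : SimpleGraph V) {k : ℕ}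
    (C : G.edgeSet → Fin k) : Prop :=
  ∀ e f : G.edgeSet, e ≠ f → StrongConflict G (e : Sym2 V) (f : Sym2 V) → C e ≠ C f

open scoped Classical in
/-- The neighbours of `v` in `G`, as a finset. -/
noncomputable def nbrs {V : Type*} [Fintype V] (G : SimpleGraph V) (v : V) : Finset V :=
  Finset.univ.filter (G.Adj v)

open scoped Classical in
/-- The edges of `G` avoiding all vertices of `M`. -/
noncomputable def edgesAvoid {V : Type*} [Fintype V] (G : SimpleGraph V) (M : Finset V) :
    Finset (Sym2 V) :=
  Finset.univ.filter fun e => e ∈ G.edgeSet ∧ ∀ v ∈ e, v ∉ M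

/-- `C` is a strong edge-coloring when restricted to the edges in `S`. -/
def ProperOn {V : Type*} (G : SimpleGraph V) (S : Finset (Sym2 V)) (C : Sym2 V → Fin 21) : Prop :=
  ∀ e ∈ S, ∀ f ∈ S, e ≠ f → StrongConflict G e f → C e ≠ C f

open scoped Classical in
/-- The edges in `S` conflicting with `e`. -/
noncomputable def conflicting {V : Type*} (G : SimpleGraph V) (S : Finset (Sym2 V)) (e : Sym2 V) :
    Finset (Sym2 V) :=
  S.filter (StrongConflict G e)

open scoped Classical in
/-- The colors appearing on edges in `S` that conflict with `e`. -/
noncomputable def seen {V : Type*} (G : SimpleGraph V) (S : Finset (Sym2 V)) (C : Sym2 V → Fin 21)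
    (e : Sym2 V) : Finset (Fin 21) :=
  (conflicting G S e).image C

open scoped Classical in
/-- The colors not appearing on edges in `S` that conflict with `e`. -/
noncomputable def avail {V : Type*} (G : SimpleGraph V) (S : Finset (Sym2 V)) (C : Sym2 V → Fin 21)
    (e : Sym2 V) : Finset (Fin 21) :=
  (seen G S C e)ᶜ

open scoped Classical in
/-- The number of edges at `w` that belong to `S`. -/
noncomputable def degIn {V : Type*} [Fintype V] (G : SimpleGraph V) (S : Finset (Sym2 V)) (w : V) :
    ℕ :=
  ((nbrs G w).filter fun x => s(w, x) ∈ S).card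

section Basic

open scoped Classical

variable {V : Type*} [Fintype V] {G : SimpleGraph V}

@[simp] lemma mem_nbrs {v w : V} : w ∈ nbrs G v ↔ G.Adj v w := by simp [nbrs]

@[simp] lemma mem_edgesAvoid {M : Finset V} {e : Sym2 V} :
    e ∈ edgesAvoid G M ↔ e ∈ G.edgeSet ∧ ∀ v ∈ e, v ∉ M := by simp [edgesAvoid]

lemma mem_conflicting {S : Finset (Sym2 V)} {e f : Sym2 V} :
    f ∈ conflicting G S e ↔ f ∈ S ∧ StrongConflict G e f := by simp [conflicting]

lemma StrongConflict.symm {e f : Sym2 V} (h : StrongConflict G e f) : StrongConflict G f e := by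
  rcases h with ⟨v, h1, h2⟩ | ⟨u, v, h1, h2, h3⟩
  · exact Or.inl ⟨v, h2, h1⟩
  · exact Or.inr ⟨v, u, h2, h1, h3.symm⟩

lemma mem_seen {S : Finset (Sym2 V)} {C : Sym2 V → Fin 21} {e : Sym2 V} {x : Fin 21} :
    x ∈ seen G S C e ↔ ∃ f ∈ S, StrongConflict G e f ∧ C f = x := by
  simp [seen, mem_conflicting, and_assoc]

lemma mem_avail {S : Finset (Sym2 V)} {C : Sym2 V → Fin 21} {e : Sym2 V} {x : Fin 21} :
    x ∈ avail G S C e ↔ ∀ f ∈ S, StrongConflict G e f → C f ≠ x := by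
  simp [avail, mem_seen]

lemma seen_card_le (S : Finset (Sym2 V)) (C : Sym2 V → Fin 21) (e : Sym2 V) :
    (seen G S C e).card ≤ (conflicting G S e).card := Finset.card_image_le

lemma card_avail_add_card_seen (S : Finset (Sym2 V)) (C : Sym2 V → Fin 21) (e : Sym2 V) :
    (avail G S C e).card + (seen G S C e).card = 21 := by
  have := Finset.card_compl_add_card (seen G S C e)
  rwa [Fintype.card_fin] at this

lemma le_card_avail {S : Finset (Sym2 V)} {C : Sym2 V → Fin 21} {e : Sym2 V} {k : ℕ}
    (h : (conflicting G S e).card + k ≤ 21) : k ≤ (avail G S C e).card := by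
  have h1 := card_avail_add_card_seen (G := G) S C e
  have h2 := seen_card_le (G := G) S C e
  omega

lemma exists_mem_avail {S : Finset (Sym2 V)} {C : Sym2 V → Fin 21} {e : Sym2 V}
    (h : (conflicting G S e).card ≤ 20) : ∃ x, x ∈ avail G S C e := by
  have : 1 ≤ (avail G S C e).card := le_card_avail (by omega)
  exact Finset.card_pos.mp this

/-- The edges of `S` at a vertex `w`. -/
noncomputable def edgesAt (S : Finset (Sym2 V)) (w : V) : Finset (Sym2 V) :=
  S.filter fun e => w ∈ e

lemma mem_edgesAt {S : Finset (Sym2 V)} {w : V} {e : Sym2 V} :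
    e ∈ edgesAt S w ↔ e ∈ S ∧ w ∈ e := by simp [edgesAt]

lemma card_edgesAt_le {S : Finset (Sym2 V)} (hS : ∀ e ∈ S, e ∈ G.edgeSet) (w : V) :
    (edgesAt S w).card ≤ degIn G S w := by
  have : edgesAt S w ⊆ ((nbrs G w).filter fun x => s(w, x) ∈ S).image fun x => s(w, x) := by
    intro e he
    obtain ⟨he, hw⟩ := mem_edgesAt.mp he
    obtain ⟨x, rfl⟩ := Sym2.mem_iff_exists.mp hw
    have := hS _ he
    simp only [Finset.mem_image, Finset.mem_filter, mem_nbrs]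
    exact ⟨x, ⟨this, he⟩, rfl⟩
  exact (Finset.card_le_card this).trans Finset.card_image_le

lemma degIn_le_card_nbrs (S : Finset (Sym2 V)) (w : V) : degIn G S w ≤ (nbrs G w).card :=
  Finset.card_filter_le _ _

lemma degIn_mono {S S' : Finset (Sym2 V)} (h : S ⊆ S') (w : V) : degIn G S w ≤ degIn G S' w := by
  apply Finset.card_le_card
  intro x hx
  simp only [Finset.mem_filter] at hx ⊢
  exact ⟨hx.1, h hx.2⟩

lemma degIn_eq_zero {S : Finset (Sym2 V)} {w : V} (h : ∀ x, G.Adj w x → s(w, x) ∉ S) :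
    degIn G S w = 0 := by
  simp only [degIn, Finset.card_eq_zero, Finset.filter_eq_empty_iff]
  intro x hx
  exact h x (mem_nbrs.mp hx)

lemma degIn_le_of_subset {S : Finset (Sym2 V)} {w : V} {K : Finset V}
    (h : ∀ x, G.Adj w x → s(w, x) ∈ S → x ∈ K) : degIn G S w ≤ K.card := by
  apply Finset.card_le_card
  intro x hx
  simp only [Finset.mem_filter, mem_nbrs] at hx
  exact h x hx.1 hx.2

/-- An edge conflicting with `s(u, v)` meets a neighbour of `u` other than `v`
or a neighbour of `v` other than `u`. -/
lemma conflicting_subset {S : Finset (Sym2 V)} (hS : ∀ e ∈ S, e ∈ G.edgeSet) {u v : V}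
    (hadj : G.Adj u v) (huv : s(u, v) ∉ S) :
    conflicting G S s(u, v) ⊆
      ((nbrs G u).erase v).biUnion (edgesAt S) ∪ ((nbrs G v).erase u).biUnion (edgesAt S) := by
  intro f hf
  obtain ⟨hfS, hc⟩ := mem_conflicting.mp hf
  have key : ∀ p q : V, G.Adj p q → s(p, q) ∉ S → p ∈ f →
      f ∈ ((nbrs G p).erase q).biUnion (edgesAt S) := by
    intro p q hpq hpqS hp
    obtain ⟨x, rfl⟩ := Sym2.mem_iff_exists.mp hp
    have hx : G.Adj p x := hS _ hfS
    simp only [Finset.mem_biUnion, Finset.mem_erase, mem_nbrs, mem_edgesAt]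
    refine ⟨x, ⟨?_, hx⟩, hfS, by simp⟩
    rintro rfl
    exact hpqS hfS
  have huv' : s(v, u) ∉ S := by rwa [Sym2.eq_swap]
  rw [Finset.mem_union]
  have key2 : ∀ p q z : V, G.Adj p q → s(p, q) ∉ S → z ∈ f → G.Adj p z →
      f ∈ ((nbrs G p).erase q).biUnion (edgesAt S) ∪
        ((nbrs G q).erase p).biUnion (edgesAt S) := by
    intro p q z hpq hpqS hz hpz
    rw [Finset.mem_union]
    by_cases hzq : z = q
    · subst hzq
      exact Or.inr (key _ _ hpq.symm (by rwa [Sym2.eq_swap]) hz)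
    · left
      simp only [Finset.mem_biUnion, Finset.mem_erase, mem_nbrs, mem_edgesAt]
      exact ⟨z, ⟨hzq, hpz⟩, hfS, hz⟩
  rcases hc with ⟨w, hw, hwf⟩ | ⟨w, z, hw, hz, hwz⟩
  · rcases Sym2.mem_iff.mp hw with rfl | rfl
    · exact Or.inl (key _ _ hadj huv hwf)
    · exact Or.inr (key _ _ hadj.symm huv' hwf)
  · rcases Sym2.mem_iff.mp hw with rfl | rfl
    · exact Finset.mem_union.mp (key2 _ _ z hadj huv hz hwz)
    · exact (Finset.mem_union.mp (key2 _ _ z hadj.symm huv' hz hwz)).symm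

lemma conflicting_card_le {S : Finset (Sym2 V)} (hS : ∀ e ∈ S, e ∈ G.edgeSet) {u v : V}
    (hadj : G.Adj u v) (huv : s(u, v) ∉ S) :
    (conflicting G S s(u, v)).card ≤
      ∑ w ∈ (nbrs G u).erase v, degIn G S w + ∑ w ∈ (nbrs G v).erase u, degIn G S w := by
  refine (Finset.card_le_card (conflicting_subset hS hadj huv)).trans ?_
  refine (Finset.card_union_le _ _).trans ?_
  gcongr
  · exact Finset.card_biUnion_le.trans (Finset.sum_le_sum fun w _ => card_edgesAt_le hS w)
  · exact Finset.card_biUnion_le.trans (Finset.sum_le_sum fun w _ => card_edgesAt_le hS w)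

lemma sum_degIn_erase_le (hdeg : ∀ v, (nbrs G v).card ≤ 4) (S : Finset (Sym2 V)) {u v : V}
    (hadj : G.Adj u v) : ∑ w ∈ (nbrs G u).erase v, degIn G S w ≤ 12 := by
  have h1 : ((nbrs G u).erase v).card ≤ 3 := by
    rw [Finset.card_erase_of_mem (mem_nbrs.mpr hadj)]
    have := hdeg u
    omega
  calc _ ≤ ∑ w ∈ (nbrs G u).erase v, 4 :=
        Finset.sum_le_sum fun w _ => (degIn_le_card_nbrs S w).trans (hdeg w)
    _ ≤ 12 := by simp only [Finset.sum_const, smul_eq_mul]; omega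

lemma sum_degIn_erase_le_of_zero (hdeg : ∀ v, (nbrs G v).card ≤ 4) (S : Finset (Sym2 V)) {u v w : V}
    (hadj : G.Adj u v) (hw : G.Adj u w) (hwv : w ≠ v) (h0 : degIn G S w = 0) :
    ∑ w ∈ (nbrs G u).erase v, degIn G S w ≤ 8 := by
  have hmem : w ∈ (nbrs G u).erase v := by simp [hw, hwv]
  have h1 : (((nbrs G u).erase v).erase w).card ≤ 2 := by
    rw [Finset.card_erase_of_mem hmem, Finset.card_erase_of_mem (mem_nbrs.mpr hadj)]
    have := hdeg u
    omega
  rw [← Finset.add_sum_erase _ _ hmem, h0, zero_add]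
  calc _ ≤ ∑ w ∈ ((nbrs G u).erase v).erase w, 4 :=
        Finset.sum_le_sum fun w _ => (degIn_le_card_nbrs S w).trans (hdeg w)
    _ ≤ 8 := by simp only [Finset.sum_const, smul_eq_mul]; omega

/-- If some neighbour of `u` other than `v` has no edge in `S`, then `s(u, v)` conflicts with at
most `20` edges of `S`. -/
lemma conflicting_card_le_of_zero (hdeg : ∀ v, (nbrs G v).card ≤ 4) {S : Finset (Sym2 V)}
    (hS : ∀ e ∈ S, e ∈ G.edgeSet) {u v w : V} (hadj : G.Adj u v) (huv : s(u, v) ∉ S)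
    (hw : G.Adj u w) (hwv : w ≠ v) (h0 : degIn G S w = 0) :
    (conflicting G S s(u, v)).card ≤ 20 := by
  have h1 := conflicting_card_le hS hadj huv
  have h2 := sum_degIn_erase_le_of_zero hdeg S hadj hw hwv h0
  have h3 := sum_degIn_erase_le hdeg S hadj.symm
  omega

/-- Extending a partial coloring by compatible available colors. -/
lemma ProperOn.extend {S F : Finset (Sym2 V)} {C c : Sym2 V → Fin 21} (hC : ProperOn G S C)
    (hdisj : ∀ e ∈ F, e ∉ S) (hav : ∀ e ∈ F, c e ∈ avail G S C e)
    (hc : ∀ e ∈ F, ∀ f ∈ F, e ≠ f → StrongConflict G e f → c e ≠ c f) :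
    ∃ C', ProperOn G (S ∪ F) C' ∧ (∀ e ∈ S, C' e = C e) ∧ ∀ e ∈ F, C' e = c e := by
  refine ⟨fun e => if e ∈ F then c e else C e, ?_, ?_, ?_⟩
  · intro e he f hf hne hcon
    by_cases heF : e ∈ F <;> by_cases hfF : f ∈ F
    · simpa [heF, hfF] using hc e heF f hfF hne hcon
    · have hfS : f ∈ S := by simpa [hfF] using hf
      simpa [heF, hfF] using (mem_avail.mp (hav e heF) f hfS hcon).symm
    · have heS : e ∈ S := by simpa [heF] using he
      simpa [heF, hfF] using (mem_avail.mp (hav f hfF) e heS hcon.symm)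
    · have heS : e ∈ S := by simpa [heF] using he
      have hfS : f ∈ S := by simpa [hfF] using hf
      simpa [heF, hfF] using hC e heS f hfS hne hcon
  · intro e he
    have : e ∉ F := fun h => hdisj e h he
    simp [this]
  · intro e he
    simp [he]

/-- Greedy extension, using only colors from the palette `T`. -/
lemma ProperOn.greedy_palette {S : Finset (Sym2 V)} {C : Sym2 V → Fin 21} (hC : ProperOn G S C)
    (T : Finset (Fin 21)) (F : Finset (Sym2 V)) (hdisj : ∀ e ∈ F, e ∉ S)
    (h : ∀ e ∈ F, ∀ S' C', S ⊆ S' → S' ⊆ S ∪ F → e ∉ S' → (∀ f ∈ S, C' f = C f) →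
      (∀ f ∈ S', f ∉ S → C' f ∈ T) → ∃ x ∈ T, x ∈ avail G S' C' e) :
    ∃ C', ProperOn G (S ∪ F) C' ∧ (∀ e ∈ S, C' e = C e) ∧ ∀ e ∈ F, C' e ∈ T := by
  induction F using Finset.induction_on with
  | empty => exact ⟨C, by simpa using hC, fun _ _ => rfl, by simp⟩
  | insert e F he ih =>
    obtain ⟨C1, h1, h2, h3⟩ := ih (fun f hf => hdisj f (Finset.mem_insert_of_mem hf))
      (fun f hf S' C' hSS hSF => h f (Finset.mem_insert_of_mem hf) S' C' hSS
        (hSF.trans (Finset.union_subset_union_right (Finset.subset_insert _ _))))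
    have heS : e ∉ S := hdisj e (Finset.mem_insert_self _ _)
    have heSF : e ∉ S ∪ F := by simp [heS, he]
    obtain ⟨x, hxT, hx⟩ := h e (Finset.mem_insert_self _ _) (S ∪ F) C1 Finset.subset_union_left
      (Finset.union_subset_union_right (Finset.subset_insert _ _)) heSF h2
      (fun f hf hfS => h3 f (by simpa [hfS] using hf))
    obtain ⟨C2, h4, h5, h6⟩ := h1.extend (F := {e}) (c := fun _ => x)
      (by simpa using heSF) (by simpa using hx)
      (by intro a ha b hb hne; simp only [Finset.mem_singleton] at ha hb
          exact absurd (ha.trans hb.symm) hne)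
    refine ⟨C2, ?_, ?_, ?_⟩
    · have : S ∪ insert e F = S ∪ F ∪ {e} := by ext; simp
      rwa [this]
    · intro f hf
      rw [h5 f (Finset.mem_union_left _ hf), h2 f hf]
    · intro f hf
      rcases Finset.mem_insert.mp hf with rfl | hf
      · rw [h6 _ (by simp)]; exact hxT
      · rw [h5 f (Finset.mem_union_right _ hf)]; exact h3 f hf

/-- Greedy extension of a partial coloring. -/
lemma ProperOn.greedy {S : Finset (Sym2 V)} {C : Sym2 V → Fin 21} (hC : ProperOn G S C)
    (F : Finset (Sym2 V))
    (h : ∀ e ∈ F, ∀ S', S ⊆ S' → S' ⊆ S ∪ F → e ∉ S' → (conflicting G S' e).card ≤ 20) :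
    ∃ C', ProperOn G (S ∪ F) C' ∧ ∀ e ∈ S, C' e = C e := by
  obtain ⟨C', h1, h2, -⟩ := hC.greedy_palette Finset.univ (F \ S) (by simp)
    (by
      intro e he S' C' hS hF heS' _ _
      obtain ⟨x, hx⟩ := exists_mem_avail (C := C')
        (h e (Finset.mem_sdiff.mp he).1 S' hS (hF.trans (by simp)) heS')
      exact ⟨x, Finset.mem_univ _, hx⟩)
  exact ⟨C', by simpa using h1, h2⟩

lemma ProperOn.mono {S S' : Finset (Sym2 V)} {C : Sym2 V → Fin 21} (hC : ProperOn G S C)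
    (h : S' ⊆ S) : ProperOn G S' C :=
  fun e he f hf => hC e (h he) f (h hf)

/-- Coloring the edges that meet `D` but not `M`, in order of decreasing rank. -/
lemma ProperOn.flow (hdeg : ∀ v, (nbrs G v).card ≤ 4) {D M : Finset V} (hMD : M ⊆ D)
    {C : Sym2 V → Fin 21} (hC : ProperOn G (edgesAvoid G D) C) (ρ : V → ℕ)
    (hρ : ∀ t ∈ D, t ∉ M → ∃ w ∈ D, G.Adj t w ∧ ρ w < ρ t) :
    ∃ C', ProperOn G (edgesAvoid G M) C' ∧ ∀ e ∈ edgesAvoid G D, C' e = C e := by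
  have step : ∀ n, ∀ A : Finset V, A = D.filter (fun v => v ∈ M ∨ ρ v < n) →
      ∀ C₁ : Sym2 V → Fin 21, ProperOn G (edgesAvoid G A) C₁ →
      (∀ e ∈ edgesAvoid G D, C₁ e = C e) →
      ∃ C', ProperOn G (edgesAvoid G M) C' ∧ ∀ e ∈ edgesAvoid G D, C' e = C e := by
    intro n
    induction n with
    | zero =>
      intro A hA C₁ h1 h2
      have : A = M := by
        subst hA; ext v; simp only [Finset.mem_filter, not_lt_zero, or_false]
        exact ⟨fun h => h.2, fun h => ⟨hMD h, h⟩⟩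
      exact ⟨C₁, this ▸ h1, h2⟩
    | succ n ih =>
      intro A hA C₁ h1 h2
      set B := D.filter (fun v => v ∈ M ∨ ρ v < n) with hB
      have hBA : B ⊆ A := by
        intro v; simp only [hA, hB, Finset.mem_filter]; rintro ⟨h, h' | h'⟩
        · exact ⟨h, Or.inl h'⟩
        · exact ⟨h, Or.inr (by omega)⟩
      have hAD : A ⊆ D := by rw [hA]; exact Finset.filter_subset _ _
      have hsub : edgesAvoid G A ⊆ edgesAvoid G B := by
        intro e; simp only [mem_edgesAvoid]
        exact fun h => ⟨h.1, fun v hv hvB => h.2 v hv (hBA hvB)⟩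
      obtain ⟨C₂, h3, h4⟩ := h1.greedy (edgesAvoid G B) (by
        intro e he S' hS1 hS2 heS'
        rw [Finset.union_eq_right.mpr hsub] at hS2
        have heA : ¬ ∀ v ∈ e, v ∉ A := fun h =>
          heS' (hS1 (mem_edgesAvoid.mpr ⟨(mem_edgesAvoid.mp he).1, h⟩))
        push Not at heA
        obtain ⟨t, hte, htA⟩ := heA
        obtain ⟨m, rfl⟩ := Sym2.mem_iff_exists.mp hte
        obtain ⟨hadj, hB'⟩ := mem_edgesAvoid.mp he
        have htB : t ∉ B := hB' t (by simp)
        have hmB : m ∉ B := hB' m (by simp)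
        have htD : t ∈ D := hAD htA
        have htM : t ∉ M := fun h => htB (by simp [hB, htD, h])
        obtain ⟨w, hwD, htw, hlt⟩ := hρ t htD htM
        have hρt : ρ t ≤ n := by
          rw [hA] at htA
          have := (Finset.mem_filter.mp htA).2
          rcases this with h | h
          · exact absurd h htM
          · omega
        have hwB : w ∈ B := by
          simp only [hB, Finset.mem_filter]; exact ⟨hwD, Or.inr (by omega)⟩
        refine conflicting_card_le_of_zero hdeg
          (fun e he => (mem_edgesAvoid.mp (hS2 he)).1) hadj heS' htw
          (fun h => hmB (h ▸ hwB)) (degIn_eq_zero fun x _ hx => ?_)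
        exact (mem_edgesAvoid.mp (hS2 hx)).2 w (by simp) hwB)
      rw [Finset.union_eq_right.mpr hsub] at h3
      refine ih B rfl C₂ h3 fun e he => ?_
      rw [h4 e, h2 e he]
      exact mem_edgesAvoid.mpr ⟨(mem_edgesAvoid.mp he).1,
        fun v hv hvA => (mem_edgesAvoid.mp he).2 v hv (hAD hvA)⟩
  refine step (D.sup ρ + 1) _ rfl C (hC.mono ?_) fun _ _ => rfl
  intro e he
  refine mem_edgesAvoid.mpr ⟨(mem_edgesAvoid.mp he).1, fun v hv hvD => ?_⟩
  refine (mem_edgesAvoid.mp he).2 v hv ?_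
  simp only [Finset.mem_filter]
  exact ⟨hvD, Or.inr (Nat.lt_succ_of_le (Finset.le_sup hvD))⟩

lemma exists_adj_dist_lt {H : SimpleGraph V} {u t : V} (h : H.Reachable u t) (hne : t ≠ u) :
    ∃ w, H.Adj t w ∧ H.Reachable u w ∧ H.dist u w < H.dist u t := by
  obtain ⟨p, hp⟩ := h.symm.exists_walk_length_eq_dist
  cases p with
  | nil => exact absurd rfl hne
  | @cons _ w _ hadj q =>
    refine ⟨w, hadj, q.reachable.symm, ?_⟩
    rw [SimpleGraph.dist_comm, SimpleGraph.dist_comm (v := t), ← hp]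
    have := SimpleGraph.dist_le q
    simp only [SimpleGraph.Walk.length_cons]
    omega

/-- In a connected graph all edges avoiding a nonempty set can be colored. -/
lemma exists_properOn_edgesAvoid (hdeg : ∀ v, (nbrs G v).card ≤ 4) (hconn : G.Connected)
    {M : Finset V} (hM : M.Nonempty) : ∃ C, ProperOn G (edgesAvoid G M) C := by
  obtain ⟨u, hu⟩ := hM
  have h0 : edgesAvoid G Finset.univ = ∅ := by
    ext e
    induction e with | _ x y =>
    simp only [mem_edgesAvoid, Finset.mem_univ, not_true_eq_false, Finset.notMem_empty, iff_false]
    exact fun h => h.2 x (by simp)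
  obtain ⟨C, hC, -⟩ := ProperOn.flow (G := G) hdeg (Finset.subset_univ M) (C := fun _ => 0)
    (by rw [h0]; intro e he; simp at he) (G.dist u) (by
      intro t _ htM
      obtain ⟨w, h1, -, h2⟩ := exists_adj_dist_lt (hconn u t) (fun h => htM (h ▸ hu))
      exact ⟨w, Finset.mem_univ _, h1, h2⟩)
  exact ⟨C, hC⟩

end Basic

section Local

open scoped Classical

variable {V : Type*} [Fintype V] {G : SimpleGraph V}

open scoped Classical in
/-- The edges of `G` having an endpoint outside `M`. -/
noncomputable def edgesNotInside (G : SimpleGraph V) (M : Finset V) : Finset (Sym2 V) :=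
  Finset.univ.filter fun e => e ∈ G.edgeSet ∧ ∃ v ∈ e, v ∉ M

@[simp] lemma mem_edgesNotInside {M : Finset V} {e : Sym2 V} :
    e ∈ edgesNotInside G M ↔ e ∈ G.edgeSet ∧ ∃ v ∈ e, v ∉ M := by simp [edgesNotInside]

/-- `G` has a strong edge-coloring with `21` colors, given as a coloring of all pairs. -/
def StrongColorable (G : SimpleGraph V) : Prop := ∃ C, ProperOn G (edgesAvoid G ∅) C

lemma ProperOn.strongColorable {S : Finset (Sym2 V)} {C : Sym2 V → Fin 21} (hC : ProperOn G S C)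
    (hS : ∀ u v, G.Adj u v → s(u, v) ∈ S) : StrongColorable G := by
  refine ⟨C, hC.mono fun e he => ?_⟩
  induction e with | _ x y =>
  exact hS x y (mem_edgesAvoid.mp he).1

/-- Completing a partial coloring greedily to all edges. -/
lemma ProperOn.greedy_all {S : Finset (Sym2 V)} {C : Sym2 V → Fin 21} (hC : ProperOn G S C)
    (hS : ∀ e ∈ S, e ∈ G.edgeSet)
    (h : ∀ u v, G.Adj u v → s(u, v) ∉ S → ∀ S', S ⊆ S' → (∀ e ∈ S', e ∈ G.edgeSet) →
      s(u, v) ∉ S' → (conflicting G S' s(u, v)).card ≤ 20) : StrongColorable G := by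
  obtain ⟨C', h1, -⟩ := hC.greedy (edgesAvoid G ∅) (by
    intro e he S' h1 h2 h3
    induction e with | _ u v =>
    refine h u v (mem_edgesAvoid.mp he).1 (fun hh => h3 (h1 hh)) S' h1 (fun f hf => ?_) h3
    rcases Finset.mem_union.mp (h2 hf) with hf | hf
    · exact hS f hf
    · exact (mem_edgesAvoid.mp hf).1)
  exact ⟨C', h1.mono Finset.subset_union_right⟩

lemma strongColorable_of_card_nbrs_le_three (hdeg : ∀ v, (nbrs G v).card ≤ 4) (hconn : G.Connected)
    {v : V} (hv : (nbrs G v).card ≤ 3) : StrongColorable G := by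
  obtain ⟨C, hC⟩ := exists_properOn_edgesAvoid hdeg hconn (M := {v}) (by simp)
  have key : ∀ x S', G.Adj v x → (∀ e ∈ S', e ∈ G.edgeSet) → s(v, x) ∉ S' →
      (conflicting G S' s(v, x)).card ≤ 20 := by
    intro x S' hx hS' hxS
    have h1 := conflicting_card_le hS' hx hxS
    have h2 := sum_degIn_erase_le hdeg S' hx.symm
    have h3 : ((nbrs G v).erase x).card ≤ 2 := by
      rw [Finset.card_erase_of_mem (mem_nbrs.mpr hx)]; omega
    have h4 : ∑ w ∈ (nbrs G v).erase x, degIn G S' w ≤ 8 := by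
      calc _ ≤ ∑ w ∈ (nbrs G v).erase x, 4 :=
            Finset.sum_le_sum fun w _ => (degIn_le_card_nbrs S' w).trans (hdeg w)
        _ ≤ 8 := by simp only [Finset.sum_const, smul_eq_mul]; omega
    omega
  refine hC.greedy_all (fun e he => (mem_edgesAvoid.mp he).1) ?_
  intro x y hxy hnot S' _ hS' hxyS
  by_cases hx : x = v
  · subst hx; exact key y S' hxy hS' hxyS
  by_cases hy : y = v
  · subst hy
    rw [Sym2.eq_swap] at hxyS ⊢
    exact key x S' hxy.symm hS' hxyS
  · refine absurd (mem_edgesAvoid.mpr ⟨hxy, ?_⟩) hnot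
    simp [hx, hy]

/-- If every vertex of `M` has two neighbours in `M`, then all edges not inside `M` can be
colored. -/
lemma exists_properOn_edgesNotInside (hdeg : ∀ v, (nbrs G v).card ≤ 4) (hconn : G.Connected)
    {M : Finset V} (hM : M.Nonempty) (h2 : ∀ u ∈ M, 2 ≤ (nbrs G u ∩ M).card) :
    ∃ C, ProperOn G (edgesNotInside G M) C := by
  obtain ⟨C, hC⟩ := exists_properOn_edgesAvoid hdeg hconn hM
  have hsub : edgesAvoid G M ⊆ edgesNotInside G M := by
    intro e he
    induction e with | _ x y =>
    obtain ⟨h1, h2⟩ := mem_edgesAvoid.mp he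
    exact mem_edgesNotInside.mpr ⟨h1, x, by simp, h2 x (by simp)⟩
  obtain ⟨C', h3, -⟩ := hC.greedy (edgesNotInside G M) (by
    intro e he S' hS1 hS2 heS'
    rw [Finset.union_eq_right.mpr hsub] at hS2
    have hS' : ∀ e ∈ S', e ∈ G.edgeSet := fun e he => (mem_edgesNotInside.mp (hS2 he)).1
    have key : ∀ u v, G.Adj u v → u ∈ M → v ∉ M → s(u, v) ∉ S' →
        (conflicting G S' s(u, v)).card ≤ 20 := by
      intro u v huv hu hv hS
      have h4 := conflicting_card_le hS' huv hS
      have h5 := sum_degIn_erase_le hdeg S' huv.symm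
      have hK : ((nbrs G u).erase v).card ≤ 3 := by
        rw [Finset.card_erase_of_mem (mem_nbrs.mpr huv)]
        have := hdeg u
        omega
      have hKM : 2 ≤ ((nbrs G u).erase v ∩ M).card := by
        refine (h2 u hu).trans (Finset.card_le_card ?_)
        intro x hx
        simp only [Finset.mem_inter, Finset.mem_erase] at hx ⊢
        exact ⟨⟨fun h => hv (h ▸ hx.2), hx.1⟩, hx.2⟩
      have hsplit := Finset.card_inter_add_card_sdiff ((nbrs G u).erase v) M
      have h6 : ∑ w ∈ (nbrs G u).erase v ∩ M, degIn G S' w ≤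
          2 * ((nbrs G u).erase v ∩ M).card := by
        rw [mul_comm]
        refine Finset.sum_le_card_nsmul _ _ _ fun w hw => ?_
        have hwM : w ∈ M := (Finset.mem_inter.mp hw).2
        have h7 : degIn G S' w ≤ (nbrs G w \ M).card := degIn_le_of_subset fun x hwx hx => by
          obtain ⟨-, z, hz, hzM⟩ := mem_edgesNotInside.mp (hS2 hx)
          rcases Sym2.mem_iff.mp hz with rfl | rfl
          · exact absurd hwM hzM
          · simp [hwx, hzM]
        have h8 := Finset.card_inter_add_card_sdiff (nbrs G w) M
        have := h2 w hwM
        have := hdeg w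
        omega
      have h7 : ∑ w ∈ (nbrs G u).erase v \ M, degIn G S' w ≤
          4 * ((nbrs G u).erase v \ M).card := by
        rw [mul_comm]
        exact Finset.sum_le_card_nsmul _ _ _ fun w _ => (degIn_le_card_nbrs S' w).trans (hdeg w)
      have h8 := Finset.sum_inter_add_sum_sdiff ((nbrs G u).erase v) M (degIn G S')
      omega
    induction e with | _ x y =>
    obtain ⟨hadj, z, hz, hzM⟩ := mem_edgesNotInside.mp he
    have hne : ¬ (x ∉ M ∧ y ∉ M) := fun h => heS' (hS1 (mem_edgesAvoid.mpr ⟨hadj, by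
      simpa using h⟩))
    by_cases hx : x ∈ M
    · refine key x y hadj hx (fun hy => ?_) heS'
      rcases Sym2.mem_iff.mp hz with rfl | rfl <;> exact hzM ‹_›
    · have hy : y ∈ M := by by_contra hy; exact hne ⟨hx, hy⟩
      rw [Sym2.eq_swap] at heS' ⊢
      exact key y x hadj.symm hy hx heS')
  exact ⟨C', h3.mono Finset.subset_union_right⟩

lemma conflicting_card_le_of_common (hdeg : ∀ v, (nbrs G v).card ≤ 4) {S : Finset (Sym2 V)}
    (hS : ∀ e ∈ S, e ∈ G.edgeSet) {u v w : V} (hadj : G.Adj u v) (huv : s(u, v) ∉ S)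
    (huw : G.Adj u w) (hvw : G.Adj v w) : (conflicting G S s(u, v)).card ≤ 20 := by
  have h1 := conflicting_subset hS hadj huv
  rw [← Finset.union_biUnion] at h1
  have hc : ((nbrs G u).erase v ∪ (nbrs G v).erase u).card ≤ 5 := by
    have h2 := Finset.card_union_add_card_inter ((nbrs G u).erase v) ((nbrs G v).erase u)
    have h3 : 1 ≤ ((nbrs G u).erase v ∩ (nbrs G v).erase u).card :=
      Finset.card_pos.mpr ⟨w, by simp [huw, hvw, huw.ne']⟩
    rw [Finset.card_erase_of_mem (mem_nbrs.mpr hadj),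
      Finset.card_erase_of_mem (mem_nbrs.mpr hadj.symm)] at h2
    have := hdeg u
    have := hdeg v
    omega
  calc _ ≤ _ := Finset.card_le_card h1
    _ ≤ _ := Finset.card_biUnion_le
    _ ≤ _ := Finset.sum_le_card_nsmul _ _ 4 fun w _ =>
      (card_edgesAt_le hS w).trans ((degIn_le_card_nbrs S w).trans (hdeg w))
    _ ≤ 20 := by simp only [smul_eq_mul]; omega

lemma strongColorable_of_triangle (hdeg : ∀ v, (nbrs G v).card ≤ 4) (hconn : G.Connected)
    {a b c : V} (hab : G.Adj a b) (hbc : G.Adj b c) (hac : G.Adj a c) : StrongColorable G := by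
  have hnbr : ∀ u ∈ ({a, b, c} : Finset V), ∀ v ∈ ({a, b, c} : Finset V), G.Adj u v →
      ∃ w ∈ ({a, b, c} : Finset V), G.Adj u w ∧ G.Adj v w := by
    intro u hu v hv huv
    simp only [Finset.mem_insert, Finset.mem_singleton] at hu hv
    rcases hu with rfl | rfl | rfl <;> rcases hv with rfl | rfl | rfl <;>
      simp_all [SimpleGraph.adj_comm]
  obtain ⟨C, hC⟩ := exists_properOn_edgesNotInside hdeg hconn (M := {a, b, c}) (by simp) (by
    have key : ∀ x y z : V, G.Adj x y → G.Adj x z → y ≠ z → y ∈ ({a, b, c} : Finset V) →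
        z ∈ ({a, b, c} : Finset V) → 2 ≤ (nbrs G x ∩ {a, b, c}).card := by
      intro x y z hy hz hne hy' hz'
      rw [← Finset.card_pair hne]
      apply Finset.card_le_card
      intro w hw
      rcases Finset.mem_insert.mp hw with rfl | hw
      · exact Finset.mem_inter.mpr ⟨mem_nbrs.mpr hy, hy'⟩
      · rw [Finset.mem_singleton] at hw
        subst hw
        exact Finset.mem_inter.mpr ⟨mem_nbrs.mpr hz, hz'⟩
    intro u hu
    simp only [Finset.mem_insert, Finset.mem_singleton] at hu
    rcases hu with rfl | rfl | rfl
    · exact key _ _ _ hab hac hbc.ne (by simp) (by simp)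
    · exact key _ _ _ hab.symm hbc hac.ne (by simp) (by simp)
    · exact key _ _ _ hac.symm hbc.symm hab.ne (by simp) (by simp))
  refine hC.greedy_all (fun e he => (mem_edgesNotInside.mp he).1) ?_
  intro u v huv hnot S' _ hS' huvS
  have hin : u ∈ ({a, b, c} : Finset V) ∧ v ∈ ({a, b, c} : Finset V) := by
    by_contra hcon
    refine hnot (mem_edgesNotInside.mpr ⟨huv, ?_⟩)
    by_cases hu : u ∈ ({a, b, c} : Finset V)
    · exact ⟨v, by simp, fun hv => hcon ⟨hu, hv⟩⟩
    · exact ⟨u, by simp, hu⟩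
  obtain ⟨w, -, h1, h2⟩ := hnbr u hin.1 v hin.2 huv
  exact conflicting_card_le_of_common hdeg hS' huv huvS h1 h2

end Local

section Hall

variable {α : Type*} [DecidableEq α]

/-- Hall's theorem for lists of colors on a finset. -/
lemma exists_injOn_of_hall (U : Finset α) (L : α → Finset (Fin 21))
    (h : ∀ T ⊆ U, T.card ≤ (T.biUnion L).card) :
    ∃ c : α → Fin 21, (∀ e ∈ U, c e ∈ L e) ∧ ∀ e ∈ U, ∀ f ∈ U, e ≠ f → c e ≠ c f := by
  obtain ⟨g, hg1, hg2⟩ := (Finset.all_card_le_biUnion_card_iff_exists_injective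
    (fun e : U => L e)).mp (by
      intro T
      have h1 := h (T.map (Function.Embedding.subtype _)) (by
        intro x hx
        obtain ⟨y, -, rfl⟩ := Finset.mem_map.mp hx
        exact y.2)
      rw [Finset.card_map, Finset.map_eq_image, Finset.image_biUnion] at h1
      exact h1)
  refine ⟨fun e => if he : e ∈ U then g ⟨e, he⟩ else 0, ?_, ?_⟩
  · intro e he
    simpa [he] using hg2 ⟨e, he⟩
  · intro e he f hf hne
    simp only [he, hf, dite_true]
    intro heq
    exact hne (congrArg Subtype.val (hg1 heq))

/-- A set containing no pair of `P` has at most one element from each pair. -/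
lemma card_inter_pairs_le (P : Finset (α × α)) (T : Finset α)
    (hT : ∀ p ∈ P, ¬ (p.1 ∈ T ∧ p.2 ∈ T)) :
    (T ∩ (P.image Prod.fst ∪ P.image Prod.snd)).card ≤ P.card := by
  have : T ∩ (P.image Prod.fst ∪ P.image Prod.snd) ⊆
      P.image fun p => if p.1 ∈ T then p.1 else p.2 := by
    intro x hx
    simp only [Finset.mem_inter, Finset.mem_union, Finset.mem_image] at hx ⊢
    obtain ⟨hx, ⟨p, hp, rfl⟩ | ⟨p, hp, rfl⟩⟩ := hx
    · exact ⟨p, hp, by simp [hx]⟩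
    · exact ⟨p, hp, by have := hT p hp; simp_all⟩
  exact (Finset.card_le_card this).trans Finset.card_image_le

/-- List coloring of `U` where the elements of each pair in `P` may share a color. -/
lemma exists_coloring_of_pairs (n : ℕ) : ∀ (P : Finset (α × α)) (Sm Bg : Finset α)
    (L : α → Finset (Fin 21)) (t B : ℕ), P.card = n →
    (P.Nonempty → 2 * P.card + Sm.card + Bg.card ≤ 2 * t) →
    P.card + Sm.card ≤ t → P.card + Sm.card + Bg.card ≤ B →
    (∀ e ∈ P.image Prod.fst ∪ P.image Prod.snd ∪ Sm, t ≤ (L e).card) →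
    (∀ e ∈ Bg, B ≤ (L e).card) →
    ∃ c : α → Fin 21, (∀ e ∈ P.image Prod.fst ∪ P.image Prod.snd ∪ Sm ∪ Bg, c e ∈ L e) ∧
      ∀ e ∈ P.image Prod.fst ∪ P.image Prod.snd ∪ Sm ∪ Bg,
      ∀ f ∈ P.image Prod.fst ∪ P.image Prod.snd ∪ Sm ∪ Bg, e ≠ f → c e = c f →
        (e, f) ∈ P ∨ (f, e) ∈ P := by
  induction n with
  | zero =>
    intro P Sm Bg L t B hn _ h2 h3 h4 h5
    obtain rfl : P = ∅ := Finset.card_eq_zero.mp hn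
    simp only [Finset.card_empty, zero_add] at h2 h3
    simp only [Finset.image_empty, Finset.empty_union] at h4 ⊢
    obtain ⟨c, hc1, hc2⟩ := exists_injOn_of_hall (Sm ∪ Bg) L (by
      intro T hT
      rcases T.eq_empty_or_nonempty with rfl | ⟨e, he⟩
      · simp
      by_cases hB : ∃ f ∈ T, f ∈ Bg
      · obtain ⟨f, hf, hfB⟩ := hB
        calc T.card ≤ (Sm ∪ Bg).card := Finset.card_le_card hT
          _ ≤ Sm.card + Bg.card := Finset.card_union_le _ _
          _ ≤ B := h3
          _ ≤ (L f).card := h5 f hfB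
          _ ≤ _ := Finset.card_le_card (Finset.subset_biUnion_of_mem L hf)
      · have hTS : T ⊆ Sm := fun f hf => (Finset.mem_union.mp (hT hf)).resolve_right
          fun h => hB ⟨f, hf, h⟩
        calc T.card ≤ Sm.card := Finset.card_le_card hTS
          _ ≤ t := h2
          _ ≤ (L e).card := h4 e (hTS he)
          _ ≤ _ := Finset.card_le_card (Finset.subset_biUnion_of_mem L he))
    exact ⟨c, hc1, fun e he f hf hne heq => absurd heq (hc2 e he f hf hne)⟩
  | succ n ih =>
    intro P Sm Bg L t B hn h1 h2 h3 h4 h5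
    have hPne : P.Nonempty := Finset.card_pos.mp (by omega)
    specialize h1 hPne
    by_cases hcommon : ∃ p ∈ P, ∃ x, x ∈ L p.1 ∧ x ∈ L p.2
    · obtain ⟨p, hp, x, hx1, hx2⟩ := hcommon
      have hcard : (P.erase p).card = n := by rw [Finset.card_erase_of_mem hp]; omega
      have herase : ∀ e, (L e).card ≤ ((L e).erase x).card + 1 := fun e => by
        have := Finset.pred_card_le_card_erase (s := L e) (a := x)
        omega
      have hsub : ∀ e, e ∈ (P.erase p).image Prod.fst ∪ (P.erase p).image Prod.snd →
          e ∈ P.image Prod.fst ∪ P.image Prod.snd := by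
        intro e he
        simp only [Finset.mem_union, Finset.mem_image, Finset.mem_erase] at he ⊢
        rcases he with ⟨q, hq, rfl⟩ | ⟨q, hq, rfl⟩
        · exact Or.inl ⟨q, hq.2, rfl⟩
        · exact Or.inr ⟨q, hq.2, rfl⟩
      obtain ⟨c, hc1, hc2⟩ := ih (P.erase p) Sm Bg (fun e => (L e).erase x) (t - 1) (B - 1)
        hcard (by omega) (by omega) (by omega) (by
          intro e he
          have : t ≤ (L e).card := h4 e (by
            rcases Finset.mem_union.mp he with he | he
            · exact Finset.mem_union_left _ (hsub e he)
            · exact Finset.mem_union_right _ he)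
          have := herase e
          omega) (by
          intro e he
          have := h5 e he
          have := herase e
          omega)
      have hcover : ∀ e ∈ P.image Prod.fst ∪ P.image Prod.snd ∪ Sm ∪ Bg, e ≠ p.1 → e ≠ p.2 →
          e ∈ (P.erase p).image Prod.fst ∪ (P.erase p).image Prod.snd ∪ Sm ∪ Bg := by
        intro e he hne1 hne2
        simp only [Finset.mem_union, Finset.mem_image, Finset.mem_erase] at he ⊢
        rcases he with ((⟨q, hq, rfl⟩ | ⟨q, hq, rfl⟩) | he) | he
        · exact Or.inl (Or.inl (Or.inl ⟨q, ⟨fun h => hne1 (h ▸ rfl), hq⟩, rfl⟩))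
        · exact Or.inl (Or.inl (Or.inr ⟨q, ⟨fun h => hne2 (h ▸ rfl), hq⟩, rfl⟩))
        · exact Or.inl (Or.inr he)
        · exact Or.inr he
      refine ⟨fun e => if e = p.1 ∨ e = p.2 then x else c e, ?_, ?_⟩
      · intro e he
        by_cases hep : e = p.1 ∨ e = p.2
        · simp only [hep, if_true]
          rcases hep with rfl | rfl <;> assumption
        · simp only [hep, if_false]
          push Not at hep
          exact Finset.mem_of_mem_erase (hc1 e (hcover e he hep.1 hep.2))
      · intro e he f hf hne heq
        by_cases hep : e = p.1 ∨ e = p.2 <;> by_cases hfp : f = p.1 ∨ f = p.2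
        · rcases hep with rfl | rfl <;> rcases hfp with rfl | rfl
          · exact absurd rfl hne
          · exact Or.inl hp
          · exact Or.inr hp
          · exact absurd rfl hne
        · simp only [hep, hfp, if_true, if_false] at heq
          push Not at hfp
          have := hc1 f (hcover f hf hfp.1 hfp.2)
          exact absurd heq.symm (Finset.ne_of_mem_erase this)
        · simp only [hep, hfp, if_true, if_false] at heq
          push Not at hep
          have := hc1 e (hcover e he hep.1 hep.2)
          exact absurd heq (Finset.ne_of_mem_erase this)
        · simp only [hep, hfp, if_false] at heq
          push Not at hep hfp
          have := hc2 e (hcover e he hep.1 hep.2) f (hcover f hf hfp.1 hfp.2) hne heq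
          exact this.imp Finset.mem_of_mem_erase Finset.mem_of_mem_erase
    · push Not at hcommon
      obtain ⟨c, hc1, hc2⟩ := exists_injOn_of_hall
        (P.image Prod.fst ∪ P.image Prod.snd ∪ Sm ∪ Bg) L (by
        intro T hT
        rcases T.eq_empty_or_nonempty with rfl | ⟨e, he⟩
        · simp
        have hsplit : T ⊆ (T ∩ (P.image Prod.fst ∪ P.image Prod.snd)) ∪ Sm ∪ Bg := by
          intro x hx
          have := hT hx
          simp only [Finset.mem_union, Finset.mem_inter] at this ⊢
          tauto
        by_cases hpair : ∃ p ∈ P, p.1 ∈ T ∧ p.2 ∈ T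
        · obtain ⟨p, hp, hp1, hp2⟩ := hpair
          have hd : Disjoint (L p.1) (L p.2) :=
            Finset.disjoint_left.mpr fun x hx1 hx2 => hcommon p hp x hx1 hx2
          have h6 : t ≤ (L p.1).card := h4 _ (by
            simp only [Finset.mem_union, Finset.mem_image]
            exact Or.inl (Or.inl ⟨p, hp, rfl⟩))
          have h7 : t ≤ (L p.2).card := h4 _ (by
            simp only [Finset.mem_union, Finset.mem_image]
            exact Or.inl (Or.inr ⟨p, hp, rfl⟩))
          have h8 := Finset.card_le_card (Finset.union_subset
            (Finset.subset_biUnion_of_mem L hp1) (Finset.subset_biUnion_of_mem L hp2))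
          rw [Finset.card_union_of_disjoint hd] at h8
          have h9 := Finset.card_le_card hT
          have h10 := Finset.card_union_le (P.image Prod.fst ∪ P.image Prod.snd ∪ Sm) Bg
          have h11 := Finset.card_union_le (P.image Prod.fst ∪ P.image Prod.snd) Sm
          have h12 := Finset.card_union_le (P.image Prod.fst) (P.image Prod.snd)
          have h13 : (P.image Prod.fst).card ≤ P.card := Finset.card_image_le
          have h14 : (P.image Prod.snd).card ≤ P.card := Finset.card_image_le
          omega
        · have hk := card_inter_pairs_le P T fun p hp h => hpair ⟨p, hp, h⟩
          by_cases hB : ∃ f ∈ T, f ∈ Bg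
          · obtain ⟨f, hf, hfB⟩ := hB
            have h6 := Finset.card_le_card (Finset.subset_biUnion_of_mem L hf)
            have h7 := h5 f hfB
            have h8 := Finset.card_le_card hsplit
            have h9 := Finset.card_union_le (T ∩ (P.image Prod.fst ∪ P.image Prod.snd) ∪ Sm) Bg
            have h10 := Finset.card_union_le (T ∩ (P.image Prod.fst ∪ P.image Prod.snd)) Sm
            omega
          · have hTS : T ⊆ (T ∩ (P.image Prod.fst ∪ P.image Prod.snd)) ∪ Sm := fun f hf =>
              (Finset.mem_union.mp (hsplit hf)).resolve_right fun h => hB ⟨f, hf, h⟩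
            have h6 := Finset.card_le_card (Finset.subset_biUnion_of_mem L he)
            have h7 := h4 e (by
              have := hTS he
              simp only [Finset.mem_union, Finset.mem_inter] at this ⊢
              tauto)
            have h8 := Finset.card_le_card hTS
            have h10 := Finset.card_union_le (T ∩ (P.image Prod.fst ∪ P.image Prod.snd)) Sm
            omega)
      exact ⟨c, hc1, fun e he f hf hne heq => absurd heq (hc2 e he f hf hne)⟩

end Hall

section Cycle

open scoped Classical

variable {V : Type*} [Fintype V] {G : SimpleGraph V}

/-- The neighbours of `v` are exactly `p`, `q`, `r`, `t`. -/
def NbrsAre (G : SimpleGraph V) (v p q r t : V) : Prop :=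
  ∀ x, G.Adj v x ↔ x = p ∨ x = q ∨ x = r ∨ x = t

lemma NbrsAre.second {v p q r t : V} (h : NbrsAre G v p q r t) : NbrsAre G v q p r t :=
  fun x => by rw [h x]; tauto

lemma NbrsAre.third {v p q r t : V} (h : NbrsAre G v p q r t) : NbrsAre G v r p q t :=
  fun x => by rw [h x]; tauto

lemma NbrsAre.fourth {v p q r t : V} (h : NbrsAre G v p q r t) : NbrsAre G v t p q r :=
  fun x => by rw [h x]; tauto

lemma edgesAvoid_subset_edgeSet {M : Finset V} : ∀ e ∈ edgesAvoid G M, e ∈ G.edgeSet :=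
  fun _ he => (mem_edgesAvoid.mp he).1

lemma sum_erase_le {u v p q r : V} (f : V → ℕ)
    (h : ∀ x, G.Adj u x → x = v ∨ x = p ∨ x = q ∨ x = r) :
    ∑ w ∈ (nbrs G u).erase v, f w ≤ f p + f q + f r := by
  have hsub : (nbrs G u).erase v ⊆ {p, q, r} := by
    intro x hx
    simp only [Finset.mem_erase, mem_nbrs] at hx
    have := h x hx.2
    simp only [Finset.mem_insert, Finset.mem_singleton]
    tauto
  have hins : ∀ (a : V) (s : Finset V), ∑ w ∈ insert a s, f w ≤ f a + ∑ w ∈ s, f w := by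
    intro a s
    by_cases ha : a ∈ s
    · rw [Finset.insert_eq_of_mem ha]; omega
    · rw [Finset.sum_insert ha]
  have h1 := Finset.sum_le_sum_of_subset (f := f) hsub
  have h2 := hins p {q, r}
  have h3 := hins q {r}
  rw [Finset.sum_singleton] at h3
  omega

lemma degIn_edgesAvoid_eq_zero {M : Finset V} {w : V} (hw : w ∈ M) :
    degIn G (edgesAvoid G M) w = 0 :=
  degIn_eq_zero fun _ _ h => (mem_edgesAvoid.mp h).2 w (by simp) hw

lemma degIn_edgesAvoid_add_card_le (hdeg : ∀ v, (nbrs G v).card ≤ 4) {M K : Finset V} {w : V}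
    (hK : ∀ m ∈ K, m ∈ M ∧ G.Adj w m) : degIn G (edgesAvoid G M) w + K.card ≤ 4 := by
  have h1 : degIn G (edgesAvoid G M) w ≤ (nbrs G w \ K).card := degIn_le_of_subset fun x hx hS => by
    simp only [Finset.mem_sdiff, mem_nbrs]
    exact ⟨hx, fun hxK => (mem_edgesAvoid.mp hS).2 x (by simp) (hK x hxK).1⟩
  have h2 : K ⊆ nbrs G w := fun m hm => mem_nbrs.mpr (hK m hm).2
  have h3 := Finset.card_sdiff_add_card_eq_card h2
  have := hdeg w
  omega

lemma degIn_edgesAvoid_le_three (hdeg : ∀ v, (nbrs G v).card ≤ 4) {M : Finset V} {w m : V}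
    (hm : m ∈ M) (hw : G.Adj m w) : degIn G (edgesAvoid G M) w ≤ 3 := by
  have := degIn_edgesAvoid_add_card_le (K := {m}) hdeg (M := M) (w := w) (by
    simp [hm, hw.symm])
  simp only [Finset.card_singleton] at this
  omega

lemma degIn_edgesAvoid_le_two (hdeg : ∀ v, (nbrs G v).card ≤ 4) {M : Finset V} {w m n : V}
    (hm : m ∈ M) (hn : n ∈ M) (hne : m ≠ n) (hw : G.Adj m w) (hw' : G.Adj n w) :
    degIn G (edgesAvoid G M) w ≤ 2 := by
  have := degIn_edgesAvoid_add_card_le (K := {m, n}) hdeg (M := M) (w := w) (by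
    simp [hm, hw.symm, hn, hw'.symm])
  rw [Finset.card_pair hne] at this
  omega

lemma mk_notMem_edgesAvoid {M : Finset V} {u v : V} (hu : u ∈ M) : s(u, v) ∉ edgesAvoid G M :=
  fun h => (mem_edgesAvoid.mp h).2 u (by simp) hu

/-- Bounding conflicts through the two neighbourhoods. -/
lemma conflicting_edgesAvoid_le {M : Finset V} {u v p q r : V} {n : ℕ} (huM : u ∈ M)
    (hu : NbrsAre G u v p q r)
    (hv : ∑ w ∈ (nbrs G v).erase u, degIn G (edgesAvoid G M) w ≤ n) :
    (conflicting G (edgesAvoid G M) s(u, v)).card ≤ degIn G (edgesAvoid G M) p +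
      degIn G (edgesAvoid G M) q + degIn G (edgesAvoid G M) r + n := by
  have h1 := conflicting_card_le edgesAvoid_subset_edgeSet ((hu v).mpr (Or.inl rfl))
    (mk_notMem_edgesAvoid (v := v) huM)
  have h2 := sum_erase_le (degIn G (edgesAvoid G M)) (v := v) (p := p) (q := q) (r := r)
    (fun x hx => (hu x).mp hx)
  omega

/-- Coloring all edges meeting `M` at once, letting each pair of `P` share a color. -/
lemma strongColorable_of_pairs (hdeg : ∀ v, (nbrs G v).card ≤ 4) (hconn : G.Connected)
    {M : Finset V} (hM : M.Nonempty) (P : Finset (Sym2 V × Sym2 V)) (Sm Bg : Finset (Sym2 V))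
    (t B : ℕ)
    (hcover : ∀ u v, G.Adj u v → u ∈ M →
      s(u, v) ∈ P.image Prod.fst ∪ P.image Prod.snd ∪ Sm ∪ Bg)
    (hP : ∀ p ∈ P, ¬ StrongConflict G p.1 p.2)
    (h1 : P.Nonempty → 2 * P.card + Sm.card + Bg.card ≤ 2 * t)
    (h2 : P.card + Sm.card ≤ t) (h3 : P.card + Sm.card + Bg.card ≤ B)
    (h4 : ∀ e ∈ P.image Prod.fst ∪ P.image Prod.snd ∪ Sm,
      (conflicting G (edgesAvoid G M) e).card + t ≤ 21)
    (h5 : ∀ e ∈ Bg, (conflicting G (edgesAvoid G M) e).card + B ≤ 21) : StrongColorable G := by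
  obtain ⟨C, hC⟩ := exists_properOn_edgesAvoid hdeg hconn hM
  obtain ⟨c, hc1, hc2⟩ := exists_coloring_of_pairs P.card P Sm Bg (avail G (edgesAvoid G M) C)
    t B rfl h1 h2 h3 (fun e he => le_card_avail (h4 e he)) (fun e he => le_card_avail (h5 e he))
  set U := P.image Prod.fst ∪ P.image Prod.snd ∪ Sm ∪ Bg with hU
  obtain ⟨C', h6, -⟩ := hC.extend (F := U \ edgesAvoid G M) (c := c) (by simp)
    (fun e he => hc1 e (Finset.mem_sdiff.mp he).1) (by
      intro e he f hf hne hcon heq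
      rcases hc2 e (Finset.mem_sdiff.mp he).1 f (Finset.mem_sdiff.mp hf).1 hne heq with h | h
      · exact hP _ h hcon
      · exact hP _ h hcon.symm)
  refine h6.strongColorable fun u v huv => ?_
  by_cases hu : u ∈ M
  · simpa using Or.inr (hcover u v huv hu)
  by_cases hv : v ∈ M
  · rw [Sym2.eq_swap]
    simpa using Or.inr (hcover v u huv.symm hv)
  · refine Finset.mem_union_left _ (mem_edgesAvoid.mpr ⟨huv, ?_⟩)
    simp [hu, hv]

/-- A 4-cycle with three pairs of compatible pendant edges. -/
lemma strongColorable_of_three_pairs (hdeg : ∀ v, (nbrs G v).card ≤ 4) (hconn : G.Connected)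
    {a b c d a1 a2 b1 b2 c1 c2 d1 d2 : V} (ha : NbrsAre G a b d a1 a2) (hb : NbrsAre G b a c b1 b2)
    (hc : NbrsAre G c b d c1 c2) (hd : NbrsAre G d a c d1 d2)
    (h1 : ¬ StrongConflict G s(a, a1) s(c, c1)) (h2 : ¬ StrongConflict G s(a, a2) s(c, c2))
    (h3 : ¬ StrongConflict G s(b, b1) s(d, d1)) : StrongColorable G := by
  have pend : ∀ u v p q r, NbrsAre G u v p q r → u ∈ ({a, b, c, d} : Finset V) →
      p ∈ ({a, b, c, d} : Finset V) → q ∈ ({a, b, c, d} : Finset V) →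
      (conflicting G (edgesAvoid G {a, b, c, d}) s(u, v)).card + 6 ≤ 21 := by
    intro u v p q r hN hu hp hq
    have h4 := conflicting_edgesAvoid_le hu hN
      (sum_degIn_erase_le hdeg (edgesAvoid G {a, b, c, d}) ((hN v).mpr (by simp)).symm)
    have h5 := degIn_edgesAvoid_le_three hdeg hu ((hN r).mpr (by simp))
    rw [degIn_edgesAvoid_eq_zero hp, degIn_edgesAvoid_eq_zero hq] at h4
    omega
  have core : ∀ u v p q r p' q' r', NbrsAre G u v p q r → NbrsAre G v u p' q' r' →
      u ∈ ({a, b, c, d} : Finset V) → v ∈ ({a, b, c, d} : Finset V) →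
      p ∈ ({a, b, c, d} : Finset V) → p' ∈ ({a, b, c, d} : Finset V) →
      (conflicting G (edgesAvoid G {a, b, c, d}) s(u, v)).card + 9 ≤ 21 := by
    intro u v p q r p' q' r' hN hN' hu hv hp hp'
    have h4 := conflicting_edgesAvoid_le hu hN
      (sum_erase_le (degIn G (edgesAvoid G {a, b, c, d})) fun x hx => (hN' x).mp hx)
    have h5 := degIn_edgesAvoid_le_three hdeg hu ((hN q).mpr (by simp))
    have h6 := degIn_edgesAvoid_le_three hdeg hu ((hN r).mpr (by simp))
    have h7 := degIn_edgesAvoid_le_three hdeg hv ((hN' q').mpr (by simp))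
    have h8 := degIn_edgesAvoid_le_three hdeg hv ((hN' r').mpr (by simp))
    rw [degIn_edgesAvoid_eq_zero hp, degIn_edgesAvoid_eq_zero hp'] at h4
    omega
  have hP : ({(s(a, a1), s(c, c1)), (s(a, a2), s(c, c2)), (s(b, b1), s(d, d1))} :
    Finset (Sym2 V × Sym2 V)).card ≤ 3 := Finset.card_le_three
  have hSm : ({s(b, b2), s(d, d2)} : Finset (Sym2 V)).card ≤ 2 := Finset.card_le_two
  have hBg : ({s(a, b), s(b, c), s(c, d), s(d, a)} : Finset (Sym2 V)).card ≤ 4 :=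
    Finset.card_le_four
  refine strongColorable_of_pairs hdeg hconn (M := {a, b, c, d}) (by simp)
    {(s(a, a1), s(c, c1)), (s(a, a2), s(c, c2)), (s(b, b1), s(d, d1))} {s(b, b2), s(d, d2)}
    {s(a, b), s(b, c), s(c, d), s(d, a)} 6 9 ?_ ?_ (fun _ => by omega) (by omega) (by omega) ?_ ?_
  · intro u v huv hu
    simp only [Finset.mem_insert, Finset.mem_singleton] at hu
    rcases hu with rfl | rfl | rfl | rfl
    · rcases (ha v).mp huv with rfl | rfl | rfl | rfl <;>
        simp only [Finset.image_insert, Finset.image_singleton,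
          Finset.mem_union, Finset.mem_insert, Finset.mem_singleton, Sym2.eq_iff, and_self,
          true_or, or_true]
    · rcases (hb v).mp huv with rfl | rfl | rfl | rfl <;>
        simp only [Finset.image_insert, Finset.image_singleton,
          Finset.mem_union, Finset.mem_insert, Finset.mem_singleton, Sym2.eq_iff, and_self,
          true_or, or_true]
    · rcases (hc v).mp huv with rfl | rfl | rfl | rfl <;>
        simp only [Finset.image_insert, Finset.image_singleton,
          Finset.mem_union, Finset.mem_insert, Finset.mem_singleton, Sym2.eq_iff, and_self,
          true_or, or_true]
    · rcases (hd v).mp huv with rfl | rfl | rfl | rfl <;>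
        simp only [Finset.image_insert, Finset.image_singleton,
          Finset.mem_union, Finset.mem_insert, Finset.mem_singleton, Sym2.eq_iff, and_self,
          true_or, or_true]
  · simp [h1, h2, h3]
  · simp only [Finset.image_insert, Finset.image_singleton, Finset.mem_union, Finset.mem_insert,
      Finset.mem_singleton]
    rintro e (((rfl | rfl | rfl) | (rfl | rfl | rfl)) | (rfl | rfl))
    · exact pend a a1 b d a2 ha.third (by simp) (by simp) (by simp)
    · exact pend a a2 b d a1 ha.fourth (by simp) (by simp) (by simp)
    · exact pend b b1 a c b2 hb.third (by simp) (by simp) (by simp)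
    · exact pend c c1 b d c2 hc.third (by simp) (by simp) (by simp)
    · exact pend c c2 b d c1 hc.fourth (by simp) (by simp) (by simp)
    · exact pend d d1 a c d2 hd.third (by simp) (by simp) (by simp)
    · exact pend b b2 a c b1 hb.fourth (by simp) (by simp) (by simp)
    · exact pend d d2 a c d1 hd.fourth (by simp) (by simp) (by simp)
  · simp only [Finset.mem_insert, Finset.mem_singleton]
    rintro e (rfl | rfl | rfl | rfl)
    · exact core a b d a1 a2 c b1 b2 ha hb (by simp) (by simp) (by simp) (by simp)
    · exact core b c a b1 b2 d c1 c2 hb.second hc (by simp) (by simp)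
        (by simp) (by simp)
    · exact core c d b c1 c2 a d1 d2 hc.second
        hd.second (by simp) (by simp) (by simp) (by simp)
    · exact core d a c d1 d2 b a1 a2 hd ha.second (by simp) (by simp)
        (by simp) (by simp)

/-- Three common neighbours `b`, `d`, `x` of `a`, `c` with two pairs of compatible pendant edges. -/
lemma strongColorable_of_two_pairs (hdeg : ∀ v, (nbrs G v).card ≤ 4) (hconn : G.Connected)
    {a b c d x a1 b1 b2 c1 d1 d2 : V} (hac : a ≠ c) (ha : NbrsAre G a b d x a1)
    (hb : NbrsAre G b a c b1 b2) (hc : NbrsAre G c b d x c1) (hd : NbrsAre G d a c d1 d2)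
    (h1 : ¬ StrongConflict G s(a, a1) s(c, c1))
    (h3 : ¬ StrongConflict G s(b, b1) s(d, d1)) : StrongColorable G := by
  have hxa : G.Adj a x := (ha x).mpr (by simp)
  have hxc : G.Adj c x := (hc x).mpr (by simp)
  have hx2 : degIn G (edgesAvoid G {a, b, c, d}) x ≤ 2 :=
    degIn_edgesAvoid_le_two hdeg (by simp) (by simp) hac hxa hxc
  have pend : ∀ u v p q r, NbrsAre G u v p q r → u ∈ ({a, b, c, d} : Finset V) →
      p ∈ ({a, b, c, d} : Finset V) → q ∈ ({a, b, c, d} : Finset V) →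
      (conflicting G (edgesAvoid G {a, b, c, d}) s(u, v)).card + 6 ≤ 21 := by
    intro u v p q r hN hu hp hq
    have h4 := conflicting_edgesAvoid_le hu hN
      (sum_degIn_erase_le hdeg (edgesAvoid G {a, b, c, d}) ((hN v).mpr (by simp)).symm)
    have h5 := degIn_edgesAvoid_le_three hdeg hu ((hN r).mpr (by simp))
    rw [degIn_edgesAvoid_eq_zero hp, degIn_edgesAvoid_eq_zero hq] at h4
    omega
  have shared : ∀ u w p q r, NbrsAre G u x p q r → u ∈ ({a, b, c, d} : Finset V) →
      p ∈ ({a, b, c, d} : Finset V) → q ∈ ({a, b, c, d} : Finset V) → G.Adj x w →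
      w ∈ ({a, b, c, d} : Finset V) → w ≠ u →
      (conflicting G (edgesAvoid G {a, b, c, d}) s(u, x)).card + 10 ≤ 21 := by
    intro u w p q r hN hu hp hq hxw hw hwu
    have h4 := conflicting_edgesAvoid_le hu hN
      (sum_degIn_erase_le_of_zero hdeg _ ((hN x).mpr (by simp)).symm hxw hwu
        (degIn_edgesAvoid_eq_zero hw))
    have h5 := degIn_edgesAvoid_le_three hdeg hu ((hN r).mpr (by simp))
    rw [degIn_edgesAvoid_eq_zero hp, degIn_edgesAvoid_eq_zero hq] at h4
    omega
  have core : ∀ u v p r p' q' r', NbrsAre G u v p x r → NbrsAre G v u p' q' r' →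
      u ∈ ({a, b, c, d} : Finset V) → v ∈ ({a, b, c, d} : Finset V) →
      p ∈ ({a, b, c, d} : Finset V) → p' ∈ ({a, b, c, d} : Finset V) →
      (conflicting G (edgesAvoid G {a, b, c, d}) s(u, v)).card + 10 ≤ 21 := by
    intro u v p r p' q' r' hN hN' hu hv hp hp'
    have h4 := conflicting_edgesAvoid_le hu hN
      (sum_erase_le (degIn G (edgesAvoid G {a, b, c, d})) fun x hx => (hN' x).mp hx)
    have h6 := degIn_edgesAvoid_le_three hdeg hu ((hN r).mpr (by simp))
    have h7 := degIn_edgesAvoid_le_three hdeg hv ((hN' q').mpr (by simp))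
    have h8 := degIn_edgesAvoid_le_three hdeg hv ((hN' r').mpr (by simp))
    rw [degIn_edgesAvoid_eq_zero hp, degIn_edgesAvoid_eq_zero hp'] at h4
    omega
  have hP : ({(s(a, a1), s(c, c1)), (s(b, b1), s(d, d1))} :
    Finset (Sym2 V × Sym2 V)).card ≤ 2 := Finset.card_le_two
  have hSm : ({s(b, b2), s(d, d2)} : Finset (Sym2 V)).card ≤ 2 := Finset.card_le_two
  have hBg : ({s(a, b), s(c, b), s(c, d), s(a, d), s(a, x), s(c, x)} : Finset (Sym2 V)).card ≤ 6 :=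
    Finset.card_le_six
  refine strongColorable_of_pairs hdeg hconn (M := {a, b, c, d}) (by simp)
    {(s(a, a1), s(c, c1)), (s(b, b1), s(d, d1))} {s(b, b2), s(d, d2)}
    {s(a, b), s(c, b), s(c, d), s(a, d), s(a, x), s(c, x)} 6 10 ?_ ?_ (fun _ => by omega)
    (by omega) (by omega) ?_ ?_
  · intro u v huv hu
    simp only [Finset.mem_insert, Finset.mem_singleton] at hu
    rcases hu with rfl | rfl | rfl | rfl
    · rcases (ha v).mp huv with rfl | rfl | rfl | rfl <;>
        simp only [Finset.image_insert, Finset.image_singleton,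
          Finset.mem_union, Finset.mem_insert, Finset.mem_singleton, Sym2.eq_iff,
          true_or, or_true]
    · rcases (hb v).mp huv with rfl | rfl | rfl | rfl <;>
        simp only [Finset.image_insert, Finset.image_singleton,
          Finset.mem_union, Finset.mem_insert, Finset.mem_singleton, Sym2.eq_iff, and_self,
          true_or, or_true]
    · rcases (hc v).mp huv with rfl | rfl | rfl | rfl <;>
        simp only [Finset.image_insert, Finset.image_singleton,
          Finset.mem_union, Finset.mem_insert, Finset.mem_singleton, Sym2.eq_iff,
          true_or, or_true]
    · rcases (hd v).mp huv with rfl | rfl | rfl | rfl <;>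
        simp only [Finset.image_insert, Finset.image_singleton,
          Finset.mem_union, Finset.mem_insert, Finset.mem_singleton, Sym2.eq_iff, and_self,
          true_or, or_true]
  · simp [h1, h3]
  · simp only [Finset.image_insert, Finset.image_singleton, Finset.mem_union, Finset.mem_insert,
      Finset.mem_singleton]
    rintro e (((rfl | rfl) | (rfl | rfl)) | (rfl | rfl))
    · exact pend a a1 b d x ha.fourth (by simp) (by simp) (by simp)
    · exact pend b b1 a c b2 hb.third (by simp) (by simp) (by simp)
    · exact pend c c1 b d x hc.fourth (by simp) (by simp) (by simp)
    · exact pend d d1 a c d2 hd.third (by simp) (by simp) (by simp)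
    · exact pend b b2 a c b1 hb.fourth (by simp) (by simp) (by simp)
    · exact pend d d2 a c d1 hd.fourth (by simp) (by simp) (by simp)
  · simp only [Finset.mem_insert, Finset.mem_singleton]
    rintro e (rfl | rfl | rfl | rfl | rfl | rfl)
    · exact core a b d a1 c b1 b2 ha hb (by simp) (by simp) (by simp) (by simp)
    · exact core c b d c1 a b1 b2 hc hb.second (by simp) (by simp)
        (by simp) (by simp)
    · exact core c d b c1 a d1 d2 hc.second
        hd.second (by simp) (by simp) (by simp) (by simp)
    · exact core a d b a1 c d1 d2 ha.second hd (by simp) (by simp)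
        (by simp) (by simp)
    · exact shared a c b d a1 ha.third (by simp) (by simp) (by simp)
        hxc.symm (by simp) hac.symm
    · exact shared c a b d c1 hc.third (by simp) (by simp) (by simp)
        hxa.symm (by simp) hac

/-- Four common neighbours `b`, `d`, `x`, `y` of `a`, `c`. -/
lemma strongColorable_of_four_common (hdeg : ∀ v, (nbrs G v).card ≤ 4) (hconn : G.Connected)
    {a b c d x y b1 b2 d1 d2 : V} (hac : a ≠ c) (hbd : b ≠ d) (ha : NbrsAre G a b d x y)
    (hb : NbrsAre G b a c b1 b2) (hc : NbrsAre G c b d x y) (hd : NbrsAre G d a c d1 d2)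
    (h : ¬ StrongConflict G s(b, b1) s(d, d1) ∨ (d1 = b1 ∧ d2 = b2)) : StrongColorable G := by
  have hx2 : degIn G (edgesAvoid G {a, b, c, d}) x ≤ 2 :=
    degIn_edgesAvoid_le_two hdeg (by simp) (by simp) hac ((ha x).mpr (by simp))
      ((hc x).mpr (by simp))
  have hy2 : degIn G (edgesAvoid G {a, b, c, d}) y ≤ 2 :=
    degIn_edgesAvoid_le_two hdeg (by simp) (by simp) hac ((ha y).mpr (by simp))
      ((hc y).mpr (by simp))
  have shared : ∀ u v w p q r, NbrsAre G u v p q r → u ∈ ({a, b, c, d} : Finset V) →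
      p ∈ ({a, b, c, d} : Finset V) → q ∈ ({a, b, c, d} : Finset V) → G.Adj w v →
      w ∈ ({a, b, c, d} : Finset V) → w ≠ u → degIn G (edgesAvoid G {a, b, c, d}) r ≤ 2 →
      (conflicting G (edgesAvoid G {a, b, c, d}) s(u, v)).card + 11 ≤ 21 := by
    intro u v w p q r hN hu hp hq hxw hw hwu hr
    have h4 := conflicting_edgesAvoid_le hu hN
      (sum_degIn_erase_le_of_zero hdeg _ ((hN v).mpr (by simp)).symm hxw.symm hwu
        (degIn_edgesAvoid_eq_zero hw))
    rw [degIn_edgesAvoid_eq_zero hp, degIn_edgesAvoid_eq_zero hq] at h4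
    omega
  have core : ∀ u v p p' q' r' k, NbrsAre G u v p x y → NbrsAre G v u p' q' r' →
      u ∈ ({a, b, c, d} : Finset V) → p ∈ ({a, b, c, d} : Finset V) →
      p' ∈ ({a, b, c, d} : Finset V) → degIn G (edgesAvoid G {a, b, c, d}) q' ≤ k →
      degIn G (edgesAvoid G {a, b, c, d}) r' ≤ k →
      (conflicting G (edgesAvoid G {a, b, c, d}) s(u, v)).card ≤ 4 + 2 * k := by
    intro u v p p' q' r' k hN hN' hu hp hp' h1 h2
    have h4 := conflicting_edgesAvoid_le hu hN
      (sum_erase_le (degIn G (edgesAvoid G {a, b, c, d})) fun x hx => (hN' x).mp hx)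
    rw [degIn_edgesAvoid_eq_zero hp, degIn_edgesAvoid_eq_zero hp'] at h4
    omega
  have core' : ∀ k, degIn G (edgesAvoid G {a, b, c, d}) b1 ≤ k →
      degIn G (edgesAvoid G {a, b, c, d}) b2 ≤ k → degIn G (edgesAvoid G {a, b, c, d}) d1 ≤ k →
      degIn G (edgesAvoid G {a, b, c, d}) d2 ≤ k →
      ∀ e ∈ ({s(a, b), s(c, b), s(c, d), s(a, d)} : Finset (Sym2 V)),
      (conflicting G (edgesAvoid G {a, b, c, d}) e).card ≤ 4 + 2 * k := by
    intro k h1 h2 h3 h4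
    simp only [Finset.mem_insert, Finset.mem_singleton]
    rintro e (rfl | rfl | rfl | rfl)
    · exact core a b d c b1 b2 k ha hb (by simp) (by simp) (by simp) h1 h2
    · exact core c b d a b1 b2 k hc hb.second (by simp) (by simp)
        (by simp) h1 h2
    · exact core c d b a d1 d2 k hc.second
        hd.second (by simp) (by simp) (by simp) h3 h4
    · exact core a d b c d1 d2 k ha.second hd (by simp) (by simp)
        (by simp) h3 h4
  have shared' : ∀ e ∈ ({s(a, x), s(a, y), s(c, x), s(c, y)} : Finset (Sym2 V)),
      (conflicting G (edgesAvoid G {a, b, c, d}) e).card + 11 ≤ 21 := by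
    simp only [Finset.mem_insert, Finset.mem_singleton]
    rintro e (rfl | rfl | rfl | rfl)
    · exact shared a x c b d y ha.third (by simp) (by simp) (by simp)
        ((hc _).mpr (by simp)) (by simp) hac.symm hy2
    · exact shared a y c b d x ha.fourth (by simp) (by simp) (by simp)
        ((hc _).mpr (by simp)) (by simp) hac.symm hx2
    · exact shared c x a b d y hc.third (by simp) (by simp) (by simp)
        ((ha _).mpr (by simp)) (by simp) hac hy2
    · exact shared c y a b d x hc.fourth (by simp) (by simp) (by simp)
        ((ha _).mpr (by simp)) (by simp) hac hx2
  rcases h with h | ⟨rfl, rfl⟩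
  · have pend : ∀ u v r, NbrsAre G u v a c r → u ∈ ({a, b, c, d} : Finset V) →
        (conflicting G (edgesAvoid G {a, b, c, d}) s(u, v)).card + 6 ≤ 21 := by
      intro u v r hN hu
      have h4 := conflicting_edgesAvoid_le hu hN
        (sum_degIn_erase_le hdeg (edgesAvoid G {a, b, c, d}) ((hN v).mpr (by simp)).symm)
      have h5 := degIn_edgesAvoid_le_three hdeg hu ((hN r).mpr (by simp))
      rw [degIn_edgesAvoid_eq_zero (by simp), degIn_edgesAvoid_eq_zero (by simp)] at h4
      omega
    have hSm : ({s(b, b2), s(d, d2)} : Finset (Sym2 V)).card ≤ 2 := Finset.card_le_two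
    have hBg1 : ({s(a, b), s(c, b), s(c, d), s(a, d)} : Finset (Sym2 V)).card ≤ 4 :=
      Finset.card_le_four
    have hBg2 : ({s(a, x), s(a, y), s(c, x), s(c, y)} : Finset (Sym2 V)).card ≤ 4 :=
      Finset.card_le_four
    have hBg := Finset.card_union_le ({s(a, b), s(c, b), s(c, d), s(a, d)} : Finset (Sym2 V))
      {s(a, x), s(a, y), s(c, x), s(c, y)}
    refine strongColorable_of_pairs hdeg hconn (M := {a, b, c, d}) (by simp)
      {(s(b, b1), s(d, d1))} {s(b, b2), s(d, d2)}
      ({s(a, b), s(c, b), s(c, d), s(a, d)} ∪ {s(a, x), s(a, y), s(c, x), s(c, y)}) 6 11 ?_ ?_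
      (fun _ => by rw [Finset.card_singleton]; omega)
      (by rw [Finset.card_singleton]; omega) (by rw [Finset.card_singleton]; omega) ?_ ?_
    · intro u v huv hu
      simp only [Finset.mem_insert, Finset.mem_singleton] at hu
      rcases hu with rfl | rfl | rfl | rfl
      · rcases (ha v).mp huv with rfl | rfl | rfl | rfl <;>
          simp only [Finset.image_singleton,
            Finset.mem_union, Finset.mem_insert, Finset.mem_singleton, Sym2.eq_iff,
            true_or, or_true]
      · rcases (hb v).mp huv with rfl | rfl | rfl | rfl <;>
          simp only [Finset.image_singleton,
            Finset.mem_union, Finset.mem_insert, Finset.mem_singleton, Sym2.eq_iff, and_self,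
            true_or, or_true]
      · rcases (hc v).mp huv with rfl | rfl | rfl | rfl <;>
          simp only [Finset.image_singleton,
            Finset.mem_union, Finset.mem_insert, Finset.mem_singleton, Sym2.eq_iff,
            true_or, or_true]
      · rcases (hd v).mp huv with rfl | rfl | rfl | rfl <;>
          simp only [Finset.image_singleton,
            Finset.mem_union, Finset.mem_insert, Finset.mem_singleton, Sym2.eq_iff, and_self,
            true_or, or_true]
    · simp [h]
    · simp only [Finset.image_singleton, Finset.mem_union, Finset.mem_insert, Finset.mem_singleton]
      rintro e ((rfl | rfl) | (rfl | rfl))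
      · exact pend b b1 b2 hb.third (by simp)
      · exact pend d d1 d2 hd.third (by simp)
      · exact pend b b2 b1 hb.fourth (by simp)
      · exact pend d d2 d1 hd.fourth (by simp)
    · intro e he
      rcases Finset.mem_union.mp he with he | he
      · have := core' 3 (degIn_edgesAvoid_le_three hdeg (m := b) (by simp) ((hb _).mpr (by simp)))
          (degIn_edgesAvoid_le_three hdeg (m := b) (by simp) ((hb _).mpr (by simp)))
          (degIn_edgesAvoid_le_three hdeg (m := d) (by simp) ((hd _).mpr (by simp)))
          (degIn_edgesAvoid_le_three hdeg (m := d) (by simp) ((hd _).mpr (by simp))) e he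
        omega
      · exact shared' e he
  · have h1 : degIn G (edgesAvoid G {a, b, c, d}) d1 ≤ 2 :=
      degIn_edgesAvoid_le_two hdeg (by simp) (by simp) hbd ((hb _).mpr (by simp))
        ((hd _).mpr (by simp))
    have h2 : degIn G (edgesAvoid G {a, b, c, d}) d2 ≤ 2 :=
      degIn_edgesAvoid_le_two hdeg (by simp) (by simp) hbd ((hb _).mpr (by simp))
        ((hd _).mpr (by simp))
    have hBg : ({s(a, b), s(c, b), s(c, d), s(a, d)} : Finset (Sym2 V)).card ≤ 4 :=
      Finset.card_le_four
    have hSm1 : ({s(b, d1), s(b, d2), s(d, d1), s(d, d2)} : Finset (Sym2 V)).card ≤ 4 :=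
      Finset.card_le_four
    have hSm2 : ({s(a, x), s(a, y), s(c, x), s(c, y)} : Finset (Sym2 V)).card ≤ 4 :=
      Finset.card_le_four
    have hSm := Finset.card_union_le ({s(b, d1), s(b, d2), s(d, d1), s(d, d2)} : Finset (Sym2 V))
      {s(a, x), s(a, y), s(c, x), s(c, y)}
    refine strongColorable_of_pairs hdeg hconn (M := {a, b, c, d}) (by simp)
      ∅ ({s(b, d1), s(b, d2), s(d, d1), s(d, d2)} ∪ {s(a, x), s(a, y), s(c, x), s(c, y)})
      {s(a, b), s(c, b), s(c, d), s(a, d)} 11 13 ?_ (by simp)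
      (fun h => by simp at h)
      (by rw [Finset.card_empty]; omega) (by rw [Finset.card_empty]; omega) ?_ ?_
    · intro u v huv hu
      simp only [Finset.mem_insert, Finset.mem_singleton] at hu
      rcases hu with rfl | rfl | rfl | rfl
      · rcases (ha v).mp huv with rfl | rfl | rfl | rfl <;>
          simp only [Finset.image_empty,
            Finset.mem_union, Finset.mem_insert, Finset.mem_singleton, Sym2.eq_iff,
            true_or, or_true]
      · rcases (hb v).mp huv with rfl | rfl | rfl | rfl <;>
          simp only [Finset.image_empty,
            Finset.mem_union, Finset.mem_insert, Finset.mem_singleton, Sym2.eq_iff, and_self,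
            true_or, or_true]
      · rcases (hc v).mp huv with rfl | rfl | rfl | rfl <;>
          simp only [Finset.image_empty,
            Finset.mem_union, Finset.mem_insert, Finset.mem_singleton, Sym2.eq_iff,
            true_or, or_true]
      · rcases (hd v).mp huv with rfl | rfl | rfl | rfl <;>
          simp only [Finset.image_empty,
            Finset.mem_union, Finset.mem_insert, Finset.mem_singleton, Sym2.eq_iff, and_self,
            true_or, or_true]
    · intro e he
      simp only [Finset.image_empty, Finset.empty_union] at he
      rcases Finset.mem_union.mp he with he | he
      · simp only [Finset.mem_insert, Finset.mem_singleton] at he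
        rcases he with rfl | rfl | rfl | rfl
        · exact shared b d1 d a c d2 hb.third (by simp) (by simp) (by simp)
            ((hd _).mpr (by simp)) (by simp) hbd.symm h2
        · exact shared b d2 d a c d1 hb.fourth (by simp) (by simp) (by simp)
            ((hd _).mpr (by simp)) (by simp) hbd.symm h1
        · exact shared d d1 b a c d2 hd.third (by simp) (by simp) (by simp)
            ((hb _).mpr (by simp)) (by simp) hbd h2
        · exact shared d d2 b a c d1 hd.fourth (by simp) (by simp) (by simp)
            ((hb _).mpr (by simp)) (by simp) hbd h1
      · exact shared' e he
    · intro e he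
      have := core' 2 h1 h2 h1 h2 e he
      omega

end Cycle

section PairHall

/-- Hall's condition for three pairs of lists of size seven and three lists of size five. -/
lemma card_le_card_biUnion_of_pairs {α : Type*} [DecidableEq α] (P : Finset (α × α)) (R : Finset α)
    (L : α → Finset (Fin 21)) (hPcard : P.card ≤ 3) (hRcard : R.card ≤ 3)
    (hP7 : ∀ e ∈ P.image Prod.fst ∪ P.image Prod.snd, 7 ≤ (L e).card)
    (hR5 : ∀ e ∈ R, 5 ≤ (L e).card) (hpair : ∀ p ∈ P, 9 ≤ (L p.1 ∪ L p.2).card) :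
    ∀ T ⊆ P.image Prod.fst ∪ P.image Prod.snd ∪ R, T.card ≤ (T.biUnion L).card := by
  intro T hT
  by_cases hpT : ∃ p ∈ P, p.1 ∈ T ∧ p.2 ∈ T
  · obtain ⟨p, hp, hp1, hp2⟩ := hpT
    have h1 := hpair p hp
    have h2 := Finset.card_le_card (Finset.union_subset
      (Finset.subset_biUnion_of_mem L hp1)
      (Finset.subset_biUnion_of_mem L hp2))
    have h3 := Finset.card_le_card hT
    have h4 := Finset.card_union_le (P.image Prod.fst ∪ P.image Prod.snd) R
    have h5 := Finset.card_union_le (P.image Prod.fst) (P.image Prod.snd)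
    have h6 : (P.image Prod.fst).card ≤ P.card := Finset.card_image_le
    have h7 : (P.image Prod.snd).card ≤ P.card := Finset.card_image_le
    omega
  · have hk := card_inter_pairs_le P T fun p hp h => hpT ⟨p, hp, h⟩
    by_cases hne : (T ∩ (P.image Prod.fst ∪ P.image Prod.snd)).Nonempty
    · obtain ⟨e, he⟩ := hne
      obtain ⟨he1, he2⟩ := Finset.mem_inter.mp he
      have h1 := hP7 e he2
      have h2 := Finset.card_le_card (Finset.subset_biUnion_of_mem L he1)
      have h3 : T ⊆ (T ∩ (P.image Prod.fst ∪ P.image Prod.snd)) ∪ R := fun f hf => by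
        have := hT hf
        simp only [Finset.mem_union, Finset.mem_inter] at this ⊢
        tauto
      have h4 := Finset.card_le_card h3
      have h5 := Finset.card_union_le (T ∩ (P.image Prod.fst ∪ P.image Prod.snd)) R
      omega
    · have hTR : T ⊆ R := fun f hf => (Finset.mem_union.mp (hT hf)).resolve_left
        fun h => hne ⟨f, Finset.mem_inter.mpr ⟨hf, h⟩⟩
      rcases T.eq_empty_or_nonempty with rfl | ⟨e, he⟩
      · simp
      have h1 := hR5 e (hTR he)
      have h2 := Finset.card_le_card (Finset.subset_biUnion_of_mem L he)
      have h3 := Finset.card_le_card hTR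
      omega

end PairHall

section SharedThree

open scoped Classical

variable {V : Type*} [Fintype V] {G : SimpleGraph V}

lemma ProperOn.strongColorable_of_hall {S : Finset (Sym2 V)} {C : Sym2 V → Fin 21}
    (hC : ProperOn G S C) (U : Finset (Sym2 V))
    (hU : ∀ u v, G.Adj u v → s(u, v) ∈ S ∨ s(u, v) ∈ U)
    (h : ∀ T ⊆ U, T.card ≤ (T.biUnion (avail G S C)).card) : StrongColorable G := by
  obtain ⟨c, hc1, hc2⟩ := exists_injOn_of_hall U (avail G S C) h
  obtain ⟨C', h6, -⟩ := hC.extend (F := U \ S) (c := c) (by simp)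
    (fun e he => hc1 e (Finset.mem_sdiff.mp he).1)
    (fun e he f hf hne _ => hc2 e (Finset.mem_sdiff.mp he).1 f (Finset.mem_sdiff.mp hf).1 hne)
  refine h6.strongColorable fun u v huv => ?_
  simpa using hU u v huv

lemma edgesNotInside_subset_edgeSet {M : Finset V} : ∀ e ∈ edgesNotInside G M, e ∈ G.edgeSet :=
  fun _ he => (mem_edgesNotInside.mp he).1

lemma mk_notMem_edgesNotInside {M : Finset V} {u v : V} (hu : u ∈ M) (hv : v ∈ M) :
    s(u, v) ∉ edgesNotInside G M := by
  simp [hu, hv]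

lemma degIn_edgesNotInside_eq_zero {M : Finset V} {w : V} (hw : w ∈ M)
    (h : ∀ x, G.Adj w x → x ∈ M) : degIn G (edgesNotInside G M) w = 0 :=
  degIn_eq_zero fun x hx => mk_notMem_edgesNotInside hw (h x hx)

lemma degIn_edgesNotInside_le_two (hdeg : ∀ v, (nbrs G v).card ≤ 4) {M : Finset V} {w m n : V}
    (hwM : w ∈ M) (hm : m ∈ M) (hn : n ∈ M) (hne : m ≠ n) (hw : G.Adj w m) (hw' : G.Adj w n) :
    degIn G (edgesNotInside G M) w ≤ 2 := by
  have h1 : degIn G (edgesNotInside G M) w ≤ (nbrs G w \ {m, n}).card :=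
    degIn_le_of_subset fun x hx hS => by
      simp only [Finset.mem_sdiff, mem_nbrs, Finset.mem_insert, Finset.mem_singleton]
      refine ⟨hx, ?_⟩
      rintro (rfl | rfl)
      · exact mk_notMem_edgesNotInside hwM hm hS
      · exact mk_notMem_edgesNotInside hwM hn hS
  have h2 : {m, n} ⊆ nbrs G w := by
    intro x hx
    rcases Finset.mem_insert.mp hx with rfl | hx
    · exact mem_nbrs.mpr hw
    · rw [Finset.mem_singleton] at hx
      exact mem_nbrs.mpr (hx ▸ hw')
  have h3 := Finset.card_sdiff_add_card_eq_card h2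
  rw [Finset.card_pair hne] at h3
  have := hdeg w
  omega

lemma two_le_card_nbrs_inter {M : Finset V} {u m n : V} (hm : m ∈ M) (hn : n ∈ M) (hne : m ≠ n)
    (hum : G.Adj u m) (hun : G.Adj u n) : 2 ≤ (nbrs G u ∩ M).card := by
  rw [← Finset.card_pair hne]
  apply Finset.card_le_card
  intro w hw
  rcases Finset.mem_insert.mp hw with rfl | hw
  · exact Finset.mem_inter.mpr ⟨mem_nbrs.mpr hum, hm⟩
  · rw [Finset.mem_singleton] at hw
    subst hw
    exact Finset.mem_inter.mpr ⟨mem_nbrs.mpr hun, hn⟩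

/-- If an uncolored edge `s(u, v)` sees the color `z`, then it does so at a neighbour. -/
lemma exists_edgesAt_of_notMem_avail {S : Finset (Sym2 V)} {C : Sym2 V → Fin 21}
    (hS : ∀ e ∈ S, e ∈ G.edgeSet) {u v : V} (hadj : G.Adj u v) (huv : s(u, v) ∉ S) {z : Fin 21}
    (hz : z ∉ avail G S C s(u, v)) : ∃ f ∈ S, C f = z ∧ ∃ w, w ∈ f ∧
      ((G.Adj u w ∧ w ≠ v) ∨ (G.Adj v w ∧ w ≠ u)) := by
  rw [mem_avail] at hz
  push Not at hz
  obtain ⟨f, hf, hconf, hfz⟩ := hz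
  have h1 := conflicting_subset hS hadj huv (mem_conflicting.mpr ⟨hf, hconf⟩)
  simp only [Finset.mem_union, Finset.mem_biUnion, Finset.mem_erase, mem_nbrs, mem_edgesAt] at h1
  rcases h1 with ⟨w, ⟨h1, h2⟩, -, h3⟩ | ⟨w, ⟨h1, h2⟩, -, h3⟩
  · exact ⟨f, hf, hfz, w, h3, Or.inl ⟨h2, h1⟩⟩
  · exact ⟨f, hf, hfz, w, h3, Or.inr ⟨h2, h1⟩⟩

/-- Two parallel core edges `s(a, b)`, `s(c, b)` have nine available colors together. -/
lemma nine_le_card_avail_union (hdeg : ∀ v, (nbrs G v).card ≤ 4) {S : Finset (Sym2 V)}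
    {C : Sym2 V → Fin 21} (hC : ProperOn G S C) (hS : ∀ e ∈ S, e ∈ G.edgeSet)
    {a b c d x a' c' : V} (ha : NbrsAre G a b d x a') (hc : NbrsAre G c b d x c')
    (hac : a ≠ c) (hadj : G.Adj a' c') (haS : ∀ e ∈ S, a ∉ e) (hcS : ∀ e ∈ S, c ∉ e)
    (h' : s(a', c') ∉ S) (hd : degIn G S d ≤ 2) (hx : degIn G S x ≤ 2) :
    9 ≤ (avail G S C s(a, b) ∪ avail G S C s(c, b)).card := by
  have hab : G.Adj a b := (ha b).mpr (by simp)
  have hcb : G.Adj c b := (hc b).mpr (by simp)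
  set E := edgesAt S d ∪ edgesAt S x ∪ (((nbrs G b).erase a).erase c).biUnion (edgesAt S) with hE
  have hEcard : E.card ≤ 12 := by
    have h1 := Finset.card_union_le (edgesAt S d) (edgesAt S x)
    have h2 := Finset.card_union_le (edgesAt S d ∪ edgesAt S x)
      ((((nbrs G b).erase a).erase c).biUnion (edgesAt S))
    have h3 := card_edgesAt_le hS d
    have h4 := card_edgesAt_le hS x
    have h5 : (((nbrs G b).erase a).erase c).card ≤ 2 := by
      rw [Finset.card_erase_of_mem (by simp [hcb.symm, hac.symm]),
        Finset.card_erase_of_mem (by simp [hab.symm])]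
      have := hdeg b
      omega
    have h6 : ((((nbrs G b).erase a).erase c).biUnion (edgesAt S)).card ≤
        (((nbrs G b).erase a).erase c).card * 4 :=
      Finset.card_biUnion_le.trans (Finset.sum_le_card_nsmul _ _ 4 fun w _ =>
        (card_edgesAt_le hS w).trans ((degIn_le_card_nbrs S w).trans (hdeg w)))
    rw [hE]
    omega
  have hcases : ∀ f ∈ S, ∀ w, w ∈ f → (w = b ∨ w = d ∨ w = x ∨ G.Adj b w) → w ≠ b → f ∈ E := by
    intro f hf w hw h1 h2
    simp only [hE, Finset.mem_union, Finset.mem_biUnion, Finset.mem_erase, mem_nbrs, mem_edgesAt]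
    rcases h1 with rfl | rfl | rfl | h1
    · exact absurd rfl h2
    · exact Or.inl (Or.inl ⟨hf, hw⟩)
    · exact Or.inl (Or.inr ⟨hf, hw⟩)
    · exact Or.inr ⟨w, ⟨fun h => hcS f hf (h ▸ hw), fun h => haS f hf (h ▸ hw), h1⟩, hf, hw⟩
  have hsub : (avail G S C s(a, b) ∪ avail G S C s(c, b))ᶜ ⊆ E.image C := by
    intro z hz
    simp only [Finset.mem_compl, Finset.mem_union, not_or] at hz
    obtain ⟨f, hf, hfz, w, hw, hw'⟩ := exists_edgesAt_of_notMem_avail hS hab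
      (fun h => haS _ h (by simp)) hz.1
    obtain ⟨g, hg, hgz, y, hy, hy'⟩ := exists_edgesAt_of_notMem_avail hS hcb
      (fun h => hcS _ h (by simp)) hz.2
    rw [Finset.mem_image]
    have h1 : f ∈ E ∨ w = a' := by
      rcases hw' with ⟨h1, h2⟩ | ⟨h1, h2⟩
      · rcases (ha w).mp h1 with h | h | h | h
        · exact absurd h h2
        · exact Or.inl (hcases f hf w hw (by simp [h]) h2)
        · exact Or.inl (hcases f hf w hw (by simp [h]) h2)
        · exact Or.inr h
      · exact Or.inl (hcases f hf w hw (by simp [h1]) h1.ne')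
    have h2 : g ∈ E ∨ y = c' := by
      rcases hy' with ⟨h1, h2⟩ | ⟨h1, h2⟩
      · rcases (hc y).mp h1 with h | h | h | h
        · exact absurd h h2
        · exact Or.inl (hcases g hg y hy (by simp [h]) h2)
        · exact Or.inl (hcases g hg y hy (by simp [h]) h2)
        · exact Or.inr h
      · exact Or.inl (hcases g hg y hy (by simp [h1]) h1.ne')
    rcases h1 with h1 | rfl
    · exact ⟨f, h1, hfz⟩
    rcases h2 with h2 | rfl
    · exact ⟨g, h2, hgz⟩
    have hfg : f ≠ g := by
      rintro rfl
      exact h' (((Sym2.mem_and_mem_iff hadj.ne).mp ⟨hw, hy⟩) ▸ hf)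
    exact absurd (hfz.trans hgz.symm) (hC f hf g hg hfg (Or.inr ⟨w, y, hw, hy, hadj⟩))
  have h1 := (Finset.card_le_card hsub).trans Finset.card_image_le
  rw [Finset.card_compl, Fintype.card_fin] at h1
  omega

/-- Three common neighbours `b`, `d`, `x` of `a`, `c` whose fourth neighbours are adjacent. -/
lemma strongColorable_of_three_common (hdeg : ∀ v, (nbrs G v).card ≤ 4) (hconn : G.Connected)
    (htf : ∀ a b c, G.Adj a b → G.Adj b c → ¬ G.Adj a c) {a b c d x a' c' : V}
    (ha : NbrsAre G a b d x a') (hc : NbrsAre G c b d x c') (hac : a ≠ c) (hbd : b ≠ d)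
    (hadj : G.Adj a' c') : StrongColorable G := by
  have hab : G.Adj a b := (ha b).mpr (by simp)
  have had : G.Adj a d := (ha d).mpr (by simp)
  have hax : G.Adj a x := (ha x).mpr (by simp)
  have haa : G.Adj a a' := (ha a').mpr (by simp)
  have hcb : G.Adj c b := (hc b).mpr (by simp)
  have hcd : G.Adj c d := (hc d).mpr (by simp)
  have hcx : G.Adj c x := (hc x).mpr (by simp)
  have hcc : G.Adj c c' := (hc c').mpr (by simp)
  have hac' : a ≠ c' := by
    rintro rfl
    exact htf _ _ _ hcc hab hcb
  have hca' : c ≠ a' := by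
    rintro rfl
    exact htf _ _ _ haa hcb hab
  set M : Finset V := {a, c, b, d, x, a', c'} with hM
  have haM : a ∈ M := by simp [hM]
  have hcM : c ∈ M := by simp [hM]
  have hbM : b ∈ M := by simp [hM]
  have hdM : d ∈ M := by simp [hM]
  have hxM : x ∈ M := by simp [hM]
  have haM' : a' ∈ M := by simp [hM]
  have hcM' : c' ∈ M := by simp [hM]
  obtain ⟨C, hC⟩ := exists_properOn_edgesNotInside hdeg hconn (M := M) ⟨a, haM⟩ (by
    intro u hu
    simp only [hM, Finset.mem_insert, Finset.mem_singleton] at hu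
    rcases hu with rfl | rfl | rfl | rfl | rfl | rfl | rfl
    · exact two_le_card_nbrs_inter hbM hdM hbd hab had
    · exact two_le_card_nbrs_inter hbM hdM hbd hcb hcd
    · exact two_le_card_nbrs_inter haM hcM hac hab.symm hcb.symm
    · exact two_le_card_nbrs_inter haM hcM hac had.symm hcd.symm
    · exact two_le_card_nbrs_inter haM hcM hac hax.symm hcx.symm
    · exact two_le_card_nbrs_inter haM hcM' hac' haa.symm hadj
    · exact two_le_card_nbrs_inter hcM haM' hca' hcc.symm hadj.symm)
  set S := edgesNotInside G M with hSdef
  have hS : ∀ e ∈ S, e ∈ G.edgeSet := edgesNotInside_subset_edgeSet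
  have hnaM : ∀ y, G.Adj a y → y ∈ M := by
    intro y hy
    rcases (ha y).mp hy with rfl | rfl | rfl | rfl <;> assumption
  have hncM : ∀ y, G.Adj c y → y ∈ M := by
    intro y hy
    rcases (hc y).mp hy with rfl | rfl | rfl | rfl <;> assumption
  have hempty : ∀ u ∈ M, (∀ y, G.Adj u y → y ∈ M) → ∀ e ∈ S, u ∉ e := by
    rintro u huM hu e he hue
    obtain ⟨y, rfl⟩ := Sym2.mem_iff_exists.mp hue
    exact mk_notMem_edgesNotInside huM (hu y (hS _ he)) he
  have ha0 : degIn G S a = 0 := degIn_edgesNotInside_eq_zero haM hnaM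
  have hc0 : degIn G S c = 0 := degIn_edgesNotInside_eq_zero hcM hncM
  have hb2 : degIn G S b ≤ 2 :=
    degIn_edgesNotInside_le_two hdeg hbM haM hcM hac hab.symm hcb.symm
  have hd2 : degIn G S d ≤ 2 :=
    degIn_edgesNotInside_le_two hdeg hdM haM hcM hac had.symm hcd.symm
  have hx2 : degIn G S x ≤ 2 :=
    degIn_edgesNotInside_le_two hdeg hxM haM hcM hac hax.symm hcx.symm
  have ha2 : degIn G S a' ≤ 2 :=
    degIn_edgesNotInside_le_two hdeg haM' haM hcM' hac' haa.symm hadj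
  have hc2 : degIn G S c' ≤ 2 :=
    degIn_edgesNotInside_le_two hdeg hcM' hcM haM' hca' hcc.symm hadj.symm
  have hcore : ∀ u v p q r w, NbrsAre G u v p q r → u ∈ M → v ∈ M → G.Adj v w → w ≠ u →
      degIn G S w = 0 → degIn G S p ≤ 2 → degIn G S q ≤ 2 → degIn G S r ≤ 2 →
      7 ≤ (avail G S C s(u, v)).card := by
    intro u v p q r w hN hu hv hw hne h0 h1 h2 h3
    have huv : G.Adj u v := (hN v).mpr (by simp)
    refine le_card_avail ?_
    have h4 := conflicting_card_le hS huv (mk_notMem_edgesNotInside hu hv)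
    have h5 := sum_degIn_erase_le_of_zero hdeg S huv.symm hw hne h0
    have h6 := sum_erase_le (degIn G S) fun y hy => (hN y).mp hy
    omega
  have hsat : ∀ u v p q r w, NbrsAre G u v p q r → u ∈ M → v ∈ M → G.Adj v w → w ≠ u →
      degIn G S w ≤ 2 → degIn G S p ≤ 2 → degIn G S q ≤ 2 → degIn G S r ≤ 2 →
      5 ≤ (avail G S C s(u, v)).card := by
    intro u v p q r w hN hu hv hw hne h0 h1 h2 h3
    have huv : G.Adj u v := (hN v).mpr (by simp)
    refine le_card_avail ?_
    have h4 := conflicting_card_le hS huv (mk_notMem_edgesNotInside hu hv)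
    have h6 := sum_erase_le (degIn G S) fun y hy => (hN y).mp hy
    have hwv : w ∈ (nbrs G v).erase u := by simp [hw, hne]
    have h7 := Finset.add_sum_erase _ (degIn G S) hwv
    have h8 : (((nbrs G v).erase u).erase w).card ≤ 2 := by
      rw [Finset.card_erase_of_mem hwv, Finset.card_erase_of_mem (by simp [huv.symm])]
      have := hdeg v
      omega
    have h9 : ∑ y ∈ ((nbrs G v).erase u).erase w, degIn G S y ≤
        (((nbrs G v).erase u).erase w).card * 4 :=
      Finset.sum_le_card_nsmul _ _ 4 fun y _ => (degIn_le_card_nbrs S y).trans (hdeg y)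
    omega
  have hend : 5 ≤ (avail G S C s(a', c')).card := by
    refine le_card_avail ?_
    have h4 := conflicting_card_le hS hadj (mk_notMem_edgesNotInside haM' hcM')
    have h5 := sum_degIn_erase_le_of_zero hdeg S hadj.symm hcc.symm hca' hc0
    have h6 := sum_degIn_erase_le_of_zero hdeg S hadj haa.symm hac' ha0
    omega
  set P : Finset (Sym2 V × Sym2 V) := {(s(a, b), s(c, b)), (s(a, d), s(c, d)), (s(a, x), s(c, x))}
    with hP
  set R : Finset (Sym2 V) := {s(a, a'), s(c, c'), s(a', c')} with hR
  have hPcard : P.card ≤ 3 := Finset.card_le_three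
  have hRcard : R.card ≤ 3 := Finset.card_le_three
  have hP7 : ∀ e ∈ P.image Prod.fst ∪ P.image Prod.snd, 7 ≤ (avail G S C e).card := by
    simp only [hP, Finset.image_insert, Finset.image_singleton, Finset.mem_union,
      Finset.mem_insert, Finset.mem_singleton]
    rintro e ((rfl | rfl | rfl) | (rfl | rfl | rfl))
    · exact hcore a b d x a' c ha haM hbM hcb.symm hac.symm hc0 hd2 hx2 ha2
    · exact hcore a d b x a' c ha.second haM hdM hcd.symm hac.symm hc0 hb2 hx2 ha2
    · exact hcore a x b d a' c ha.third haM hxM hcx.symm hac.symm hc0 hb2 hd2 ha2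
    · exact hcore c b d x c' a hc hcM hbM hab.symm hac ha0 hd2 hx2 hc2
    · exact hcore c d b x c' a hc.second hcM hdM had.symm hac ha0 hb2 hx2 hc2
    · exact hcore c x b d c' a hc.third hcM hxM hax.symm hac ha0 hb2 hd2 hc2
  have hR5 : ∀ e ∈ R, 5 ≤ (avail G S C e).card := by
    simp only [hR, Finset.mem_insert, Finset.mem_singleton]
    rintro e (rfl | rfl | rfl)
    · exact hsat a a' b d x c' ha.fourth haM haM' hadj hac'.symm hc2 hb2 hd2 hx2
    · exact hsat c c' b d x a' hc.fourth hcM hcM' hadj.symm hca'.symm ha2 hb2 hd2 hx2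
    · exact hend
  have hpair : ∀ p ∈ P, 9 ≤ (avail G S C p.1 ∪ avail G S C p.2).card := by
    have haS := hempty a haM hnaM
    have hcS := hempty c hcM hncM
    have hend' : s(a', c') ∉ S := mk_notMem_edgesNotInside haM' hcM'
    simp only [hP, Finset.mem_insert, Finset.mem_singleton]
    rintro p (rfl | rfl | rfl)
    · exact nine_le_card_avail_union hdeg hC hS ha hc hac hadj haS hcS hend' hd2 hx2
    · exact nine_le_card_avail_union hdeg hC hS ha.second hc.second hac hadj haS hcS hend' hb2 hx2
    · exact nine_le_card_avail_union hdeg hC hS ha.third hc.third hac hadj haS hcS hend' hb2 hd2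
  refine hC.strongColorable_of_hall (P.image Prod.fst ∪ P.image Prod.snd ∪ R) ?_ ?_
  · intro u v huv
    by_cases h : s(u, v) ∈ S
    · exact Or.inl h
    refine Or.inr ?_
    have hatA : ∀ y, G.Adj a y → s(a, y) ∈ P.image Prod.fst ∪ P.image Prod.snd ∪ R := by
      intro y hy
      simp only [hP, hR, Finset.image_insert, Finset.image_singleton, Finset.mem_union,
        Finset.mem_insert, Finset.mem_singleton]
      rcases (ha y).mp hy with rfl | rfl | rfl | rfl <;> simp only [true_or, or_true]
    have hatC : ∀ y, G.Adj c y → s(c, y) ∈ P.image Prod.fst ∪ P.image Prod.snd ∪ R := by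
      intro y hy
      simp only [hP, hR, Finset.image_insert, Finset.image_singleton, Finset.mem_union,
        Finset.mem_insert, Finset.mem_singleton]
      rcases (hc y).mp hy with rfl | rfl | rfl | rfl <;> simp only [true_or, or_true]
    have hend' : s(a', c') ∈ P.image Prod.fst ∪ P.image Prod.snd ∪ R := by simp [hR]
    have hin : u ∈ M ∧ v ∈ M := by
      by_contra hcon
      refine h (mem_edgesNotInside.mpr ⟨huv, ?_⟩)
      by_cases hu : u ∈ M
      · exact ⟨v, by simp, fun hv => hcon ⟨hu, hv⟩⟩
      · exact ⟨u, by simp, hu⟩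
    by_cases hua : u = a
    · subst hua; exact hatA v huv
    by_cases huc : u = c
    · subst huc; exact hatC v huv
    by_cases hva : v = a
    · subst hva; rw [Sym2.eq_swap]; exact hatA u huv.symm
    by_cases hvc : v = c
    · subst hvc; rw [Sym2.eq_swap]; exact hatC u huv.symm
    have hclass : ∀ y ∈ M, y ≠ a → y ≠ c → (G.Adj a y ∧ (G.Adj c y ∨ y = a')) ∨ y = c' := by
      intro y hy h1 h2
      simp only [hM, Finset.mem_insert, Finset.mem_singleton] at hy
      rcases hy with rfl | rfl | rfl | rfl | rfl | rfl | rfl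
      · exact absurd rfl h1
      · exact absurd rfl h2
      · exact Or.inl ⟨hab, Or.inl hcb⟩
      · exact Or.inl ⟨had, Or.inl hcd⟩
      · exact Or.inl ⟨hax, Or.inl hcx⟩
      · exact Or.inl ⟨haa, Or.inr rfl⟩
      · exact Or.inr rfl
    rcases hclass u hin.1 hua huc with ⟨h1, h2⟩ | rfl <;>
      rcases hclass v hin.2 hva hvc with ⟨h3, h4⟩ | rfl
    · exact absurd h3 (htf _ _ _ h1 huv)
    · rcases h2 with h2 | rfl
      · exact absurd hcc (htf _ _ _ h2 huv)
      · exact hend'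
    · rcases h4 with h4 | rfl
      · exact absurd hcc (htf _ _ _ h4 huv.symm)
      · rw [Sym2.eq_swap]; exact hend'
    · exact absurd huv (SimpleGraph.irrefl _)
  · exact card_le_card_biUnion_of_pairs P R _ hPcard hRcard hP7 hR5 hpair

end SharedThree

section CommonNeighbours

open scoped Classical

variable {V : Type*} [Fintype V] {G : SimpleGraph V}

lemma exists_nbrsAre_of_two {v p q : V} (hv : (nbrs G v).card = 4) (hp : G.Adj v p)
    (hq : G.Adj v q) (hpq : p ≠ q) :
    ∃ r t, NbrsAre G v p q r t ∧ r ≠ p ∧ r ≠ q ∧ t ≠ p ∧ t ≠ q ∧ r ≠ t := by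
  have h1 : (((nbrs G v).erase p).erase q).card = 2 := by
    rw [Finset.card_erase_of_mem (by simp [hq, hpq.symm]), Finset.card_erase_of_mem (by simp [hp])]
    omega
  obtain ⟨r, t, hrt, h2⟩ := Finset.card_eq_two.mp h1
  have h3 : ∀ y, (y ≠ q ∧ y ≠ p ∧ G.Adj v y) ↔ (y = r ∨ y = t) := fun y => by
    have := Finset.ext_iff.mp h2 y
    simpa using this
  have hr := (h3 r).mpr (Or.inl rfl)
  have ht := (h3 t).mpr (Or.inr rfl)
  refine ⟨r, t, fun y => ?_, hr.2.1, hr.1, ht.2.1, ht.1, hrt⟩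
  have := h3 y
  by_cases h4 : y = p
  · subst h4; simp [hp]
  by_cases h5 : y = q
  · subst h5; simp [hq]
  tauto

lemma exists_nbrsAre_of_three {v p q r : V} (hv : (nbrs G v).card = 4) (hp : G.Adj v p)
    (hq : G.Adj v q) (hr : G.Adj v r) (hpq : p ≠ q) (hpr : p ≠ r) (hqr : q ≠ r) :
    ∃ t, NbrsAre G v p q r t ∧ t ≠ p ∧ t ≠ q ∧ t ≠ r := by
  obtain ⟨s, t, hN, h1, h2, h3, h4, h5⟩ := exists_nbrsAre_of_two hv hp hq hpq
  rcases (hN r).mp hr with rfl | rfl | rfl | rfl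
  · exact absurd rfl hpr
  · exact absurd rfl hqr
  · exact ⟨t, hN, h3, h4, h5.symm⟩
  · exact ⟨s, fun y => by rw [hN y]; tauto, h1, h2, h5⟩

lemma not_strongConflict {b d β δ : V} (hbd : b ≠ d) (hnbd : ¬ G.Adj b d) (hβ : G.Adj b β)
    (hδ : G.Adj d δ) (h1 : ¬ G.Adj d β) (h2 : ¬ G.Adj b δ) (h3 : ¬ G.Adj β δ) :
    ¬ StrongConflict G s(b, β) s(d, δ) := by
  rintro (⟨v, hv1, hv2⟩ | ⟨u, v, hu, hv, huv⟩)
  · rw [Sym2.mem_iff] at hv1 hv2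
    rcases hv1 with rfl | rfl <;> rcases hv2 with rfl | rfl
    · exact hbd rfl
    · exact hnbd hδ.symm
    · exact hnbd hβ
    · exact h1 hδ
  · rw [Sym2.mem_iff] at hu hv
    rcases hu with rfl | rfl <;> rcases hv with rfl | rfl
    · exact hnbd huv
    · exact h2 huv
    · exact h1 huv.symm
    · exact h3 huv

/-- Three independent pairs in a triangle-free graph, none containing another, have two
nonadjacent vertices in the differences of two of the pairs. -/
lemma exists_nonadj_of_pairs (htf : ∀ a b c, G.Adj a b → G.Adj b c → ¬ G.Adj a c)
    {P Q R : Finset V} (hP : P.card ≤ 2) (hPind : ∀ x ∈ P, ∀ y ∈ P, ¬ G.Adj x y)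
    (hQ : Q.card ≤ 2) (hQind : ∀ x ∈ Q, ∀ y ∈ Q, ¬ G.Adj x y)
    (hR : R.card ≤ 2) (hRind : ∀ x ∈ R, ∀ y ∈ R, ¬ G.Adj x y)
    (hPQ : ¬ P ⊆ Q) (hQP : ¬ Q ⊆ P) (hPR : ¬ P ⊆ R) (hRP : ¬ R ⊆ P) (hQR : ¬ Q ⊆ R)
    (hRQ : ¬ R ⊆ Q) :
    (∃ x ∈ P, ∃ y ∈ Q, x ∉ Q ∧ y ∉ P ∧ ¬ G.Adj x y) ∨
    (∃ x ∈ P, ∃ y ∈ R, x ∉ R ∧ y ∉ P ∧ ¬ G.Adj x y) ∨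
    (∃ x ∈ Q, ∃ y ∈ R, x ∉ R ∧ y ∉ Q ∧ ¬ G.Adj x y) := by
  have key : ∀ A B D : Finset V, A.card ≤ 2 → ¬ A ⊆ B → ¬ A ⊆ D →
      (∃ x ∈ A, x ∉ B ∧ x ∉ D) ∨ ∃ x ∈ A, ∃ y ∈ A, x ∈ B ∧ x ∉ D ∧ y ∈ D ∧ y ∉ B := by
    intro A B D hA h1 h2
    obtain ⟨y, hy, hyB⟩ := Finset.not_subset.mp h1
    obtain ⟨x, hx, hxD⟩ := Finset.not_subset.mp h2
    by_cases h3 : y ∈ D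
    · by_cases h4 : x ∈ B
      · exact Or.inr ⟨x, hx, y, hy, h4, hxD, h3, hyB⟩
      · exact Or.inl ⟨x, hx, h4, hxD⟩
    · exact Or.inl ⟨y, hy, hyB, h3⟩
  rcases key P Q R hP hPQ hPR with ⟨p, hp, hp1, hp2⟩ | ⟨x, hx, y, hy, h1, h2, h3, h4⟩
  swap
  · exact Or.inr (Or.inr ⟨x, h1, y, h3, h2, h4, hPind x hx y hy⟩)
  rcases key Q P R hQ hQP hQR with ⟨q, hq, hq1, hq2⟩ | ⟨x, hx, y, hy, h1, h2, h3, h4⟩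
  swap
  · exact Or.inr (Or.inl ⟨x, h1, y, h3, h2, h4, hQind x hx y hy⟩)
  rcases key R P Q hR hRP hRQ with ⟨r, hr, hr1, hr2⟩ | ⟨x, hx, y, hy, h1, h2, h3, h4⟩
  swap
  · exact Or.inl ⟨x, h1, y, h3, h2, h4, hRind x hx y hy⟩
  by_cases h1 : G.Adj p q
  · by_cases h2 : G.Adj q r
    · exact Or.inr (Or.inl ⟨p, hp, r, hr, hp2, hr1, htf p q r h1 h2⟩)
    · exact Or.inr (Or.inr ⟨q, hq, r, hr, hq2, hr2, h2⟩)
  · exact Or.inl ⟨p, hp, q, hq, hp1, hq1, h1⟩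

/-- Two neighbours `b`, `d` of both `a` and `c` with equal neighbourhoods or with compatible
pendant edges. -/
def MatchedPendants (G : SimpleGraph V) (a c b d : V) : Prop :=
  ∃ b1 b2 d1 d2, NbrsAre G b a c b1 b2 ∧ NbrsAre G d a c d1 d2 ∧
    (¬ StrongConflict G s(b, b1) s(d, d1) ∨ (d1 = b1 ∧ d2 = b2 ∧ a ≠ d1 ∧ c ≠ d1))

lemma matchedPendants_of_three (hreg : ∀ v, (nbrs G v).card = 4)
    (htf : ∀ a b c, G.Adj a b → G.Adj b c → ¬ G.Adj a c) {a c b d x : V} (hac : a ≠ c)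
    (hab : G.Adj a b) (had : G.Adj a d) (hax : G.Adj a x) (hcb : G.Adj c b) (hcd : G.Adj c d)
    (hcx : G.Adj c x) (hbd : b ≠ d) (hbx : b ≠ x) (hdx : d ≠ x) :
    MatchedPendants G a c b d ∨ MatchedPendants G a c b x ∨ MatchedPendants G a c d x := by
  have hcard : ∀ v, G.Adj a v → G.Adj c v → (((nbrs G v).erase a).erase c).card = 2 := by
    intro v h1 h2
    rw [Finset.card_erase_of_mem (by simp [h2.symm, hac.symm]),
      Finset.card_erase_of_mem (by simp [h1.symm])]
    have := hreg v
    omega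
  have hind : ∀ v, ∀ y ∈ ((nbrs G v).erase a).erase c, ∀ z ∈ ((nbrs G v).erase a).erase c,
      ¬ G.Adj y z := by
    intro v y hy z hz
    simp only [Finset.mem_erase, mem_nbrs] at hy hz
    exact htf y v z hy.2.2.symm hz.2.2
  have hsub : ∀ u v, G.Adj a u → G.Adj c u → G.Adj a v → G.Adj c v →
      ((nbrs G u).erase a).erase c ⊆ ((nbrs G v).erase a).erase c →
      MatchedPendants G a c u v ∧ MatchedPendants G a c v u := by
    intro u v h1 h2 h3 h4 hs
    have heq := Finset.eq_of_subset_of_card_le hs (by rw [hcard u h1 h2, hcard v h3 h4])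
    obtain ⟨r, t, hN, h5, h6, -⟩ := exists_nbrsAre_of_two (hreg u) h1.symm h2.symm hac
    have hN' : NbrsAre G v a c r t := by
      intro y
      have h7 := Finset.ext_iff.mp heq y
      simp only [Finset.mem_erase, mem_nbrs] at h7
      have h8 := hN y
      by_cases hya : y = a
      · subst hya; simp [h3.symm]
      by_cases hyc : y = c
      · subst hyc; simp [h4.symm]
      tauto
    exact ⟨⟨r, t, r, t, hN, hN', Or.inr ⟨rfl, rfl, h5.symm, h6.symm⟩⟩,
      ⟨r, t, r, t, hN', hN, Or.inr ⟨rfl, rfl, h5.symm, h6.symm⟩⟩⟩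
  have hpend : ∀ u v, G.Adj a u → G.Adj c u → G.Adj a v → G.Adj c v → u ≠ v →
      (∃ y ∈ ((nbrs G u).erase a).erase c, ∃ z ∈ ((nbrs G v).erase a).erase c,
        y ∉ ((nbrs G v).erase a).erase c ∧ z ∉ ((nbrs G u).erase a).erase c ∧ ¬ G.Adj y z) →
      MatchedPendants G a c u v := by
    rintro u v h1 h2 h3 h4 hne ⟨y, hy, z, hz, hyv, hzu, hyz⟩
    simp only [Finset.mem_erase, mem_nbrs] at hy hz hyv hzu
    obtain ⟨y', hNu, -⟩ := exists_nbrsAre_of_three (hreg u) h1.symm h2.symm hy.2.2 hac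
      hy.2.1.symm hy.1.symm
    obtain ⟨z', hNv, -⟩ := exists_nbrsAre_of_three (hreg v) h3.symm h4.symm hz.2.2 hac
      hz.2.1.symm hz.1.symm
    exact ⟨y, y', z, z', hNu, hNv, Or.inl (not_strongConflict hne (htf u a v h1.symm h3) hy.2.2
      hz.2.2 (by tauto) (by tauto) hyz)⟩
  by_cases h1 : MatchedPendants G a c b d
  · exact Or.inl h1
  by_cases h2 : MatchedPendants G a c b x
  · exact Or.inr (Or.inl h2)
  by_cases h3 : MatchedPendants G a c d x
  · exact Or.inr (Or.inr h3)
  rcases exists_nonadj_of_pairs htf (hcard b hab hcb).le (hind b) (hcard d had hcd).le (hind d)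
    (hcard x hax hcx).le (hind x) (fun h => h1 (hsub b d hab hcb had hcd h).1)
    (fun h => h1 (hsub d b had hcd hab hcb h).2) (fun h => h2 (hsub b x hab hcb hax hcx h).1)
    (fun h => h2 (hsub x b hax hcx hab hcb h).2) (fun h => h3 (hsub d x had hcd hax hcx h).1)
    (fun h => h3 (hsub x d hax hcx had hcd h).2) with h | h | h
  · exact Or.inl (hpend b d hab hcb had hcd hbd h)
  · exact Or.inr (Or.inl (hpend b x hab hcb hax hcx hbx h))
  · exact Or.inr (Or.inr (hpend d x had hcd hax hcx hdx h))

lemma strongColorable_of_four_common_nbrs (hreg : ∀ v, (nbrs G v).card = 4) (hconn : G.Connected)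
    (htf : ∀ a b c, G.Adj a b → G.Adj b c → ¬ G.Adj a c) {a b c d x y : V} (hac : a ≠ c)
    (ha : NbrsAre G a b d x y) (hc : NbrsAre G c b d x y) (hbd : b ≠ d) (hbx : b ≠ x)
    (hdx : d ≠ x) : StrongColorable G := by
  have hdeg : ∀ v, (nbrs G v).card ≤ 4 := fun v => (hreg v).le
  rcases matchedPendants_of_three hreg htf hac ((ha b).mpr (by simp)) ((ha d).mpr (by simp))
    ((ha x).mpr (by simp)) ((hc b).mpr (by simp)) ((hc d).mpr (by simp)) ((hc x).mpr (by simp))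
    hbd hbx hdx with ⟨b1, b2, d1, d2, hb, hd, h⟩ | ⟨b1, b2, d1, d2, hb, hd, h⟩ |
      ⟨b1, b2, d1, d2, hb, hd, h⟩
  · exact strongColorable_of_four_common hdeg hconn hac hbd ha hb hc hd (h.imp_right (by tauto))
  · exact strongColorable_of_four_common hdeg hconn hac hbx ha.third.second hb hc.third.second hd
      (h.imp_right (by tauto))
  · exact strongColorable_of_four_common hdeg hconn hac hdx (fun z => by rw [ha z]; tauto) hb
      (fun z => by rw [hc z]; tauto : NbrsAre G c d x b y) hd (h.imp_right (by tauto))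

lemma strongColorable_of_three_common_nbrs (hreg : ∀ v, (nbrs G v).card = 4)
    (hconn : G.Connected) (htf : ∀ a b c, G.Adj a b → G.Adj b c → ¬ G.Adj a c) {a c b d x : V}
    (hac : a ≠ c) (hab : G.Adj a b) (had : G.Adj a d) (hax : G.Adj a x) (hcb : G.Adj c b)
    (hcd : G.Adj c d) (hcx : G.Adj c x) (hbd : b ≠ d) (hbx : b ≠ x) (hdx : d ≠ x) :
    StrongColorable G := by
  have hdeg : ∀ v, (nbrs G v).card ≤ 4 := fun v => (hreg v).le
  obtain ⟨a', ha, ha1, ha2, ha3⟩ := exists_nbrsAre_of_three (hreg a) hab had hax hbd hbx hdx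
  obtain ⟨c', hc, hc1, hc2, hc3⟩ := exists_nbrsAre_of_three (hreg c) hcb hcd hcx hbd hbx hdx
  by_cases hac' : a' = c'
  · subst hac'
    exact strongColorable_of_four_common_nbrs hreg hconn htf hac ha hc hbd hbx hdx
  by_cases hadj : G.Adj a' c'
  · exact strongColorable_of_three_common hdeg hconn htf ha hc hac hbd hadj
  have hcompat : ¬ StrongConflict G s(a, a') s(c, c') := by
    refine not_strongConflict hac (htf a b c hab hcb.symm) ((ha _).mpr (by simp))
      ((hc _).mpr (by simp)) ?_ ?_ hadj
    · rw [hc]; tauto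
    · rw [ha]; rintro (h | h | h | h) <;> tauto
  have hequal : ∀ u v r t, u ≠ v → NbrsAre G u a c r t → NbrsAre G v a c r t → a ≠ r → c ≠ r →
      StrongColorable G := fun u v r t huv h1 h2 h3 h4 =>
    strongColorable_of_four_common_nbrs hreg hconn htf huv h1 h2 hac h3 h4
  rcases matchedPendants_of_three hreg htf hac hab had hax hcb hcd hcx hbd hbx hdx with
    ⟨b1, b2, d1, d2, hb, hd, h | ⟨rfl, rfl, h1, h2⟩⟩ |
    ⟨b1, b2, d1, d2, hb, hd, h | ⟨rfl, rfl, h1, h2⟩⟩ |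
    ⟨b1, b2, d1, d2, hb, hd, h | ⟨rfl, rfl, h1, h2⟩⟩
  · exact strongColorable_of_two_pairs hdeg hconn hac ha hb hc hd hcompat h
  · exact hequal _ _ _ _ hbd hb hd h1 h2
  · exact strongColorable_of_two_pairs hdeg hconn hac ha.third.second hb hc.third.second hd
      hcompat h
  · exact hequal _ _ _ _ hbx hb hd h1 h2
  · exact strongColorable_of_two_pairs hdeg hconn hac
      (fun z => by rw [ha z]; tauto : NbrsAre G a d x b a') hb
      (fun z => by rw [hc z]; tauto : NbrsAre G c d x b c') hd hcompat h
  · exact hequal _ _ _ _ hdx hb hd h1 h2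

end CommonNeighbours

section TwinSquares

open scoped Classical

variable {V : Type*} [Fintype V] {G : SimpleGraph V}

lemma degIn_le_three_of_notMem {S : Finset (Sym2 V)} {w p q r t : V} (hN : NbrsAre G w p q r t)
    (hp : s(w, p) ∉ S) : degIn G S w ≤ 3 := by
  refine (degIn_le_of_subset (K := {q, r, t}) fun x hx hS => ?_).trans Finset.card_le_three
  rcases (hN x).mp hx with rfl | h
  · exact absurd hS hp
  · simpa using h

lemma degIn_le_two_of_notMem {S : Finset (Sym2 V)} {w p q r t : V} (hN : NbrsAre G w p q r t)
    (hp : s(w, p) ∉ S) (hq : s(w, q) ∉ S) : degIn G S w ≤ 2 := by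
  refine (degIn_le_of_subset (K := {r, t}) fun x hx hS => ?_).trans Finset.card_le_two
  rcases (hN x).mp hx with rfl | rfl | h
  · exact absurd hS hp
  · exact absurd hS hq
  · simpa using h

lemma degIn_le_one_of_notMem {S : Finset (Sym2 V)} {w p q r t : V} (hN : NbrsAre G w p q r t)
    (hp : s(w, p) ∉ S) (hq : s(w, q) ∉ S) (hr : s(w, r) ∉ S) : degIn G S w ≤ 1 := by
  refine (degIn_le_of_subset (K := {t}) fun x hx hS => ?_).trans (Finset.card_singleton t).le
  rcases (hN x).mp hx with rfl | rfl | rfl | h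
  · exact absurd hS hp
  · exact absurd hS hq
  · exact absurd hS hr
  · simpa using h

lemma degIn_eq_zero_of_notMem {S : Finset (Sym2 V)} {w p q r t : V} (hN : NbrsAre G w p q r t)
    (hp : s(w, p) ∉ S) (hq : s(w, q) ∉ S) (hr : s(w, r) ∉ S) (ht : s(w, t) ∉ S) :
    degIn G S w = 0 := by
  refine degIn_eq_zero fun x hx => ?_
  rcases (hN x).mp hx with rfl | rfl | rfl | rfl <;> assumption

lemma degIn_le_three_of_adj (hdeg : ∀ v, (nbrs G v).card ≤ 4) {S : Finset (Sym2 V)} {w v : V}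
    (hadj : G.Adj w v) (h : s(w, v) ∉ S) : degIn G S w ≤ 3 := by
  refine (degIn_le_of_subset (K := (nbrs G w).erase v) fun x hx hS => ?_).trans ?_
  · simp only [Finset.mem_erase, mem_nbrs]
    exact ⟨fun hxv => h (hxv ▸ hS), hx⟩
  · rw [Finset.card_erase_of_mem (mem_nbrs.mpr hadj)]
    have := hdeg w
    omega

lemma le_card_avail_of_nbrsAre {S : Finset (Sym2 V)} {C : Sym2 V → Fin 21}
    (hS : ∀ e ∈ S, e ∈ G.edgeSet) {u v p q r p' q' r' : V} {k : ℕ} (hu : NbrsAre G u v p q r)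
    (hv : NbrsAre G v u p' q' r') (huv : s(u, v) ∉ S)
    (h : degIn G S p + degIn G S q + degIn G S r +
      (degIn G S p' + degIn G S q' + degIn G S r') + k ≤ 21) :
    k ≤ (avail G S C s(u, v)).card := by
  have h1 := conflicting_card_le hS ((hu v).mpr (by simp)) huv
  have h2 := sum_erase_le (degIn G S) fun x hx => (hu x).mp hx
  have h3 := sum_erase_le (degIn G S) fun x hx => (hv x).mp hx
  exact le_card_avail (by omega)

/-- Two 4-cycles `a b c d` and `f p c q` sharing `c`, with `a` and `f` adjacent. -/
structure TwinSquares (G : SimpleGraph V) (a b c d f p q a' f' b1 b2 d1 d2 p1 p2 q1 q2 : V) :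
    Prop where
  at_a : NbrsAre G a b d f a'
  at_f : NbrsAre G f p q a f'
  at_c : NbrsAre G c b d p q
  at_b : NbrsAre G b a c b1 b2
  at_d : NbrsAre G d a c d1 d2
  at_p : NbrsAre G p f c p1 p2
  at_q : NbrsAre G q f c q1 q2
  hab' : a' ≠ b
  had' : a' ≠ d
  haf' : a' ≠ f
  hfp' : f' ≠ p
  hfq' : f' ≠ q
  hfa' : f' ≠ a
  hac : a ≠ c
  hfc : f ≠ c
  hbd : b ≠ d
  hbp : b ≠ p
  hbq : b ≠ q
  hdp : d ≠ p
  hdq : d ≠ q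
  hpq : p ≠ q

/-- The seven edges colored last. -/
noncomputable def twinCore (a b c d f p q : V) : Finset (Sym2 V) :=
  {s(c, d), s(c, q), s(a, f)} ∪ {s(a, b), s(a, d), s(f, p), s(f, q)}

/-- All edges except the seven edges colored last. -/
noncomputable def twinRest (G : SimpleGraph V) (a b c d f p q : V) : Finset (Sym2 V) :=
  edgesAvoid G ∅ \ twinCore a b c d f p q

lemma twinRest_subset_edgeSet {a b c d f p q : V} :
    ∀ e ∈ twinRest G a b c d f p q, e ∈ G.edgeSet := by
  intro e he
  exact (mem_edgesAvoid.mp (Finset.mem_sdiff.mp he).1).1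

lemma mem_twinRest {a b c d f p q u v : V} :
    s(u, v) ∈ twinRest G a b c d f p q ↔ G.Adj u v ∧ s(u, v) ∉ twinCore a b c d f p q := by
  simp [twinRest]

variable {a b c d f p q a' f' b1 b2 d1 d2 p1 p2 q1 q2 : V}

lemma notMem_of_subset_twinRest {S : Finset (Sym2 V)} (hS : S ⊆ twinRest G a b c d f p q)
    {e : Sym2 V} (he : e ∈ twinCore a b c d f p q) : e ∉ S :=
  fun h => (Finset.mem_sdiff.mp (hS h)).2 he

/-- Degrees in the set of edges colored before the last seven. -/
lemma TwinSquares.degIn_le (h : TwinSquares G a b c d f p q a' f' b1 b2 d1 d2 p1 p2 q1 q2)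
    {S : Finset (Sym2 V)} (hS : S ⊆ twinRest G a b c d f p q) :
    degIn G S a ≤ 1 ∧ degIn G S f ≤ 1 ∧ degIn G S b ≤ 3 ∧ degIn G S d ≤ 2 ∧ degIn G S p ≤ 3 ∧
      degIn G S q ≤ 2 ∧ degIn G S c ≤ 2 := by
  have key := fun {e} => notMem_of_subset_twinRest (e := e) hS
  refine ⟨degIn_le_one_of_notMem h.at_a (key ?_) (key ?_) (key ?_),
    degIn_le_one_of_notMem h.at_f (key ?_) (key ?_) (key ?_),
    degIn_le_three_of_notMem h.at_b (key ?_), degIn_le_two_of_notMem h.at_d (key ?_) (key ?_),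
    degIn_le_three_of_notMem h.at_p (key ?_), degIn_le_two_of_notMem h.at_q (key ?_) (key ?_),
    degIn_le_two_of_notMem (t := p) (r := b) (p := d) (q := q)
      (fun z => by rw [h.at_c z]; tauto) (key ?_) (key ?_)⟩ <;>
  simp [twinCore]

end TwinSquares

section TwinSquaresColoring

open scoped Classical

variable {V : Type*} [Fintype V] {G : SimpleGraph V}

/-- A partial coloring extends to two compatible edges with a common available color. -/
lemma ProperOn.extend_pair {S : Finset (Sym2 V)} {C : Sym2 V → Fin 21} (hC : ProperOn G S C)
    {e g : Sym2 V} (he : e ∉ S) (hg : g ∉ S) (h : ¬ StrongConflict G e g) {x : Fin 21}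
    (hxe : x ∈ avail G S C e) (hxg : x ∈ avail G S C g) :
    ∃ C', ProperOn G (S ∪ {e, g}) C' ∧ (∀ f ∈ S, C' f = C f) ∧ C' e = x ∧ C' g = x := by
  obtain ⟨C', h1, h2, h3⟩ := hC.extend (F := {e, g}) (c := fun _ => x) (by simp [he, hg])
    (by simp [hxe, hxg]) (by
      intro y hy z hz hne hyz
      simp only [Finset.mem_insert, Finset.mem_singleton] at hy hz
      rcases hy with rfl | rfl <;> rcases hz with rfl | rfl
      · exact absurd rfl hne
      · exact absurd hyz h
      · exact absurd hyz.symm h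
      · exact absurd rfl hne)
  exact ⟨C', h1, h2, h3 e (by simp), h3 g (by simp)⟩

lemma mem_avail_union {S F : Finset (Sym2 V)} {C C' : Sym2 V → Fin 21} {e : Sym2 V} {x y : Fin 21}
    (hx : x ∈ avail G S C e) (hS : ∀ f ∈ S, C' f = C f) (hF : ∀ f ∈ F, C' f = y) (hxy : x ≠ y) :
    x ∈ avail G (S ∪ F) C' e := by
  rw [mem_avail] at hx ⊢
  intro f hf hef
  by_cases h : f ∈ S
  · rw [hS f h]; exact hx f h hef
  · rw [hF f (by simpa [h] using hf)]; exact hxy.symm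

lemma avail_subset_of_forall_not {S : Finset (Sym2 V)} {C C' : Sym2 V → Fin 21} {e z : Sym2 V}
    (hS : ∀ f ∈ S.erase z, C' f = C f) (hz : ¬ StrongConflict G e z) :
    avail G (S.erase z) C e ⊆ avail G S C' e := by
  intro x hx
  rw [mem_avail] at hx ⊢
  intro f hf hef
  have hfz : f ≠ z := by rintro rfl; exact hz hef
  have hf' := Finset.mem_erase.mpr ⟨hfz, hf⟩
  rw [hS f hf']
  exact hx f hf' hef

lemma avail_erase_color_subset {S : Finset (Sym2 V)} {C C' : Sym2 V → Fin 21} {e z : Sym2 V}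
    (hS : ∀ f ∈ S.erase z, C' f = C f) :
    (avail G (S.erase z) C e).erase (C' z) ⊆ avail G S C' e := by
  intro x hx
  obtain ⟨hne, hx⟩ := Finset.mem_erase.mp hx
  rw [mem_avail] at hx ⊢
  intro f hf hef
  by_cases hfz : f = z
  · subst hfz; exact hne.symm
  · have hf' := Finset.mem_erase.mpr ⟨hfz, hf⟩
    rw [hS f hf']
    exact hx f hf' hef

/-- Two colors, each repeated near `e`, need to be counted once each. -/
lemma avail_erase_erase_subset {S : Finset (Sym2 V)} {C : Sym2 V → Fin 21}
    {e g₁ g₂ k₁ k₂ : Sym2 V} (hk₁ : k₁ ∈ (S.erase g₁).erase g₂) (hk₂ : k₂ ∈ (S.erase g₁).erase g₂)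
    (h₁ : C k₁ = C g₁) (h₂ : C k₂ = C g₂) (hc₁ : StrongConflict G e k₁)
    (hc₂ : StrongConflict G e k₂) :
    avail G ((S.erase g₁).erase g₂) C e ⊆ avail G S C e := by
  intro x hx
  rw [mem_avail] at hx ⊢
  intro f hf hef
  by_cases hf1 : f = g₁
  · subst hf1; rw [← h₁]; exact hx k₁ hk₁ hc₁
  by_cases hf2 : f = g₂
  · subst hf2; rw [← h₂]; exact hx k₂ hk₂ hc₂
  exact hx f (by simp [hf, hf1, hf2]) hef

lemma card_le_card_biUnion_of_three_four {ι : Type*} [DecidableEq ι] (A B : Finset ι)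
    (L : ι → Finset (Fin 21)) (hA : A.card ≤ 3) (hB : B.card ≤ 4)
    (hA5 : ∀ i ∈ A, 5 ≤ (L i).card) (hB6 : ∀ i ∈ B, 6 ≤ (L i).card) {e f : ι} (he : e ∈ B)
    (hf : f ∈ B)
    (hef : 7 ≤ (L e ∪ L f).card) (T : Finset ι) (hT : T ⊆ A ∪ B) :
    T.card ≤ (T.biUnion L).card := by
  have hT7 : T.card ≤ 7 := by
    have := Finset.card_le_card hT
    have := Finset.card_union_le A B
    omega
  by_cases h1 : e ∈ T ∧ f ∈ T
  · have : L e ∪ L f ⊆ T.biUnion L :=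
      Finset.union_subset (Finset.subset_biUnion_of_mem L h1.1)
        (Finset.subset_biUnion_of_mem L h1.2)
    have := Finset.card_le_card this
    omega
  by_cases h2 : ∃ i ∈ T, i ∈ B
  · obtain ⟨i, hi, hiB⟩ := h2
    have h3 := Finset.card_le_card (Finset.subset_biUnion_of_mem L hi)
    have h4 := hB6 i hiB
    by_cases h7 : T.card ≤ 6
    · omega
    have hTe : T = A ∪ B := Finset.eq_of_subset_of_card_le hT (by
      have := Finset.card_union_le A B
      omega)
    exact absurd ⟨by simp [hTe, he], by simp [hTe, hf]⟩ h1
  · push Not at h2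
    have hTA : T ⊆ A := fun i hi => by
      have := hT hi
      simpa [h2 i hi] using this
    have h3 := Finset.card_le_card hTA
    rcases T.eq_empty_or_nonempty with rfl | ⟨i, hi⟩
    · simp
    · have h4 := Finset.card_le_card (Finset.subset_biUnion_of_mem L hi)
      have := hA5 i (hTA hi)
      omega

end TwinSquaresColoring

section TwinSquaresRepeat

open scoped Classical

variable {V : Type*} [Fintype V] {G : SimpleGraph V}
  {a b c d f p q a' f' b1 b2 d1 d2 p1 p2 q1 q2 : V}

lemma TwinSquares.adjs (h : TwinSquares G a b c d f p q a' f' b1 b2 d1 d2 p1 p2 q1 q2) :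
    G.Adj a b ∧ G.Adj a d ∧ G.Adj a f ∧ G.Adj a a' ∧ G.Adj f p ∧ G.Adj f q ∧ G.Adj f f' ∧
      G.Adj c b ∧ G.Adj c d ∧ G.Adj c p ∧ G.Adj c q := by
  simp [h.at_a _, h.at_f _, h.at_c _]

lemma TwinSquares.nonadjs (h : TwinSquares G a b c d f p q a' f' b1 b2 d1 d2 p1 p2 q1 q2)
    (htf : ∀ a b c, G.Adj a b → G.Adj b c → ¬ G.Adj a c) :
    ¬ G.Adj c f ∧ ¬ G.Adj f b ∧ ¬ G.Adj f d ∧ ¬ G.Adj c a ∧ ¬ G.Adj a p ∧ ¬ G.Adj a q ∧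
      ¬ G.Adj d p ∧ ¬ G.Adj d q := by
  obtain ⟨hab, had, haf, haa', hfp, hfq, hff', hcb, hcd, hcp, hcq⟩ := h.adjs
  exact ⟨htf _ _ _ hcp hfp.symm, htf _ _ _ haf.symm hab, htf _ _ _ haf.symm had,
    htf _ _ _ hcb hab.symm, htf _ _ _ haf hfp, htf _ _ _ haf hfq, htf _ _ _ hcd.symm hcp,
    htf _ _ _ hcd.symm hcq⟩

lemma TwinSquares.not_adj_c (h : TwinSquares G a b c d f p q a' f' b1 b2 d1 d2 p1 p2 q1 q2)
    (htf : ∀ a b c, G.Adj a b → G.Adj b c → ¬ G.Adj a c) :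
    ¬ G.Adj c a' ∧ ¬ G.Adj c f' := by
  obtain ⟨hab, had, haf, haa', hfp, hfq, hff', hcb, hcd, hcp, hcq⟩ := h.adjs
  obtain ⟨-, nfb, nfd, -, nap, naq, -, -⟩ := h.nonadjs htf
  constructor
  · rw [h.at_c]
    rintro (e | e | e | e)
    · exact h.hab' e
    · exact h.had' e
    · exact nap (e ▸ haa')
    · exact naq (e ▸ haa')
  · rw [h.at_c]
    rintro (e | e | e | e)
    · exact nfb (e ▸ hff')
    · exact nfd (e ▸ hff')
    · exact h.hfp' e
    · exact h.hfq' e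

/-- The four edges receiving only two colors lie outside the core and are distinct. -/
lemma TwinSquares.repeated_mem_twinRest
    (h : TwinSquares G a b c d f p q a' f' b1 b2 d1 d2 p1 p2 q1 q2)
    (htf : ∀ a b c, G.Adj a b → G.Adj b c → ¬ G.Adj a c) :
    s(c, b) ∈ twinRest G a b c d f p q ∧ s(f, f') ∈ twinRest G a b c d f p q ∧
      s(c, p) ∈ twinRest G a b c d f p q ∧ s(a, a') ∈ twinRest G a b c d f p q := by
  obtain ⟨hab, had, haf, haa', hfp, hfq, hff', hcb, hcd, hcp, hcq⟩ := h.adjs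
  obtain ⟨ncf, nfb, nfd, nca, nap, naq, ndp, ndq⟩ := h.nonadjs htf
  obtain ⟨nca', ncf'⟩ := h.not_adj_c htf
  have h1 := h.hac
  have h2 := h.hfc
  have h3 := h.hbd
  have h4 := h.hbp
  have h5 := h.hbq
  have h6 := h.hdp
  have h7 := h.hdq
  have h8 := h.hpq
  have := hab.ne
  have := haa'.ne
  have := hff'.ne
  have := haf.ne
  have := hfp.ne
  have := had.ne
  have := h.hab'
  have := h.had'
  have := h.haf'
  have := h.hfp'
  have := h.hfq'
  have := h.hfa'
  have := hcp.ne
  have := hcb.ne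
  have : c ≠ a' := by rintro rfl; exact nca haa'.symm
  have : c ≠ f' := by rintro rfl; exact ncf hff'.symm
  simp only [mem_twinRest, hcb, hff', hcp, haa', true_and, twinCore, Finset.mem_union,
    Finset.mem_insert, Finset.mem_singleton, Sym2.eq_iff]
  refine ⟨?_, ?_, ?_, ?_⟩ <;> grind

lemma TwinSquares.pair_ne (h : TwinSquares G a b c d f p q a' f' b1 b2 d1 d2 p1 p2 q1 q2)
    (htf : ∀ a b c, G.Adj a b → G.Adj b c → ¬ G.Adj a c) :
    s(c, b) ≠ s(f, f') ∧ s(c, b) ≠ s(c, p) ∧ s(c, b) ≠ s(a, a') ∧ s(f, f') ≠ s(c, p) ∧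
      s(f, f') ≠ s(a, a') ∧ s(c, p) ≠ s(a, a') := by
  obtain ⟨hab, had, haf, haa', hfp, hfq, hff', hcb, hcd, hcp, hcq⟩ := h.adjs
  have h1 := h.hac
  have h2 := h.hfc
  have h4 := h.hbp
  have := haf.ne
  have := hab.ne
  have := hfp.ne
  have := h.hfa'
  obtain ⟨ncf, nfb, nfd, nca, nap, naq, ndp, ndq⟩ := h.nonadjs htf
  have : c ≠ a' := by rintro rfl; exact nca haa'.symm
  have : c ≠ f' := by rintro rfl; exact ncf hff'.symm
  simp only [ne_eq, Sym2.eq_iff]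
  refine ⟨?_, ?_, ?_, ?_, ?_, ?_⟩ <;> grind

/-- A coloring avoiding the two squares extends with two colors to four of the edges. -/
lemma TwinSquares.exists_repeat (hdeg : ∀ v, (nbrs G v).card ≤ 4) (hconn : G.Connected)
    (h : TwinSquares G a b c d f p q a' f' b1 b2 d1 d2 p1 p2 q1 q2)
    (htf : ∀ a b c, G.Adj a b → G.Adj b c → ¬ G.Adj a c) (hbf' : ¬ G.Adj b f')
    (hpa' : ¬ G.Adj p a') :
    ∃ C, ProperOn G (edgesAvoid G {c, b, d, p, q, a, f} ∪ {s(c, b), s(f, f')} ∪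
      {s(c, p), s(a, a')}) C ∧ C s(c, b) = C s(f, f') ∧ C s(c, p) = C s(a, a') := by
  obtain ⟨hab, had, haf, haa', hfp, hfq, hff', hcb, hcd, hcp, hcq⟩ := h.adjs
  obtain ⟨ncf, nfb, nfd, nca, nap, naq, ndp, ndq⟩ := h.nonadjs htf
  obtain ⟨nca', ncf'⟩ := h.not_adj_c htf
  obtain ⟨ne1, ne2, ne3, ne4, ne5, ne6⟩ := h.pair_ne htf
  set M : Finset V := {c, b, d, p, q, a, f} with hM
  obtain ⟨C, hC⟩ := exists_properOn_edgesAvoid hdeg hconn (M := M) ⟨c, by simp [hM]⟩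
  set S := edgesAvoid G M with hSdef
  have hS : ∀ e ∈ S, e ∈ G.edgeSet := fun e he => (mem_edgesAvoid.mp he).1
  have h0 : ∀ w ∈ M, degIn G S w = 0 := fun w hw => degIn_edgesAvoid_eq_zero hw
  have h3 : ∀ m ∈ M, ∀ w, G.Adj m w → degIn G S w ≤ 3 :=
    fun m hm w hw => degIn_edgesAvoid_le_three hdeg hm hw
  have hout : ∀ u ∈ M, ∀ v, s(u, v) ∉ S := fun u hu v => mk_notMem_edgesAvoid hu
  have hcb15 : 15 ≤ (avail G S C s(c, b)).card := by
    refine le_card_avail_of_nbrsAre hS h.at_c h.at_b.second (hout c (by simp [hM]) b) ?_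
    have e1 := h0 d (by simp [hM])
    have e2 := h0 p (by simp [hM])
    have e3 := h0 q (by simp [hM])
    have e4 := h0 a (by simp [hM])
    have e5 := h3 b (by simp [hM]) b1 ((h.at_b b1).mpr (by simp))
    have e6 := h3 b (by simp [hM]) b2 ((h.at_b b2).mpr (by simp))
    omega
  have hcp15 : 15 ≤ (avail G S C s(c, p)).card := by
    refine le_card_avail_of_nbrsAre hS h.at_c.third h.at_p.second (hout c (by simp [hM]) p) ?_
    have e1 := h0 d (by simp [hM])
    have e2 := h0 b (by simp [hM])
    have e3 := h0 q (by simp [hM])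
    have e4 := h0 f (by simp [hM])
    have e5 := h3 p (by simp [hM]) p1 ((h.at_p p1).mpr (by simp))
    have e6 := h3 p (by simp [hM]) p2 ((h.at_p p2).mpr (by simp))
    omega
  have hff9 : 9 ≤ (avail G S C s(f, f')).card := by
    refine le_card_avail ?_
    have e0 := conflicting_card_le hS hff' (hout f (by simp [hM]) f')
    have e1 := sum_erase_le (degIn G S) fun x hx => (h.at_f.fourth x).mp hx
    have e2 := sum_degIn_erase_le hdeg S hff'.symm
    have e3 := h0 p (by simp [hM])
    have e4 := h0 q (by simp [hM])
    have e5 := h0 a (by simp [hM])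
    omega
  have haa9 : 9 ≤ (avail G S C s(a, a')).card := by
    refine le_card_avail ?_
    have e0 := conflicting_card_le hS haa' (hout a (by simp [hM]) a')
    have e1 := sum_erase_le (degIn G S) fun x hx => (h.at_a.fourth x).mp hx
    have e2 := sum_degIn_erase_le hdeg S haa'.symm
    have e3 := h0 b (by simp [hM])
    have e4 := h0 d (by simp [hM])
    have e5 := h0 f (by simp [hM])
    omega
  have hinter : ∀ A B : Finset (Fin 21), 15 ≤ A.card → 9 ≤ B.card → 2 ≤ (A ∩ B).card := by
    intro A B hA hB
    have e1 := Finset.card_union_add_card_inter A B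
    have e2 := Finset.card_le_univ (A ∪ B)
    rw [Fintype.card_fin] at e2
    omega
  obtain ⟨γ, hγ⟩ := Finset.card_pos.mp (lt_of_lt_of_le two_pos (hinter _ _ hcb15 hff9))
  obtain ⟨δ, hδ, hδγ⟩ := Finset.exists_mem_ne (lt_of_lt_of_le one_lt_two (hinter _ _ hcp15 haa9)) γ
  rw [Finset.mem_inter] at hγ hδ
  have hnc1 : ¬ StrongConflict G s(c, b) s(f, f') :=
    not_strongConflict h.hfc.symm ncf hcb hff' nfb ncf' hbf'
  have hnc2 : ¬ StrongConflict G s(c, p) s(a, a') :=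
    not_strongConflict h.hac.symm nca hcp haa' nap nca' hpa'
  obtain ⟨C1, hC1, hC1S, hC1e, hC1f⟩ := hC.extend_pair (hout c (by simp [hM]) b)
    (hout f (by simp [hM]) f') hnc1 hγ.1 hγ.2
  have hF : ∀ e ∈ ({s(c, b), s(f, f')} : Finset (Sym2 V)), C1 e = γ := by
    simp [hC1e, hC1f]
  obtain ⟨C2, hC2, hC2S, hC2e, hC2f⟩ := hC1.extend_pair (e := s(c, p)) (g := s(a, a'))
    (by simp [hout c (by simp [hM]) p, ne2.symm, ne4.symm])
    (by simp [hout a (by simp [hM]) a', ne3.symm, ne5.symm]) hnc2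
    (mem_avail_union hδ.1 hC1S hF hδγ) (mem_avail_union hδ.2 hC1S hF hδγ)
  refine ⟨C2, hC2, ?_, hC2e.trans hC2f.symm⟩
  rw [hC2S _ (by simp), hC2S _ (by simp), hC1e, hC1f]

end TwinSquaresRepeat

section TwinSquaresExtend

open scoped Classical

variable {V : Type*} [Fintype V] {G : SimpleGraph V}
  {a b c d f p q a' f' b1 b2 d1 d2 p1 p2 q1 q2 : V}

/-- Every edge is a core edge, one of the four repeated edges, a pendant edge at one of
`b`, `d`, `p`, `q`, or avoids the two squares. -/
lemma TwinSquares.edge_cases (h : TwinSquares G a b c d f p q a' f' b1 b2 d1 d2 p1 p2 q1 q2)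
    {e : Sym2 V} (he : e ∈ twinRest G a b c d f p q) :
    e ∈ edgesAvoid G {c, b, d, p, q, a, f} ∪ {s(c, b), s(f, f')} ∪ {s(c, p), s(a, a')} ∨
      e ∈ ({s(b, b1), s(b, b2), s(d, d1), s(d, d2), s(p, p1), s(p, p2), s(q, q1), s(q, q2)} :
        Finset (Sym2 V)) := by
  have heG := twinRest_subset_edgeSet e he
  by_cases hM : e ∈ edgesAvoid G {c, b, d, p, q, a, f}
  · simp [hM]
  have : ∃ v ∈ e, v ∈ ({c, b, d, p, q, a, f} : Finset V) := by
    by_contra hcon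
    push Not at hcon
    exact hM (mem_edgesAvoid.mpr ⟨heG, hcon⟩)
  obtain ⟨v, hve, hv⟩ := this
  obtain ⟨y, rfl⟩ := Sym2.mem_iff_exists.mp hve
  have hy : G.Adj v y := heG
  have hcore := (mem_twinRest.mp he).2
  simp only [Finset.mem_insert, Finset.mem_singleton] at hv
  have hne : ∀ x, s(v, x) ∈ twinCore a b c d f p q → y ≠ x := by
    rintro x hx rfl
    exact hcore hx
  rcases hv with rfl | rfl | rfl | rfl | rfl | rfl | rfl
  · rcases (h.at_c y).mp hy with rfl | rfl | rfl | rfl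
    · simp
    · exact absurd rfl (hne _ (by simp [twinCore]))
    · simp
    · exact absurd rfl (hne _ (by simp [twinCore]))
  · rcases (h.at_b y).mp hy with rfl | rfl | rfl | rfl
    · exact absurd rfl (hne _ (by simp [twinCore]))
    · simp
    · simp
    · simp
  · rcases (h.at_d y).mp hy with rfl | rfl | rfl | rfl
    · exact absurd rfl (hne _ (by simp [twinCore]))
    · exact absurd rfl (hne _ (by simp [twinCore]))
    · simp
    · simp
  · rcases (h.at_p y).mp hy with rfl | rfl | rfl | rfl
    · exact absurd rfl (hne _ (by simp [twinCore]))
    · simp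
    · simp
    · simp
  · rcases (h.at_q y).mp hy with rfl | rfl | rfl | rfl
    · exact absurd rfl (hne _ (by simp [twinCore]))
    · exact absurd rfl (hne _ (by simp [twinCore]))
    · simp
    · simp
  · rcases (h.at_a y).mp hy with rfl | rfl | rfl | rfl
    · exact absurd rfl (hne _ (by simp [twinCore]))
    · exact absurd rfl (hne _ (by simp [twinCore]))
    · exact absurd rfl (hne _ (by simp [twinCore]))
    · simp
  · rcases (h.at_f y).mp hy with rfl | rfl | rfl | rfl
    · exact absurd rfl (hne _ (by simp [twinCore]))
    · exact absurd rfl (hne _ (by simp [twinCore]))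
    · exact absurd rfl (hne _ (by simp [twinCore]))
    · simp

lemma conflicting_card_le_of_nbrsAre (hdeg : ∀ v, (nbrs G v).card ≤ 4) {S : Finset (Sym2 V)}
    (hS : ∀ e ∈ S, e ∈ G.edgeSet) {u v x y z : V} (hN : NbrsAre G u v x y z) (huv : s(u, v) ∉ S)
    (hx : degIn G S x ≤ 1) (hy : degIn G S y ≤ 2) : (conflicting G S s(u, v)).card ≤ 19 := by
  have hadj : G.Adj u v := (hN v).mpr (by simp)
  have h0 := conflicting_card_le hS hadj huv
  have h1 := sum_erase_le (degIn G S) fun x hx => (hN x).mp hx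
  have h2 := sum_degIn_erase_le hdeg S hadj.symm
  have h3 := (degIn_le_card_nbrs (G := G) S z).trans (hdeg z)
  omega

/-- Pendant edges of the two squares see at most 19 edges. -/
lemma TwinSquares.conflicting_pendant_le (hdeg : ∀ v, (nbrs G v).card ≤ 4)
    (h : TwinSquares G a b c d f p q a' f' b1 b2 d1 d2 p1 p2 q1 q2) {S : Finset (Sym2 V)}
    (hS : S ⊆ twinRest G a b c d f p q) {e : Sym2 V} (heS : e ∉ S)
    (he : e ∈ ({s(b, b1), s(b, b2), s(d, d1), s(d, d2), s(p, p1), s(p, p2), s(q, q1), s(q, q2)} :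
        Finset (Sym2 V))) : (conflicting G S e).card ≤ 19 := by
  have hSG : ∀ e ∈ S, e ∈ G.edgeSet := fun e he => twinRest_subset_edgeSet e (hS he)
  obtain ⟨ha, hf, -, -, -, -, hc⟩ := h.degIn_le hS
  have key : ∀ {u v x y z : V}, NbrsAre G u x y v z → degIn G S x ≤ 1 → degIn G S y ≤ 2 →
      s(u, v) ∉ S → (conflicting G S s(u, v)).card ≤ 19 := by
    intro u v x y z hN hx hy huv
    exact conflicting_card_le_of_nbrsAre hdeg hSG hN.third huv hx hy
  have key' : ∀ {u v x y z : V}, NbrsAre G u x y z v → degIn G S x ≤ 1 → degIn G S y ≤ 2 →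
      s(u, v) ∉ S → (conflicting G S s(u, v)).card ≤ 19 := by
    intro u v x y z hN hx hy huv
    exact conflicting_card_le_of_nbrsAre hdeg hSG hN.fourth huv hx hy
  simp only [Finset.mem_insert, Finset.mem_singleton] at he
  rcases he with rfl | rfl | rfl | rfl | rfl | rfl | rfl | rfl
  · exact key h.at_b ha hc heS
  · exact key' h.at_b ha hc heS
  · exact key h.at_d ha hc heS
  · exact key' h.at_d ha hc heS
  · exact key h.at_p hf hc heS
  · exact key' h.at_p hf hc heS
  · exact key h.at_q hf hc heS
  · exact key' h.at_q hf hc heS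

/-- All edges outside the core except `s(d, d1)` can be colored with two repeated colors. -/
lemma TwinSquares.exists_rest (hdeg : ∀ v, (nbrs G v).card ≤ 4) (hconn : G.Connected)
    (h : TwinSquares G a b c d f p q a' f' b1 b2 d1 d2 p1 p2 q1 q2)
    (htf : ∀ a b c, G.Adj a b → G.Adj b c → ¬ G.Adj a c) (hbf' : ¬ G.Adj b f')
    (hpa' : ¬ G.Adj p a') :
    ∃ C, ProperOn G ((twinRest G a b c d f p q).erase s(d, d1)) C ∧ C s(c, b) = C s(f, f') ∧
      C s(c, p) = C s(a, a') ∧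
      2 ≤ (avail G ((twinRest G a b c d f p q).erase s(d, d1)) C s(d, d1)).card := by
  obtain ⟨C, hC, h1, h2⟩ := h.exists_repeat hdeg hconn htf hbf' hpa'
  obtain ⟨m1, m2, m3, m4⟩ := h.repeated_mem_twinRest htf
  set R := twinRest G a b c d f p q with hR
  set S := edgesAvoid G {c, b, d, p, q, a, f} ∪ {s(c, b), s(f, f')} ∪ {s(c, p), s(a, a')} with hS
  have hSR : S ⊆ R := by
    intro e he
    simp only [hS, Finset.mem_union, Finset.mem_insert, Finset.mem_singleton] at he
    rcases he with (he | rfl | rfl) | rfl | rfl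
    · rw [hR, twinRest, Finset.mem_sdiff]
      have he' := mem_edgesAvoid.mp he
      refine ⟨mem_edgesAvoid.mpr ⟨he'.1, by simp⟩, fun hcore => ?_⟩
      have h3 : c ∉ e := fun hc => he'.2 c hc (by simp)
      have h4 : a ∉ e := fun hc => he'.2 a hc (by simp)
      have h5 : f ∉ e := fun hc => he'.2 f hc (by simp)
      simp only [twinCore, Finset.mem_union, Finset.mem_insert, Finset.mem_singleton] at hcore
      rcases hcore with (rfl | rfl | rfl) | rfl | rfl | rfl | rfl <;> simp at h3 h4 h5
    · exact m1
    · exact m2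
    · exact m3
    · exact m4
  obtain ⟨C', hC', hagree⟩ := hC.greedy (R.erase s(d, d1)) (by
    intro e he S' hSS' hS' heS'
    obtain ⟨-, heR⟩ := Finset.mem_erase.mp he
    have hS'R : S' ⊆ R := hS'.trans (Finset.union_subset hSR (Finset.erase_subset _ _))
    rcases h.edge_cases heR with he' | he'
    · exact absurd (hSS' he') heS'
    · exact (h.conflicting_pendant_le hdeg hS'R heS' he').trans (by omega))
  refine ⟨C', hC'.mono Finset.subset_union_right, ?_, ?_, ?_⟩
  · rw [hagree _ (by simp [hS]), hagree _ (by simp [hS]), h1]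
  · rw [hagree _ (by simp [hS]), hagree _ (by simp [hS]), h2]
  · refine le_card_avail ?_
    have := h.conflicting_pendant_le hdeg (Finset.erase_subset s(d, d1) R)
      (Finset.notMem_erase _ _) (by simp)
    omega

end TwinSquaresExtend

section TwinSquaresLists

open scoped Classical

variable {V : Type*} [Fintype V] {G : SimpleGraph V}
  {a b c d f p q a' f' b1 b2 d1 d2 p1 p2 q1 q2 : V}

/-- List sizes after erasing the two repeated edges `s(a, a')` and `s(f, f')`. -/
lemma TwinSquares.le_card_avail_erase_outer (hdeg : ∀ v, (nbrs G v).card ≤ 4)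
    (h : TwinSquares G a b c d f p q a' f' b1 b2 d1 d2 p1 p2 q1 q2)
    {S : Finset (Sym2 V)} {C : Sym2 V → Fin 21} (hS : S ⊆ twinRest G a b c d f p q) {k : ℕ}
    (hk : degIn G S d + k ≤ 8) :
    let S' := (S.erase s(a, a')).erase s(f, f')
    5 ≤ (avail G S' C s(c, d)).card ∧ 5 ≤ (avail G S' C s(c, q)).card ∧
      5 ≤ (avail G S' C s(a, f)).card ∧ k ≤ (avail G S' C s(a, b)).card ∧
      6 ≤ (avail G S' C s(f, p)).card := by
  intro S'
  obtain ⟨hab, had, haf, haa', hfp, hfq, hff', hcb, hcd, hcp, hcq⟩ := h.adjs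
  have hS'S : S' ⊆ S := (Finset.erase_subset _ _).trans (Finset.erase_subset _ _)
  have hS' := hS'S.trans hS
  have hSG : ∀ e ∈ S', e ∈ G.edgeSet := fun e he => twinRest_subset_edgeSet e (hS' he)
  have hout := fun {e} => notMem_of_subset_twinRest (e := e) hS'
  obtain ⟨-, -, hb, hd, hp, hq, hc⟩ := h.degIn_le hS'
  have hd' := degIn_mono (G := G) hS'S d
  have naa : s(a, a') ∉ S' := by simp [S']
  have nff : s(f, f') ∉ S' := by simp [S']
  have ha0 : degIn G S' a = 0 := degIn_eq_zero_of_notMem h.at_a (hout (by simp [twinCore]))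
    (hout (by simp [twinCore])) (hout (by simp [twinCore])) naa
  have hf0 : degIn G S' f = 0 := degIn_eq_zero_of_notMem h.at_f (hout (by simp [twinCore]))
    (hout (by simp [twinCore])) (hout (by simp [twinCore])) nff
  have ha' : degIn G S' a' ≤ 3 := degIn_le_three_of_adj hdeg haa'.symm (by rwa [Sym2.eq_swap])
  have hf' : degIn G S' f' ≤ 3 := degIn_le_three_of_adj hdeg hff'.symm (by rwa [Sym2.eq_swap])
  have h4 : ∀ w, degIn G S' w ≤ 4 := fun w => (degIn_le_card_nbrs S' w).trans (hdeg w)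
  have := h4 b1
  have := h4 b2
  have := h4 d1
  have := h4 d2
  have := h4 p1
  have := h4 p2
  have := h4 q1
  have := h4 q2
  refine ⟨?_, ?_, ?_, ?_, ?_⟩
  · exact le_card_avail_of_nbrsAre hSG h.at_c.second h.at_d.second (hout (by simp [twinCore]))
      (by omega)
  · exact le_card_avail_of_nbrsAre hSG h.at_c.fourth h.at_q.second (hout (by simp [twinCore]))
      (by omega)
  · exact le_card_avail_of_nbrsAre hSG h.at_a.third h.at_f.third (hout (by simp [twinCore]))
      (by omega)
  · exact le_card_avail_of_nbrsAre hSG h.at_a h.at_b (hout (by simp [twinCore])) (by omega)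
  · exact le_card_avail_of_nbrsAre hSG h.at_f h.at_p (hout (by simp [twinCore])) (by omega)

/-- List size at `s(a, d)` after erasing the repeated edges `s(c, b)` and `s(a, a')`. -/
lemma TwinSquares.six_le_card_avail_erase_left (hdeg : ∀ v, (nbrs G v).card ≤ 4)
    (h : TwinSquares G a b c d f p q a' f' b1 b2 d1 d2 p1 p2 q1 q2)
    {S : Finset (Sym2 V)} {C : Sym2 V → Fin 21} (hS : S ⊆ twinRest G a b c d f p q) :
    6 ≤ (avail G ((S.erase s(c, b)).erase s(a, a')) C s(a, d)).card := by
  set S' := (S.erase s(c, b)).erase s(a, a') with hS'def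
  obtain ⟨hab, had, haf, haa', hfp, hfq, hff', hcb, hcd, hcp, hcq⟩ := h.adjs
  have hS'S : S' ⊆ S := (Finset.erase_subset _ _).trans (Finset.erase_subset _ _)
  have hS' := hS'S.trans hS
  have hSG : ∀ e ∈ S', e ∈ G.edgeSet := fun e he => twinRest_subset_edgeSet e (hS' he)
  have hout := fun {e} => notMem_of_subset_twinRest (e := e) hS'
  obtain ⟨-, hf1, -, -, -, -, -⟩ := h.degIn_le hS'
  have ncb : s(c, b) ∉ S' := by simp [S']
  have naa : s(a, a') ∉ S' := by simp [S']
  have hb : degIn G S' b ≤ 2 := degIn_le_two_of_notMem h.at_b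
    (hout (by simp [twinCore])) (by rwa [Sym2.eq_swap])
  have hc : degIn G S' c ≤ 1 := degIn_le_one_of_notMem (q := d) (r := q) (t := p)
    (fun z => by rw [h.at_c z]; tauto) ncb (hout (by simp [twinCore])) (hout (by simp [twinCore]))
  have ha' : degIn G S' a' ≤ 3 := degIn_le_three_of_adj hdeg haa'.symm (by rwa [Sym2.eq_swap])
  have := (degIn_le_card_nbrs S' d1).trans (hdeg d1)
  have := (degIn_le_card_nbrs S' d2).trans (hdeg d2)
  exact le_card_avail_of_nbrsAre hSG h.at_a.second h.at_d (hout (by simp [twinCore])) (by omega)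

/-- List size at `s(f, q)` after erasing the repeated edges `s(c, p)` and `s(f, f')`. -/
lemma TwinSquares.six_le_card_avail_erase_right (hdeg : ∀ v, (nbrs G v).card ≤ 4)
    (h : TwinSquares G a b c d f p q a' f' b1 b2 d1 d2 p1 p2 q1 q2)
    {S : Finset (Sym2 V)} {C : Sym2 V → Fin 21} (hS : S ⊆ twinRest G a b c d f p q) :
    6 ≤ (avail G ((S.erase s(c, p)).erase s(f, f')) C s(f, q)).card := by
  set S' := (S.erase s(c, p)).erase s(f, f') with hS'def
  obtain ⟨hab, had, haf, haa', hfp, hfq, hff', hcb, hcd, hcp, hcq⟩ := h.adjs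
  have hS'S : S' ⊆ S := (Finset.erase_subset _ _).trans (Finset.erase_subset _ _)
  have hS' := hS'S.trans hS
  have hSG : ∀ e ∈ S', e ∈ G.edgeSet := fun e he => twinRest_subset_edgeSet e (hS' he)
  have hout := fun {e} => notMem_of_subset_twinRest (e := e) hS'
  obtain ⟨ha1, -, -, -, -, -, -⟩ := h.degIn_le hS'
  have ncp : s(c, p) ∉ S' := by simp [S']
  have nff : s(f, f') ∉ S' := by simp [S']
  have hp : degIn G S' p ≤ 2 := degIn_le_two_of_notMem h.at_p
    (hout (by simp [twinCore])) (by rwa [Sym2.eq_swap])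
  have hc : degIn G S' c ≤ 1 := degIn_le_one_of_notMem (q := d) (r := q) (t := b)
    (fun z => by rw [h.at_c z]; tauto) ncp (hout (by simp [twinCore])) (hout (by simp [twinCore]))
  have hf' : degIn G S' f' ≤ 3 := degIn_le_three_of_adj hdeg hff'.symm (by rwa [Sym2.eq_swap])
  have := (degIn_le_card_nbrs S' q1).trans (hdeg q1)
  have := (degIn_le_card_nbrs S' q2).trans (hdeg q2)
  exact le_card_avail_of_nbrsAre hSG h.at_f.second h.at_q (hout (by simp [twinCore])) (by omega)

/-- List sizes of the core edges when four earlier edges use only two colors. -/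
lemma TwinSquares.le_card_avail (hdeg : ∀ v, (nbrs G v).card ≤ 4)
    (h : TwinSquares G a b c d f p q a' f' b1 b2 d1 d2 p1 p2 q1 q2)
    (htf : ∀ a b c, G.Adj a b → G.Adj b c → ¬ G.Adj a c)
    {S : Finset (Sym2 V)} {C : Sym2 V → Fin 21} (hS : S ⊆ twinRest G a b c d f p q)
    (hcbS : s(c, b) ∈ S) (hffS : s(f, f') ∈ S) (hcpS : s(c, p) ∈ S) (haaS : s(a, a') ∈ S)
    (hC₁ : C s(c, b) = C s(f, f')) (hC₂ : C s(c, p) = C s(a, a')) {k : ℕ}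
    (hk : degIn G S d + k ≤ 8) :
    (5 ≤ (avail G S C s(c, d)).card ∧ 5 ≤ (avail G S C s(c, q)).card ∧
      5 ≤ (avail G S C s(a, f)).card) ∧ k ≤ (avail G S C s(a, b)).card ∧
      6 ≤ (avail G S C s(a, d)).card ∧ 6 ≤ (avail G S C s(f, p)).card ∧
      6 ≤ (avail G S C s(f, q)).card := by
  obtain ⟨hab, had, haf, haa', hfp, hfq, hff', hcb, hcd, hcp, hcq⟩ := h.adjs
  obtain ⟨ne1, ne2, ne3, ne4, ne5, ne6⟩ := h.pair_ne htf
  obtain ⟨k1, k2, k3, k4, k5⟩ := h.le_card_avail_erase_outer (C := C) hdeg hS hk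
  have k6 := h.six_le_card_avail_erase_left (C := C) hdeg hS
  have k7 := h.six_le_card_avail_erase_right (C := C) hdeg hS
  have outer : ∀ {e}, StrongConflict G e s(c, p) → StrongConflict G e s(c, b) →
      avail G ((S.erase s(a, a')).erase s(f, f')) C e ⊆ avail G S C e := fun h1 h2 =>
    avail_erase_erase_subset (by simp [hcpS, ne6, ne4.symm]) (by simp [hcbS, ne1, ne3]) hC₂ hC₁
      h1 h2
  have hadj : ∀ {u v x y : V}, G.Adj u x → StrongConflict G s(u, v) s(x, y) :=
    fun hux => Or.inr ⟨_, _, by simp, by simp, hux⟩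
  have hadj' : ∀ {u v x y : V}, G.Adj v y → StrongConflict G s(u, v) s(x, y) :=
    fun hux => Or.inr ⟨_, _, by simp, by simp, hux⟩
  have hadjl : ∀ {u v x y : V}, G.Adj v x → StrongConflict G s(u, v) s(x, y) :=
    fun hux => Or.inr ⟨_, _, by simp, by simp, hux⟩
  have hadjr : ∀ {u v x y : V}, G.Adj u y → StrongConflict G s(u, v) s(x, y) :=
    fun hux => Or.inr ⟨_, _, by simp, by simp, hux⟩
  have hcom : ∀ {u v w : V}, StrongConflict G s(u, v) s(u, w) :=
    fun {u _ _} => Or.inl ⟨u, by simp, by simp⟩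
  refine ⟨⟨k1.trans (Finset.card_le_card (outer hcom hcom)),
    k2.trans (Finset.card_le_card (outer hcom hcom)),
    k3.trans (Finset.card_le_card (outer (hadj' hfp) (hadjr hab)))⟩,
    k4.trans (Finset.card_le_card (outer (hadjl hcb.symm) (hadjr hab))),
    k6.trans (Finset.card_le_card ?_),
    k5.trans (Finset.card_le_card (outer (hadjr hfp) (hadjl hcp.symm))),
    k7.trans (Finset.card_le_card ?_)⟩
  · exact avail_erase_erase_subset (by simp [hffS, ne1.symm, ne5]) (by simp [hcpS, ne2.symm, ne6])
      hC₁.symm hC₂ (hadj haf) (hadjl hcd.symm)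
  · exact avail_erase_erase_subset (by simp [haaS, ne6.symm, ne5.symm]) (by simp [hcbS, ne2, ne1])
      hC₂.symm hC₁ (hadj haf.symm) (hadjl hcq.symm)

end TwinSquaresLists

section TwinSquaresMain

open scoped Classical

variable {V : Type*} [Fintype V] {G : SimpleGraph V}
  {a b c d f p q a' f' b1 b2 d1 d2 p1 p2 q1 q2 : V}

lemma mem_twinRest_or_mem_twinCore (u v : V)
    (huv : G.Adj u v) :
    s(u, v) ∈ twinRest G a b c d f p q ∨ s(u, v) ∈ twinCore a b c d f p q := by
  by_cases h : s(u, v) ∈ twinCore a b c d f p q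
  · exact Or.inr h
  · exact Or.inl (mem_twinRest.mpr ⟨huv, h⟩)

/-- Among two colors for an edge near `e` only, one keeps the lists at `e` and `g` spread out. -/
lemma exists_erase_union {A B : Finset (Fin 21)} (hA : 7 ≤ A.card) (hB : 6 ≤ B.card)
    {x y : Fin 21} (hxy : x ≠ y) : 7 ≤ (A.erase x ∪ B).card ∨ 7 ≤ (A.erase y ∪ B).card := by
  by_contra! hcon
  have h1 := Finset.eq_of_subset_of_card_le (Finset.subset_union_right (s₁ := A.erase x) (s₂ := B))
    (by omega)
  have h2 := Finset.eq_of_subset_of_card_le (Finset.subset_union_right (s₁ := A.erase y) (s₂ := B))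
    (by omega)
  have h3 : A ⊆ B := by
    intro z hz
    by_cases hzx : z = x
    · exact h2.symm ▸ Finset.mem_union_left B (Finset.mem_erase.mpr ⟨hzx ▸ hxy, hz⟩)
    · exact h1.symm ▸ Finset.mem_union_left B (Finset.mem_erase.mpr ⟨hzx, hz⟩)
  have h4 := Finset.card_le_card h3
  have h5 := congrArg Finset.card h1
  omega

lemma TwinSquares.strongColorable (hdeg : ∀ v, (nbrs G v).card ≤ 4) (hconn : G.Connected)
    (h : TwinSquares G a b c d f p q a' f' b1 b2 d1 d2 p1 p2 q1 q2)
    (htf : ∀ a b c, G.Adj a b → G.Adj b c → ¬ G.Adj a c) (hbf' : ¬ G.Adj b f')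
    (hpa' : ¬ G.Adj p a') (hd1a : d1 ≠ a) (hd1c : d1 ≠ c) (hfd1 : ¬ G.Adj f d1) {s : V}
    (hs : s = p ∨ s = q)
    (hsd1 : ¬ G.Adj d1 s) : StrongColorable G := by
  obtain ⟨C, hC, hC1, hC2, hz⟩ := h.exists_rest hdeg hconn htf hbf' hpa'
  obtain ⟨hab, had, haf, haa', hfp, hfq, hff', hcb, hcd, hcp, hcq⟩ := h.adjs
  obtain ⟨ncf, nfb, nfd, nca, nap, naq, ndp, ndq⟩ := h.nonadjs htf
  obtain ⟨m1, m2, m3, m4⟩ := h.repeated_mem_twinRest htf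
  set R := twinRest G a b c d f p q with hR
  set z := s(d, d1) with hzdef
  have hdd1 : G.Adj d d1 := (h.at_d d1).mpr (by simp)
  have hfd : f ≠ d := by rintro rfl; exact ncf hcd
  have hfd1' : f ≠ d1 := by rintro rfl; exact nfd hdd1.symm
  have hfs : G.Adj f s := by rcases hs with rfl | rfl <;> assumption
  have hds : ¬ G.Adj d s := by rcases hs with rfl | rfl <;> assumption
  have z1 : s(c, b) ≠ z := fun e => by
    rcases (Sym2.eq_iff.mp e) with ⟨e1, -⟩ | ⟨-, e1⟩
    · exact hcd.ne e1
    · exact h.hbd e1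
  have z2 : s(f, f') ≠ z := fun e => by
    rcases (Sym2.eq_iff.mp e) with ⟨e1, -⟩ | ⟨e1, -⟩
    · exact hfd e1
    · exact hfd1' e1
  have z3 : s(c, p) ≠ z := fun e => by
    rcases (Sym2.eq_iff.mp e) with ⟨e1, -⟩ | ⟨-, e1⟩
    · exact hcd.ne e1
    · exact h.hdp e1.symm
  have z4 : s(a, a') ≠ z := fun e => by
    rcases (Sym2.eq_iff.mp e) with ⟨e1, -⟩ | ⟨-, e1⟩
    · exact had.ne e1
    · exact h.had' e1
  have hRG := twinRest_subset_edgeSet (G := G) (a := a) (b := b) (c := c) (d := d) (f := f)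
    (p := p) (q := q)
  have hzR : z ∈ R := by
    refine mem_twinRest.mpr ⟨hdd1, ?_⟩
    have e1 := hcd.ne
    have e2 := had.ne
    have e3 := h.hbd
    have e4 := h.hdp
    have e5 := h.hdq
    have e6 := hdd1.ne
    simp only [twinCore, Finset.mem_union, Finset.mem_insert, Finset.mem_singleton, Sym2.eq_iff]
    grind
  have hd1 : degIn G (R.erase z) d ≤ 1 := by
    have hout := fun {e} => notMem_of_subset_twinRest (e := e)
      ((Finset.erase_subset z R).trans (Finset.Subset.refl R))
    exact degIn_le_one_of_notMem h.at_d (hout (by simp [twinCore])) (hout (by simp [twinCore]))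
      (Finset.notMem_erase _ _)
  obtain ⟨-, l1, -, l2, l3⟩ := h.le_card_avail (C := C) hdeg htf (Finset.erase_subset z R)
    (by simp [m1, z1]) (by simp [m2, z2]) (by simp [m3, z3]) (by simp [m4, z4]) hC1 hC2
    (k := 7) (by omega)
  have hW : 6 ≤ (avail G (R.erase z) C s(f, s)).card := by
    rcases hs with rfl | rfl <;> assumption
  have hzs : ¬ StrongConflict G s(f, s) z := fun hc =>
    not_strongConflict hfd.symm (fun e => nfd e.symm) hdd1 hfs hfd1 hds hsd1 hc.symm
  obtain ⟨x, hx, y, hy, hxy⟩ := Finset.one_lt_card.mp (show 1 < _ from hz)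
  have main : ∀ x ∈ avail G (R.erase z) C z,
      7 ≤ ((avail G (R.erase z) C s(a, b)).erase x ∪ avail G (R.erase z) C s(f, s)).card →
      StrongColorable G := by
    intro x hx hcard
    obtain ⟨C', hC', hagree, hCz⟩ := hC.extend (F := {z}) (c := fun _ => x) (by simp)
      (by simpa using hx) (by
        intro e he g hg hne
        simp only [Finset.mem_singleton] at he hg
        exact absurd (he.trans hg.symm) hne)
    have hCz := hCz z (by simp)
    have hun : R.erase z ∪ {z} = R := by
      rw [Finset.union_comm, ← Finset.insert_eq, Finset.insert_erase hzR]
    rw [hun] at hC'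
    have hd2 : degIn G R d ≤ 2 := (h.degIn_le (Finset.Subset.refl R)).2.2.2.1
    obtain ⟨⟨k1, k2, k3⟩, k4, k5, k6, k7⟩ := h.le_card_avail (C := C') hdeg htf
      (Finset.Subset.refl R) m1 m2 m3 m4
      (by rw [hagree _ (by simp [m1, z1]), hagree _ (by simp [m2, z2]), hC1])
      (by rw [hagree _ (by simp [m3, z3]), hagree _ (by simp [m4, z4]), hC2]) (k := 6) (by omega)
    refine hC'.strongColorable_of_hall (twinCore a b c d f p q)
      mem_twinRest_or_mem_twinCore fun T hT => ?_
    refine card_le_card_biUnion_of_three_four {s(c, d), s(c, q), s(a, f)}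
      {s(a, b), s(a, d), s(f, p), s(f, q)} (avail G R C') Finset.card_le_three
      Finset.card_le_four (by simp [k1, k2, k3]) (by simp [k4, k5, k6, k7])
      (e := s(a, b)) (f := s(f, s)) (by simp) (by rcases hs with rfl | rfl <;> simp) ?_ T hT
    refine hcard.trans (Finset.card_le_card (Finset.union_subset_union ?_ ?_))
    · have := avail_erase_color_subset (G := G) (e := s(a, b)) hagree
      rwa [hCz] at this
    · exact avail_subset_of_forall_not hagree hzs
  rcases exists_erase_union l1 hW hxy with h7 | h7
  · exact main x hx h7
  · exact main y hy h7

end TwinSquaresMain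

section TwinSquaresExistence

open scoped Classical

variable {V : Type*} [Fintype V] {G : SimpleGraph V} {a b c d f p q a' f' : V}

lemma strongColorable_of_twinSquares_of_nonadj (hreg : ∀ v, (nbrs G v).card = 4)
    (hconn : G.Connected) (htf : ∀ a b c, G.Adj a b → G.Adj b c → ¬ G.Adj a c)
    (hK : ∀ x y b d e, x ≠ y → b ≠ d → b ≠ e → d ≠ e → G.Adj x b → G.Adj x d → G.Adj x e →
      G.Adj y b → G.Adj y d → ¬ G.Adj y e)
    (ha : NbrsAre G a b d f a') (hf : NbrsAre G f p q a f') (hc : NbrsAre G c b d p q)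
    (hab' : a' ≠ b) (had' : a' ≠ d) (haf' : a' ≠ f) (hfp' : f' ≠ p) (hfq' : f' ≠ q)
    (hfa' : f' ≠ a) (hac : a ≠ c) (hfc : f ≠ c) (hbd : b ≠ d) (hbp : b ≠ p) (hbq : b ≠ q)
    (hdp : d ≠ p) (hdq : d ≠ q) (hpq : p ≠ q) (hbf' : ¬ G.Adj b f') (hpa' : ¬ G.Adj p a') :
    StrongColorable G := by
  have hab : G.Adj a b := (ha b).mpr (by simp)
  have had : G.Adj a d := (ha d).mpr (by simp)
  have haf : G.Adj a f := (ha f).mpr (by simp)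
  have hfp : G.Adj f p := (hf p).mpr (by simp)
  have hfq : G.Adj f q := (hf q).mpr (by simp)
  have hcb : G.Adj c b := (hc b).mpr (by simp)
  have hcd : G.Adj c d := (hc d).mpr (by simp)
  have hcp : G.Adj c p := (hc p).mpr (by simp)
  have hcq : G.Adj c q := (hc q).mpr (by simp)
  obtain ⟨b1, b2, hb, -⟩ := exists_nbrsAre_of_two (hreg b) hab.symm hcb.symm hac
  obtain ⟨p1, p2, hp, -⟩ := exists_nbrsAre_of_two (hreg p) hfp.symm hcp.symm hfc
  obtain ⟨q1, q2, hq, -⟩ := exists_nbrsAre_of_two (hreg q) hfq.symm hcq.symm hfc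
  obtain ⟨d1, d2, hd, h1, h2, h3, h4, h5⟩ :=
    exists_nbrsAre_of_two (hreg d) had.symm hcd.symm hac
  have key : ∀ e1 e2, NbrsAre G d a c e1 e2 → e1 ≠ a → e1 ≠ c → e1 ≠ f' → StrongColorable G := by
    intro e1 e2 hde h1 h2 h3
    have hde1 : G.Adj d e1 := (hde e1).mpr (by simp)
    have hdf : ¬ G.Adj d f := htf _ _ _ had.symm haf
    have hdp' : ¬ G.Adj d p := htf _ _ _ hcd.symm hcp
    have hdq' : ¬ G.Adj d q := htf _ _ _ hcd.symm hcq
    have hfe1 : ¬ G.Adj f e1 := by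
      rw [hf]
      rintro (rfl | rfl | rfl | rfl)
      · exact hdp' hde1
      · exact hdq' hde1
      · exact h1 rfl
      · exact h3 rfl
    have hs : ∃ s, (s = p ∨ s = q) ∧ ¬ G.Adj e1 s := by
      by_contra! hcon
      have h4 := hcon p (Or.inl rfl)
      have h5 := hcon q (Or.inr rfl)
      have h6 : e1 ≠ f := by rintro rfl; exact hdf hde1
      exact hK p q e1 f c hpq h6 h2 hfc h4.symm hfp.symm hcp.symm h5.symm hfq.symm hcq.symm
    obtain ⟨s, hs, hse⟩ := hs
    have htw : TwinSquares G a b c d f p q a' f' b1 b2 e1 e2 p1 p2 q1 q2 :=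
      ⟨ha, hf, hc, hb, hde, hp, hq, hab', had', haf', hfp', hfq', hfa', hac, hfc, hbd, hbp, hbq,
        hdp, hdq, hpq⟩
    exact htw.strongColorable (fun v => (hreg v).le) hconn htf hbf' hpa' h1 h2 hfe1 hs hse
  by_cases h6 : d1 = f'
  · exact key d2 d1 (fun z => by rw [hd z]; tauto) h3 h4 (fun h => h5 (h6.trans h.symm))
  · exact key d1 d2 hd h1 h2 h6

/-- Two 4-cycles through `c` covering its neighbourhood, with adjacent opposite vertices. -/
lemma strongColorable_of_twinSquares (hreg : ∀ v, (nbrs G v).card = 4)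
    (hconn : G.Connected) (htf : ∀ a b c, G.Adj a b → G.Adj b c → ¬ G.Adj a c)
    (hK : ∀ x y b d e, x ≠ y → b ≠ d → b ≠ e → d ≠ e → G.Adj x b → G.Adj x d → G.Adj x e →
      G.Adj y b → G.Adj y d → ¬ G.Adj y e) (hc : NbrsAre G c b d p q)
    (hbd : b ≠ d) (hbp : b ≠ p) (hbq : b ≠ q) (hdp : d ≠ p) (hdq : d ≠ q) (hpq : p ≠ q)
    (hac : a ≠ c) (hfc : f ≠ c) (hab : G.Adj a b) (had : G.Adj a d) (haf : G.Adj a f)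
    (hfp : G.Adj f p) (hfq : G.Adj f q) : StrongColorable G := by
  have hcb : G.Adj c b := (hc b).mpr (by simp)
  have hcd : G.Adj c d := (hc d).mpr (by simp)
  have hcp : G.Adj c p := (hc p).mpr (by simp)
  have hcq : G.Adj c q := (hc q).mpr (by simp)
  have hfb : ¬ G.Adj f b := htf _ _ _ haf.symm hab
  have hap : ¬ G.Adj a p := htf _ _ _ haf hfp
  have hca : ¬ G.Adj c a := htf _ _ _ hcb hab.symm
  have hcf : ¬ G.Adj c f := htf _ _ _ hcp hfp.symm
  have hbf : b ≠ f := by rintro rfl; exact hcf hcb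
  have hdf : d ≠ f := by rintro rfl; exact hcf hcd
  have hpa : p ≠ a := by rintro rfl; exact hca hcp
  have hqa : q ≠ a := by rintro rfl; exact hca hcq
  obtain ⟨a', ha, ha1, ha2, ha3⟩ := exists_nbrsAre_of_three (hreg a) hab had haf hbd hbf hdf
  obtain ⟨f', hf, hf1, hf2, hf3⟩ := exists_nbrsAre_of_three (hreg f) hfp hfq haf.symm hpq hpa hqa
  have haa' : G.Adj a a' := (ha a').mpr (by simp)
  have hff' : G.Adj f f' := (hf f').mpr (by simp)
  have hf'c : f' ≠ c := by rintro rfl; exact hcf hff'.symm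
  have ha'c : a' ≠ c := by rintro rfl; exact hca haa'.symm
  have hB : ¬ G.Adj b f' ∨ ¬ G.Adj d f' := by
    by_contra! hcon
    exact hK b d a c f' hbd hac hf3.symm hf'c.symm hab.symm hcb.symm hcon.1 had.symm hcd.symm hcon.2
  have hP : ¬ G.Adj p a' ∨ ¬ G.Adj q a' := by
    by_contra! hcon
    exact hK p q f c a' hpq hfc ha3.symm ha'c.symm hfp.symm hcp.symm hcon.1 hfq.symm hcq.symm hcon.2
  rcases hB with hB | hB <;> rcases hP with hP | hP
  · exact strongColorable_of_twinSquares_of_nonadj hreg hconn htf hK ha hf hc ha1 ha2 ha3 hf1 hf2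
      hf3 hac hfc hbd hbp hbq hdp hdq hpq hB hP
  · exact strongColorable_of_twinSquares_of_nonadj hreg hconn htf hK ha hf.second
      (fun z => by rw [hc z]; tauto) ha1 ha2 ha3 hf2 hf1 hf3 hac hfc hbd hbq hbp hdq hdp hpq.symm
      hB hP
  · exact strongColorable_of_twinSquares_of_nonadj hreg hconn htf hK ha.second hf hc.second ha2
      ha1 ha3 hf1 hf2 hf3 hac hfc hbd.symm hdp hdq hbp hbq hpq hB hP
  · exact strongColorable_of_twinSquares_of_nonadj hreg hconn htf hK ha.second hf.second
      (fun z => by rw [hc z]; tauto) ha2 ha1 ha3 hf2 hf1 hf3 hac hfc hbd.symm hdq hdp hbq hbp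
      hpq.symm hB hP

/-- A 4-cycle in a graph without three common neighbours. -/
lemma strongColorable_of_square (hreg : ∀ v, (nbrs G v).card = 4)
    (hconn : G.Connected) (htf : ∀ a b c, G.Adj a b → G.Adj b c → ¬ G.Adj a c)
    (hK : ∀ x y b d e, x ≠ y → b ≠ d → b ≠ e → d ≠ e → G.Adj x b → G.Adj x d → G.Adj x e →
      G.Adj y b → G.Adj y d → ¬ G.Adj y e) (hac : a ≠ c) (hbd : b ≠ d)
    (hab : G.Adj a b) (had : G.Adj a d) (hcb : G.Adj c b) (hcd : G.Adj c d) :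
    StrongColorable G := by
  have hnac : ¬ G.Adj a c := htf _ _ _ hab hcb.symm
  have hnbd : ¬ G.Adj b d := htf _ _ _ hab.symm had
  obtain ⟨a1, a2, ha, a1b, a1d, a2b, a2d, a12⟩ := exists_nbrsAre_of_two (hreg a) hab had hbd
  obtain ⟨c1, c2, hc, c1b, c1d, c2b, c2d, c12⟩ := exists_nbrsAre_of_two (hreg c) hcb hcd hbd
  obtain ⟨b1, b2, hb, b1a, b1c, b2a, b2c, b12⟩ :=
    exists_nbrsAre_of_two (hreg b) hab.symm hcb.symm hac
  obtain ⟨d1, d2, hd, d1a, d1c, d2a, d2c, d12⟩ :=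
    exists_nbrsAre_of_two (hreg d) had.symm hcd.symm hac
  have haa1 : G.Adj a a1 := (ha a1).mpr (by simp)
  have haa2 : G.Adj a a2 := (ha a2).mpr (by simp)
  have hcc1 : G.Adj c c1 := (hc c1).mpr (by simp)
  have hcc2 : G.Adj c c2 := (hc c2).mpr (by simp)
  have hbb1 : G.Adj b b1 := (hb b1).mpr (by simp)
  have hbb2 : G.Adj b b2 := (hb b2).mpr (by simp)
  have hdd1 : G.Adj d d1 := (hd d1).mpr (by simp)
  have hdd2 : G.Adj d d2 := (hd d2).mpr (by simp)
  have hncA : ∀ x, G.Adj a x → x ≠ b → x ≠ d → ¬ G.Adj c x := fun x hx h1 h2 =>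
    hK a c b d x hac hbd h1.symm h2.symm hab had hx hcb hcd
  have hnaC : ∀ x, G.Adj c x → x ≠ b → x ≠ d → ¬ G.Adj a x := fun x hx h1 h2 =>
    hK c a b d x hac.symm hbd h1.symm h2.symm hcb hcd hx hab had
  have hndB : ∀ x, G.Adj b x → x ≠ a → x ≠ c → ¬ G.Adj d x := fun x hx h1 h2 =>
    hK b d a c x hbd hac h1.symm h2.symm hab.symm hcb.symm hx had.symm hcd.symm
  have hnbD : ∀ x, G.Adj d x → x ≠ a → x ≠ c → ¬ G.Adj b x := fun x hx h1 h2 =>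
    hK d b a c x hbd.symm hac h1.symm h2.symm had.symm hcd.symm hx hab.symm hcb.symm
  have hAC : ∀ x y, G.Adj a x → x ≠ b → x ≠ d → G.Adj c y → y ≠ b → y ≠ d → ¬ G.Adj x y →
      ¬ StrongConflict G s(a, x) s(c, y) := fun x y hx h1 h2 hy h3 h4 hxy =>
    not_strongConflict hac hnac hx hy (hncA x hx h1 h2) (hnaC y hy h3 h4) hxy
  have hBD : ∀ x y, G.Adj b x → x ≠ a → x ≠ c → G.Adj d y → y ≠ a → y ≠ c → ¬ G.Adj x y →
      ¬ StrongConflict G s(b, x) s(d, y) := fun x y hx h1 h2 hy h3 h4 hxy =>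
    not_strongConflict hbd hnbd hx hy (hndB x hx h1 h2) (hnbD y hy h3 h4) hxy
  have hthree : ∀ x1 x2 y1 y2 z1 z2 w1 w2, NbrsAre G a b d x1 x2 → NbrsAre G c b d y1 y2 →
      NbrsAre G b a c z1 z2 → NbrsAre G d a c w1 w2 → ¬ StrongConflict G s(a, x1) s(c, y1) →
      ¬ StrongConflict G s(a, x2) s(c, y2) → ¬ StrongConflict G s(b, z1) s(d, w1) →
      StrongColorable G := fun _ _ _ _ _ _ _ _ h1 h2 h3 h4 h5 h6 h7 =>
    strongColorable_of_three_pairs (fun v => (hreg v).le) hconn h1 h3 h2 h4 h5 h6 h7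
  have hb' : NbrsAre G b a c b2 b1 := fun z => by rw [hb z]; tauto
  have hpairs : ∀ x1 x2 y1 y2, NbrsAre G a b d x1 x2 → NbrsAre G c b d y1 y2 →
      ¬ StrongConflict G s(a, x1) s(c, y1) → ¬ StrongConflict G s(a, x2) s(c, y2) →
      StrongColorable G := by
    intro x1 x2 y1 y2 h1 h2 h3 h4
    have hd' : NbrsAre G d a c d2 d1 := fun z => by rw [hd z]; tauto
    by_cases h5 : G.Adj b1 d1
    · by_cases h6 : G.Adj b2 d1
      · by_cases h7 : G.Adj b1 d2
        · have hbd1 : b ≠ d1 := by rintro rfl; exact hnbd hdd1.symm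
          have hbd2 : b ≠ d2 := by rintro rfl; exact hnbd hdd2.symm
          have h8 := hK b1 b2 b d1 d2 b12 hbd1 hbd2 d12 hbb1.symm h5 h7 hbb2.symm h6
          exact hthree _ _ _ _ _ _ _ _ h1 h2 hb' hd' h3 h4
            (hBD _ _ hbb2 b2a b2c hdd2 d2a d2c h8)
        · exact hthree _ _ _ _ _ _ _ _ h1 h2 hb hd' h3 h4
            (hBD _ _ hbb1 b1a b1c hdd2 d2a d2c h7)
      · exact hthree _ _ _ _ _ _ _ _ h1 h2 hb' hd h3 h4 (hBD _ _ hbb2 b2a b2c hdd1 d1a d1c h6)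
    · exact hthree _ _ _ _ _ _ _ _ h1 h2 hb hd h3 h4 (hBD _ _ hbb1 b1a b1c hdd1 d1a d1c h5)
  have hc' : NbrsAre G c b d c2 c1 := fun z => by rw [hc z]; tauto
  have htwinA : ∀ x, G.Adj a x → G.Adj x c1 → G.Adj x c2 → StrongColorable G := by
    intro x hx h1 h2
    exact strongColorable_of_twinSquares hreg hconn htf hK hc hbd c1b.symm c2b.symm c1d.symm
      c2d.symm c12 hac (by rintro rfl; exact hnac hx) hab had hx h1 h2
  have htwinC : ∀ y, G.Adj c y → G.Adj y a1 → G.Adj y a2 → StrongColorable G := by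
    intro x hx h1 h2
    exact strongColorable_of_twinSquares hreg hconn htf hK ha hbd a1b.symm a2b.symm a1d.symm
      a2d.symm a12 hac.symm (by rintro rfl; exact hnac hx.symm) hcb hcd hx h1 h2
  by_cases h11 : G.Adj a1 c1 <;> by_cases h12 : G.Adj a1 c2
  · exact htwinA a1 haa1 h11 h12
  · by_cases h21 : G.Adj a2 c1
    · exact htwinC c1 hcc1 h11.symm h21.symm
    · exact hpairs _ _ _ _ ha hc' (hAC _ _ haa1 a1b a1d hcc2 c2b c2d h12)
        (hAC _ _ haa2 a2b a2d hcc1 c1b c1d h21)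
  · by_cases h22 : G.Adj a2 c2
    · exact htwinC c2 hcc2 h12.symm h22.symm
    · exact hpairs _ _ _ _ ha hc (hAC _ _ haa1 a1b a1d hcc1 c1b c1d h11)
        (hAC _ _ haa2 a2b a2d hcc2 c2b c2d h22)
  · by_cases h21 : G.Adj a2 c1
    · by_cases h22 : G.Adj a2 c2
      · exact htwinA a2 haa2 h21 h22
      · exact hpairs _ _ _ _ ha hc (hAC _ _ haa1 a1b a1d hcc1 c1b c1d h11)
          (hAC _ _ haa2 a2b a2d hcc2 c2b c2d h22)
    · exact hpairs _ _ _ _ ha hc' (hAC _ _ haa1 a1b a1d hcc2 c2b c2d h12)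
        (hAC _ _ haa2 a2b a2d hcc1 c1b c1d h21)

end TwinSquaresExistence

open scoped Classical in
/-- The edges at neighbours of `u` other than `t` that do not contain `u`. -/
noncomputable def outerEdges {V : Type*} [Fintype V] (G : SimpleGraph V) (u t : V) :
    Finset (Sym2 V) :=
  ((nbrs G u).erase t).biUnion fun x => ((nbrs G x).erase u).image fun y => s(x, y)

section LargeGirth

open scoped Classical

variable {V : Type*} [Fintype V] {G : SimpleGraph V} {u t : V}

lemma mem_outerEdges {e : Sym2 V} : e ∈ outerEdges G u t ↔
    ∃ x y, x ≠ t ∧ G.Adj u x ∧ y ≠ u ∧ G.Adj x y ∧ s(x, y) = e := by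
  simp only [outerEdges, Finset.mem_biUnion, Finset.mem_erase, mem_nbrs, Finset.mem_image]
  constructor
  · rintro ⟨x, ⟨h1, h2⟩, y, ⟨h3, h4⟩, h5⟩
    exact ⟨x, y, h1, h2, h3, h4, h5⟩
  · rintro ⟨x, y, h1, h2, h3, h4, h5⟩
    exact ⟨x, ⟨h1, h2⟩, y, ⟨h3, h4⟩, h5⟩

/-- A color is available if the edges of `P` use few colors and few other edges conflict. -/
lemma exists_mem_avail_of_palette {S P : Finset (Sym2 V)} {C : Sym2 V → Fin 21}
    {T : Finset (Fin 21)} {e : Sym2 V} (hT : T.card ≤ 5) (hP : ∀ f ∈ S, f ∈ P → C f ∈ T)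
    (h : (conflicting G (S \ P) e).card ≤ 15) : ∃ x, x ∈ avail G S C e := by
  have h1 : seen G S C e ⊆ T ∪ (conflicting G (S \ P) e).image C := by
    intro x hx
    obtain ⟨f, hf, hef, rfl⟩ := mem_seen.mp hx
    by_cases hfP : f ∈ P
    · exact Finset.mem_union_left _ (hP f hf hfP)
    · exact Finset.mem_union_right _ (Finset.mem_image_of_mem C
        (mem_conflicting.mpr ⟨Finset.mem_sdiff.mpr ⟨hf, hfP⟩, hef⟩))
  have h2 := (Finset.card_le_card h1).trans (Finset.card_union_le _ _)
  have h3 : ((conflicting G (S \ P) e).image C).card ≤ 15 := Finset.card_image_le.trans h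
  have h4 := card_avail_add_card_seen (G := G) S C e
  exact Finset.card_pos.mp (by omega)

lemma sum_degIn_erase_le_mul (hdeg : ∀ v, (nbrs G v).card ≤ 4) {S : Finset (Sym2 V)} {u v : V}
    (hadj : G.Adj u v) {k : ℕ} (hk : ∀ w, G.Adj u w → w ≠ v → degIn G S w ≤ k) :
    ∑ w ∈ (nbrs G u).erase v, degIn G S w ≤ 3 * k := by
  have h1 : ((nbrs G u).erase v).card ≤ 3 := by
    rw [Finset.card_erase_of_mem (mem_nbrs.mpr hadj)]
    have := hdeg u
    omega
  refine (Finset.sum_le_card_nsmul _ _ k fun w hw => ?_).trans (Nat.mul_le_mul_right k h1)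
  simp only [Finset.mem_erase, mem_nbrs] at hw
  exact hk w hw.2 hw.1

lemma sum_degIn_erase_le_add (hdeg : ∀ v, (nbrs G v).card ≤ 4) {S : Finset (Sym2 V)} {u v z : V}
    (hadj : G.Adj u v) (hz : G.Adj u z) (hzv : z ≠ v) {j k : ℕ} (hj : degIn G S z ≤ j)
    (hk : ∀ w, G.Adj u w → w ≠ v → w ≠ z → degIn G S w ≤ k) :
    ∑ w ∈ (nbrs G u).erase v, degIn G S w ≤ j + 2 * k := by
  have hmem : z ∈ (nbrs G u).erase v := by simp [hz, hzv]
  have h1 : (((nbrs G u).erase v).erase z).card ≤ 2 := by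
    rw [Finset.card_erase_of_mem hmem, Finset.card_erase_of_mem (mem_nbrs.mpr hadj)]
    have := hdeg u
    omega
  rw [← Finset.add_sum_erase _ _ hmem]
  refine Nat.add_le_add hj ((Finset.sum_le_card_nsmul _ _ k fun w hw => ?_).trans
    (Nat.mul_le_mul_right k h1))
  simp only [Finset.mem_erase, mem_nbrs] at hw
  exact hk w hw.2.2 hw.2.1 hw.1

/-- In a graph of girth at least five, an outer edge conflicts with at most four others. -/
lemma conflicting_outerEdges_le (hdeg : ∀ v, (nbrs G v).card ≤ 4)
    (htf : ∀ a b c, G.Adj a b → G.Adj b c → ¬ G.Adj a c)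
    (hsq : ∀ x y p q, x ≠ y → G.Adj x p → G.Adj x q → G.Adj y p → G.Adj y q → p = q)
    (hut : G.Adj u t) {S : Finset (Sym2 V)} (hS : S ⊆ outerEdges G u t) {e : Sym2 V}
    (he : e ∈ outerEdges G u t) (heS : e ∉ S) : (conflicting G S e).card ≤ 4 := by
  obtain ⟨x, y, hxt, hux, hyu, hxy, rfl⟩ := mem_outerEdges.mp he
  set A := (((nbrs G x).erase u).erase y).image fun z => s(x, z) with hA
  set B := (((nbrs G u).erase t).erase x).biUnion fun z =>
    (nbrs G z ∩ nbrs G y).image fun w => s(z, w) with hB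
  have hsub : conflicting G S s(x, y) ⊆ A ∪ B := by
    intro f hf
    obtain ⟨hfS, hc⟩ := mem_conflicting.mp hf
    obtain ⟨x', y', hxt', hux', hyu', hxy', rfl⟩ := mem_outerEdges.mp (hS hfS)
    by_cases hxx : x' = x
    · subst hxx
      refine Finset.mem_union_left _ ?_
      simp only [hA, Finset.mem_image, Finset.mem_erase, mem_nbrs]
      refine ⟨y', ⟨?_, hyu', hxy'⟩, rfl⟩
      rintro rfl
      exact heS hfS
    · refine Finset.mem_union_right _ ?_
      have nxx : ¬ G.Adj x x' := htf _ _ _ hux.symm hux'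
      have nxy' : ¬ G.Adj x y' := fun h =>
        hyu' (hsq x x' y' u (Ne.symm hxx) h hux.symm hxy' hux'.symm)
      have nyx' : ¬ G.Adj y x' := fun h =>
        hyu (hsq x x' y u (Ne.symm hxx) hxy hux.symm h.symm hux'.symm)
      have hyy : G.Adj y y' := by
        by_contra hcon
        exact not_strongConflict (Ne.symm hxx) nxx hxy hxy' (fun h => nyx' h.symm) nxy' hcon hc
      simp only [hB, Finset.mem_biUnion, Finset.mem_erase, Finset.mem_image, Finset.mem_inter,
        mem_nbrs]
      exact ⟨x', ⟨hxx, hxt', hux'⟩, y', ⟨hxy', hyy⟩, rfl⟩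
  have hAc : A.card ≤ 2 := by
    refine Finset.card_image_le.trans ?_
    rw [Finset.card_erase_of_mem (by simp [hxy, hyu]),
      Finset.card_erase_of_mem (by simp [hux.symm])]
    have := hdeg x
    omega
  have hBc : B.card ≤ 2 := by
    have h1 : (((nbrs G u).erase t).erase x).card ≤ 2 := by
      rw [Finset.card_erase_of_mem (by simp [hxt, hux]), Finset.card_erase_of_mem (by simp [hut])]
      have := hdeg u
      omega
    refine Finset.card_biUnion_le.trans ((Finset.sum_le_card_nsmul _ _ 1 fun z hz => ?_).trans
      (by simpa using h1))
    simp only [Finset.mem_erase, mem_nbrs] at hz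
    refine Finset.card_image_le.trans (Finset.card_le_one.mpr fun p hp q hq => ?_)
    simp only [Finset.mem_inter, mem_nbrs] at hp hq
    refine hsq z y p q ?_ hp.1 hq.1 hp.2 hq.2
    rintro rfl
    exact htf _ _ _ hux hxy hz.2.2
  have := (Finset.card_le_card hsub).trans (Finset.card_union_le A B)
  omega

/-- Outer edges can be colored with a palette of five colors. -/
lemma exists_properOn_outerEdges (hdeg : ∀ v, (nbrs G v).card ≤ 4)
    (htf : ∀ a b c, G.Adj a b → G.Adj b c → ¬ G.Adj a c)
    (hsq : ∀ x y p q, x ≠ y → G.Adj x p → G.Adj x q → G.Adj y p → G.Adj y q → p = q)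
    (hut : G.Adj u t) : ∃ (T : Finset (Fin 21)) (C : Sym2 V → Fin 21), T.card ≤ 5 ∧
      ProperOn G (outerEdges G u t) C ∧ ∀ e ∈ outerEdges G u t, C e ∈ T := by
  have h0 : ProperOn G (∅ : Finset (Sym2 V)) fun _ => 0 := by
    intro e he
    simp at he
  set T : Finset (Fin 21) := {0, 1, 2, 3, 4} with hT
  have hTc : T.card = 5 := by decide
  obtain ⟨C, h1, -, h2⟩ := h0.greedy_palette T (outerEdges G u t) (by simp) (by
    intro e he S' C' _ hS' heS' _ _
    have h3 := conflicting_outerEdges_le hdeg htf hsq hut (by simpa using hS') he heS'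
    have h4 := seen_card_le (G := G) S' C' e
    obtain ⟨x, hx, hxs⟩ := Finset.exists_mem_notMem_of_card_lt_card
      (show (seen G S' C' e).card < T.card by omega)
    exact ⟨x, hx, by simpa [avail] using hxs⟩)
  exact ⟨T, C, hTc.le, by simpa using h1, h2⟩

end LargeGirth

section PaletteExtension

open scoped Classical

variable {V : Type*} [Fintype V] {G : SimpleGraph V} {u t : V}

lemma degIn_le_three (hdeg : ∀ v, (nbrs G v).card ≤ 4) {S : Finset (Sym2 V)} {w x : V}
    (hwx : G.Adj w x) (hS : s(w, x) ∉ S) : degIn G S w ≤ 3 := by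
  have h : degIn G S w ≤ ((nbrs G w).erase x).card := degIn_le_of_subset fun y hy hyS => by
    simp only [Finset.mem_erase, mem_nbrs]
    refine ⟨?_, hy⟩
    rintro rfl
    exact hS hyS
  rw [Finset.card_erase_of_mem (mem_nbrs.mpr hwx)] at h
  have := hdeg w
  omega

/-- Extending a coloring of the outer edges to the edges whose ends have no neighbour in `D`. -/
lemma exists_properOn_inner (hdeg : ∀ v, (nbrs G v).card ≤ 4) {D : Finset V}
    {P : Finset (Sym2 V)} {T : Finset (Fin 21)} {C : Sym2 V → Fin 21}
    (hT : T.card ≤ 5) (hC : ProperOn G P C) (hCT : ∀ e ∈ P, C e ∈ T)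
    (hZ : ∀ q ∉ D, (∀ w, G.Adj q w → w ∉ D) → ∃ b, G.Adj q b ∧ b ∉ D ∧ ∃ w ∈ D, G.Adj b w)
    {F : Finset (Sym2 V)} (hF : ∀ e, e ∈ F ↔ e ∈ G.edgeSet ∧ e ∉ P ∧
      ∀ v ∈ e, v ∉ D ∧ ∀ w, G.Adj v w → w ∉ D) :
    ∃ C', ProperOn G (P ∪ F) C' ∧ ∀ e ∈ P, C' e ∈ T := by
  obtain ⟨C', h1, h2, -⟩ := hC.greedy_palette Finset.univ F (fun e he => ((hF e).mp he).2.1) (by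
    intro e he S' C' hS1 hS2 heS' hagree _
    have hsub : ∀ f ∈ S' \ P, f ∈ F := by
      intro f hf
      rw [Finset.mem_sdiff] at hf
      exact (Finset.mem_union.mp (hS2 hf.1)).resolve_left hf.2
    have hdeg3 : ∀ w, degIn G (S' \ P) w ≤ 3 := by
      intro w
      by_cases hw : w ∉ D ∧ ∀ x, G.Adj w x → x ∉ D
      · obtain ⟨b, hb, -, x, hx, hbx⟩ := hZ w hw.1 hw.2
        exact degIn_le_three hdeg hb fun h =>
          (((hF _).mp (hsub _ h)).2.2 b (by simp)).2 x hbx hx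
      · rw [degIn_eq_zero fun x _ h => hw (((hF _).mp (hsub _ h)).2.2 w (by simp))]
        omega
    have hside : ∀ a b, G.Adj a b → (a ∉ D ∧ ∀ w, G.Adj a w → w ∉ D) →
        (b ∉ D ∧ ∀ w, G.Adj b w → w ∉ D) →
        ∑ w ∈ (nbrs G a).erase b, degIn G (S' \ P) w ≤ 0 + 2 * 3 := by
      intro a b hab ha hb
      obtain ⟨z, hz, -, x, hx, hzx⟩ := hZ a ha.1 ha.2
      refine sum_degIn_erase_le_add hdeg hab hz ?_ (le_of_eq (degIn_eq_zero fun y _ h => ?_))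
        fun w _ _ _ => hdeg3 w
      · rintro rfl
        exact hb.2 x hzx hx
      · exact (((hF _).mp (hsub _ h)).2.2 z (by simp)).2 x hzx hx
    obtain ⟨hadj, -, hends⟩ := (hF e).mp he
    induction e with | _ a b =>
    have hab : G.Adj a b := hadj
    have ha := hends a (by simp)
    have hb := hends b (by simp)
    obtain ⟨x, hx⟩ := exists_mem_avail_of_palette (G := G) (S := S') (P := P) (C := C')
      (e := s(a, b)) hT (fun f _ hfP => by rw [hagree f hfP]; exact hCT f hfP) (by
        have h1 := conflicting_card_le (S := S' \ P)
          (fun f hf => ((hF f).mp (hsub f hf)).1) hab (by simp [heS'])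
        have h2 := hside a b hab ha hb
        have h3 := hside b a hab.symm hb ha
        omega)
    exact ⟨x, Finset.mem_univ _, hx⟩)
  exact ⟨C', h1, fun e he => by rw [h2 e he]; exact hCT e he⟩

/-- Extending a coloring of the outer edges to all edges not containing `u`. -/
lemma exists_properOn_edgesAvoid_of_palette (hdeg : ∀ v, (nbrs G v).card ≤ 4) {D : Finset V}
    {P : Finset (Sym2 V)} {T : Finset (Fin 21)} {C : Sym2 V → Fin 21}
    (hP : P ⊆ edgesAvoid G D) (hT : T.card ≤ 5) (hC : ProperOn G P C) (hCT : ∀ e ∈ P, C e ∈ T)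
    (hZ : ∀ q ∉ D, (∀ w, G.Adj q w → w ∉ D) → ∃ b, G.Adj q b ∧ b ∉ D ∧ ∃ w ∈ D, G.Adj b w)
    (hu : u ∈ D) (ρ : V → ℕ) (hρ : ∀ t ∈ D, t ≠ u → ∃ w ∈ D, G.Adj t w ∧ ρ w < ρ t) :
    ∃ C', ProperOn G (edgesAvoid G {u}) C' ∧ ∀ e ∈ P, C' e ∈ T := by
  set F : Finset (Sym2 V) := Finset.univ.filter fun e => e ∈ G.edgeSet ∧ e ∉ P ∧
      ∀ v ∈ e, v ∉ D ∧ ∀ w, G.Adj v w → w ∉ D with hFdef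
  have hF : ∀ e, e ∈ F ↔ e ∈ G.edgeSet ∧ e ∉ P ∧
      ∀ v ∈ e, v ∉ D ∧ ∀ w, G.Adj v w → w ∉ D := by
    intro e
    simp [hFdef]
  obtain ⟨C1, h1, h1T⟩ := exists_properOn_inner hdeg hT hC hCT hZ hF
  have hPF : P ∪ F ⊆ edgesAvoid G D := by
    refine Finset.union_subset hP fun e he => ?_
    have := (hF e).mp he
    exact mem_edgesAvoid.mpr ⟨this.1, fun v hv => (this.2.2 v hv).1⟩
  obtain ⟨C2, h2, h2a⟩ := h1.greedy (edgesAvoid G D) (by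
    intro e he S' hS1 hS2 heS'
    rw [Finset.union_eq_right.mpr hPF] at hS2
    obtain ⟨hadj, hD⟩ := mem_edgesAvoid.mp he
    have heF : e ∉ F := fun h => heS' (hS1 (Finset.mem_union_right _ h))
    have heP : e ∉ P := fun h => heS' (hS1 (Finset.mem_union_left _ h))
    have : ∃ m ∈ e, ∃ w, G.Adj m w ∧ w ∈ D := by
      by_contra! hcon
      exact heF ((hF e).mpr ⟨hadj, heP, fun v hv => ⟨hD v hv, hcon v hv⟩⟩)
    obtain ⟨m, hm, w, hmw, hw⟩ := this
    obtain ⟨x, rfl⟩ := Sym2.mem_iff_exists.mp hm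
    refine conflicting_card_le_of_zero hdeg (fun f hf => (mem_edgesAvoid.mp (hS2 hf)).1) hadj heS'
      hmw ?_ (degIn_eq_zero fun y _ hy => (mem_edgesAvoid.mp (hS2 hy)).2 w (by simp) hw)
    rintro rfl
    exact hD w (by simp) hw)
  rw [Finset.union_eq_right.mpr hPF] at h2
  obtain ⟨C3, h3, h3a⟩ := h2.flow hdeg (M := {u}) (by simpa using hu) ρ
    (fun x hx hxu => hρ x hx (by simpa using hxu))
  refine ⟨C3, h3, fun e he => ?_⟩
  rw [h3a e (hP he), h2a e (Finset.mem_union_left _ he)]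
  exact h1T e he

/-- Coloring the edges at `u` when the outer edges use few colors. -/
lemma strongColorable_of_outerEdges_palette (hdeg : ∀ v, (nbrs G v).card ≤ 4) (hut : G.Adj u t)
    {T : Finset (Fin 21)} {C : Sym2 V → Fin 21} (hT : T.card ≤ 5)
    (hC : ProperOn G (edgesAvoid G {u}) C) (hCT : ∀ e ∈ outerEdges G u t, C e ∈ T)
    (hP : outerEdges G u t ⊆ edgesAvoid G {u}) : StrongColorable G := by
  set F : Finset (Sym2 V) := Finset.univ.filter fun e => e ∈ G.edgeSet ∧ u ∈ e with hF
  obtain ⟨C', h1, -, -⟩ := hC.greedy_palette Finset.univ F (by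
    intro e he h
    simp only [hF, Finset.mem_filter] at he
    exact (mem_edgesAvoid.mp h).2 u he.2.2 (by simp)) (by
    intro e he S' C' hS1 hS2 heS' hagree _
    simp only [hF, Finset.mem_filter] at he
    obtain ⟨-, hadj, hue⟩ := he
    obtain ⟨x, rfl⟩ := Sym2.mem_iff_exists.mp hue
    have hux : G.Adj u x := hadj
    set P := outerEdges G u t with hPdef
    have hSe : ∀ f ∈ S' \ P, f ∈ G.edgeSet := by
      intro f hf
      have := hS2 (Finset.mem_sdiff.mp hf).1
      rcases Finset.mem_union.mp this with h | h
      · exact (mem_edgesAvoid.mp h).1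
      · simp only [hF, Finset.mem_filter] at h
        exact h.2.1
    have h1 : ∀ w, G.Adj u w → w ≠ t → degIn G (S' \ P) w ≤ 1 := by
      intro w huw hwt
      have h := degIn_le_of_subset (G := G) (S := S' \ P) (w := w) (K := {u}) (by
        intro y hy hyS
        by_contra hyu
        refine (Finset.mem_sdiff.mp hyS).2 (mem_outerEdges.mpr ⟨w, y, hwt, huw, ?_, hy, rfl⟩)
        simpa using hyu)
      simpa using h
    have h15 : (conflicting G (S' \ P) s(u, x)).card ≤ 15 := by
      have h2 := conflicting_card_le (S := S' \ P) hSe hux (by simp [heS'])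
      by_cases hxt : x = t
      · subst hxt
        have h3 := sum_degIn_erase_le_mul hdeg hux h1
        have h4 := sum_degIn_erase_le hdeg (S' \ P) hux.symm
        omega
      · have h3 := sum_degIn_erase_le_add hdeg hux hut (Ne.symm hxt)
          ((degIn_le_card_nbrs (S' \ P) t).trans (hdeg t)) fun w hw _ hwt => h1 w hw hwt
        have h4 := sum_degIn_erase_le_mul (S := S' \ P) hdeg hux.symm fun y hxy hyu =>
          degIn_le_three hdeg hxy.symm fun h => (Finset.mem_sdiff.mp h).2
            (mem_outerEdges.mpr ⟨x, y, hxt, hux, hyu, hxy, Sym2.eq_swap⟩)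
        omega
    obtain ⟨c, hc⟩ := exists_mem_avail_of_palette (G := G) (S := S') (P := P) (C := C') hT
      (fun f _ hfP => by rw [hagree f (hP hfP)]; exact hCT f hfP) h15
    exact ⟨c, Finset.mem_univ _, hc⟩)
  refine h1.strongColorable fun a b hab => ?_
  by_cases h : u ∈ s(a, b)
  · exact Finset.mem_union_right _ (by simp only [hF, Finset.mem_filter]; exact
      ⟨Finset.mem_univ _, hab, h⟩)
  · refine Finset.mem_union_left _ (mem_edgesAvoid.mpr ⟨hab, fun v hv hvu => h ?_⟩)
    rw [Finset.mem_singleton] at hvu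
    exact hvu ▸ hv

lemma strongColorable_of_boundary (hdeg : ∀ v, (nbrs G v).card ≤ 4)
    (htf : ∀ a b c, G.Adj a b → G.Adj b c → ¬ G.Adj a c)
    (hsq : ∀ x y p q, x ≠ y → G.Adj x p → G.Adj x q → G.Adj y p → G.Adj y q → p = q)
    (hut : G.Adj u t) {D : Finset V} (hu : u ∈ D)
    (hout : ∀ x, G.Adj u x → x ≠ t → x ∉ D ∧ ∀ y, G.Adj x y → y ≠ u → y ∉ D)
    (hZ : ∀ q ∉ D, (∀ w, G.Adj q w → w ∉ D) → ∃ b, G.Adj q b ∧ b ∉ D ∧ ∃ w ∈ D, G.Adj b w)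
    (ρ : V → ℕ) (hρ : ∀ t ∈ D, t ≠ u → ∃ w ∈ D, G.Adj t w ∧ ρ w < ρ t) :
    StrongColorable G := by
  obtain ⟨T, C, hT, hC, hCT⟩ := exists_properOn_outerEdges hdeg htf hsq hut
  have hP : outerEdges G u t ⊆ edgesAvoid G D := by
    intro e he
    obtain ⟨x, y, hxt, hux, hyu, hxy, rfl⟩ := mem_outerEdges.mp he
    refine mem_edgesAvoid.mpr ⟨hxy, fun v hv => ?_⟩
    rcases Sym2.mem_iff.mp hv with rfl | rfl
    · exact (hout _ hux hxt).1
    · exact (hout _ hux hxt).2 _ hxy hyu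
  obtain ⟨C', h1, h2⟩ := exists_properOn_edgesAvoid_of_palette hdeg hP hT hC hCT hZ hu ρ hρ
  refine strongColorable_of_outerEdges_palette hdeg hut hT h1 h2 (hP.trans fun e he => ?_)
  rw [mem_edgesAvoid] at he ⊢
  exact ⟨he.1, fun v hv hvu => he.2 v hv (Finset.mem_singleton.mp hvu ▸ hu)⟩

end PaletteExtension

/-- The vertices other than `u` at distance at most one from a neighbour `x ≠ t` of `u`. -/
def InShell {V : Type*} (G : SimpleGraph V) (u t v : V) : Prop :=
  v ≠ u ∧ ∃ x, G.Adj u x ∧ x ≠ t ∧ (v = x ∨ G.Adj x v)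

/-- The graph obtained from `G` by deleting all edges meeting the shell of `(u, t)`. -/
def offShell {V : Type*} (G : SimpleGraph V) (u t : V) : SimpleGraph V where
  Adj a b := G.Adj a b ∧ ¬ InShell G u t a ∧ ¬ InShell G u t b
  symm := ⟨fun _ _ h => ⟨h.1.symm, h.2.2, h.2.1⟩⟩
  loopless := ⟨fun _ h => G.irrefl h.1⟩

open scoped Classical in
/-- The vertices that can be reached from `u` without meeting the shell of `(u, t)`. -/
noncomputable def core {V : Type*} [Fintype V] (G : SimpleGraph V) (u t : V) : Finset V :=
  Finset.univ.filter fun v => (offShell G u t).Reachable u v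

section Core

open scoped Classical

variable {V : Type*} [Fintype V] {G : SimpleGraph V} {u t : V}

lemma mem_core {v : V} : v ∈ core G u t ↔ (offShell G u t).Reachable u v := by simp [core]

lemma self_mem_core : u ∈ core G u t := mem_core.mpr (SimpleGraph.Reachable.refl u)

lemma not_inShell_of_mem_core {v : V} (hv : v ∈ core G u t) : ¬ InShell G u t v := by
  by_cases hvu : v = u
  · exact fun h => h.1 hvu
  · obtain ⟨w, hw, -⟩ := exists_adj_dist_lt (mem_core.mp hv) hvu
    exact hw.2.1

lemma mem_core_of_adj {v w : V} (hv : v ∈ core G u t) (hvw : G.Adj v w)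
    (hw : ¬ InShell G u t w) : w ∈ core G u t := by
  have h : (offShell G u t).Adj v w := ⟨hvw, not_inShell_of_mem_core hv, hw⟩
  exact mem_core.mpr ((mem_core.mp hv).trans h.reachable)

lemma core_subset_core {q m w : V} (hdisj : ∀ v ∈ core G u t, ¬ InShell G q m v)
    (hw : w ∈ core G u t) (hw' : w ∈ core G q m) : core G u t ⊆ core G q m := by
  intro v hv
  obtain ⟨p⟩ := (mem_core.mp hw).symm.trans (mem_core.mp hv)
  induction p with
  | nil => exact hw'
  | cons h p ih =>
    have hx := mem_core_of_adj hw h.1 h.2.2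
    exact ih hx (mem_core_of_adj hw' h.1 (hdisj _ hx)) hv

/-- If the core of `(u, t)` does not come close to every vertex, then another core is larger. -/
lemma exists_core_ssubset (hconn : G.Connected)
    (htf : ∀ a b c, G.Adj a b → G.Adj b c → ¬ G.Adj a c)
    (hsq : ∀ x y p q, x ≠ y → G.Adj x p → G.Adj x q → G.Adj y p → G.Adj y q → p = q)
    {r : V} (hr : r ∉ core G u t) (hr1 : ∀ w, G.Adj r w → w ∉ core G u t)
    (hr2 : ∀ b, G.Adj r b → b ∉ core G u t → ∀ w ∈ core G u t, ¬ G.Adj b w) :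
    ∃ q m, G.Adj q m ∧ core G u t ⊂ core G q m := by
  set D := core G u t with hD
  set B : Set V := {q | q ∉ D ∧ (∀ w, G.Adj q w → w ∉ D) ∧
    ∀ b, G.Adj q b → b ∉ D → ∀ w ∈ D, ¬ G.Adj b w} with hB
  obtain ⟨p⟩ := hconn r u
  obtain ⟨⟨⟨q, m⟩, hqm⟩, -, hqB, hmB⟩ := p.exists_boundary_dart B ⟨hr, hr1, hr2⟩
    (fun h => h.1 self_mem_core)
  change G.Adj q m at hqm
  change q ∈ B at hqB
  change m ∉ B at hmB
  obtain ⟨hq, hq1, hq2⟩ := hqB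
  have hm : m ∉ D := hq1 m hqm
  have hm1 : ∀ w, G.Adj m w → w ∉ D := fun w h hw => hq2 m hqm hm w hw h
  have : ∃ b, G.Adj m b ∧ b ∉ D ∧ ∃ w ∈ D, G.Adj b w := by
    by_contra! hcon
    exact hmB ⟨hm, hm1, hcon⟩
  obtain ⟨b, hmb, hb, w, hw, hbw⟩ := this
  have hqb : q ≠ b := by
    rintro rfl
    exact hq1 w hbw hw
  have hdisj : ∀ v ∈ D, ¬ InShell G q m v := by
    rintro v hv ⟨-, x, hqx, -, rfl | hxv⟩
    · exact hq1 v hqx hv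
    · exact hq2 x hqx (hq1 x hqx) v hv hxv
  have hmS : ¬ InShell G q m m := by
    rintro ⟨-, x, hqx, hxm, h | hxv⟩
    · exact hxm h.symm
    · exact htf _ _ _ hqx hxv hqm
  have hbS : ¬ InShell G q m b := by
    rintro ⟨-, x, hqx, hxm, rfl | hxb⟩
    · exact hq2 b hqx hb w hw hbw
    · exact hxm (hsq q b x m hqb hqx hqm hxb.symm hmb.symm)
  have hwD : w ∈ core G q m := mem_core_of_adj (mem_core_of_adj (mem_core_of_adj
    self_mem_core hqm hmS) hmb hbS) hbw (hdisj w hw)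
  exact ⟨q, m, hqm, (Finset.ssubset_iff_of_subset (core_subset_core hdisj hw hwD)).mpr
    ⟨q, self_mem_core, hq⟩⟩

lemma strongColorable_of_girth (hdeg : ∀ v, (nbrs G v).card ≤ 4) (hconn : G.Connected)
    (htf : ∀ a b c, G.Adj a b → G.Adj b c → ¬ G.Adj a c)
    (hsq : ∀ x y p q, x ≠ y → G.Adj x p → G.Adj x q → G.Adj y p → G.Adj y q → p = q)
    (hadj : G.Adj u t) : StrongColorable G := by
  obtain ⟨⟨u, t⟩, hut, hmax⟩ := Finset.exists_max_image
    (Finset.univ.filter fun e : V × V => G.Adj e.1 e.2) (fun e => (core G e.1 e.2).card)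
    ⟨(u, t), by simpa using hadj⟩
  have hut : G.Adj u t := by simpa using hut
  refine strongColorable_of_boundary (D := core G u t) hdeg htf hsq hut self_mem_core
    (fun x hux hxt => ⟨fun h => not_inShell_of_mem_core h ⟨hux.ne', x, hux, hxt, Or.inl rfl⟩,
      fun y hxy hyu h => not_inShell_of_mem_core h ⟨hyu, x, hux, hxt, Or.inr hxy⟩⟩) ?_
    ((offShell G u t).dist u) ?_
  · intro r hr hr1
    by_contra! hcon
    obtain ⟨q, m, hqm, hlt⟩ := exists_core_ssubset hconn htf hsq hr hr1 hcon
    exact (Finset.card_lt_card hlt).not_ge (hmax (q, m) (by simpa using hqm))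
  · intro x hx hxu
    obtain ⟨w, h1, h2, h3⟩ := exists_adj_dist_lt (mem_core.mp hx) hxu
    exact ⟨w, mem_core.mpr h2, h1.1, h3⟩

end Core

section Main

open scoped Classical

variable {V : Type*} [Fintype V] {G : SimpleGraph V}

/-- A connected graph of maximum degree at most four has a strong edge-coloring with 21 colors. -/
lemma strongColorable_of_connected (hdeg : ∀ v, (nbrs G v).card ≤ 4) (hconn : G.Connected) :
    StrongColorable G := by
  by_cases hreg : ∀ v, (nbrs G v).card = 4
  swap
  · push Not at hreg
    obtain ⟨v, hv⟩ := hreg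
    have := hdeg v
    exact strongColorable_of_card_nbrs_le_three hdeg hconn (v := v) (by omega)
  by_cases htf : ∀ a b c, G.Adj a b → G.Adj b c → ¬ G.Adj a c
  swap
  · push Not at htf
    obtain ⟨a, b, c, hab, hbc, hac⟩ := htf
    exact strongColorable_of_triangle hdeg hconn hab hbc hac
  by_cases hK : ∀ x y b d e, x ≠ y → b ≠ d → b ≠ e → d ≠ e → G.Adj x b → G.Adj x d →
      G.Adj x e → G.Adj y b → G.Adj y d → ¬ G.Adj y e
  swap
  · push Not at hK
    obtain ⟨x, y, b, d, e, hxy, hbd, hbe, hde, h1, h2, h3, h4, h5, h6⟩ := hK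
    exact strongColorable_of_three_common_nbrs hreg hconn htf hxy h1 h2 h3 h4 h5 h6 hbd hbe hde
  by_cases hsq : ∀ x y p q, x ≠ y → G.Adj x p → G.Adj x q → G.Adj y p → G.Adj y q → p = q
  swap
  · push Not at hsq
    obtain ⟨x, y, p, q, hxy, h1, h2, h3, h4, hpq⟩ := hsq
    exact strongColorable_of_square hreg hconn htf hK hxy hpq h1 h2 h3 h4
  obtain ⟨u⟩ := hconn.nonempty
  obtain ⟨t, ht⟩ : (nbrs G u).Nonempty := Finset.card_pos.mp (by rw [hreg u]; omega)
  exact strongColorable_of_girth hdeg hconn htf hsq (mem_nbrs.mp ht)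

/-- The edges of a connected component can be strongly colored with 21 colors. -/
lemma exists_coloring_of_component (hdeg : ∀ v, (nbrs G v).card ≤ 4) (c : G.ConnectedComponent) :
    ∃ C : Sym2 c.supp → Fin 21, ∀ e ∈ c.toSimpleGraph.edgeSet, ∀ f ∈ c.toSimpleGraph.edgeSet,
      e ≠ f → StrongConflict c.toSimpleGraph e f → C e ≠ C f := by
  have : Fintype c.supp := Fintype.ofFinite _
  obtain ⟨C, hC⟩ := strongColorable_of_connected (G := c.toSimpleGraph) (by
    intro v
    refine le_trans (Finset.card_le_card_of_injOn Subtype.val (fun w hw => ?_)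
      Subtype.val_injective.injOn) (hdeg v)
    simp only [Finset.mem_coe, mem_nbrs] at hw ⊢
    exact hw) c.connected_toSimpleGraph
  exact ⟨C, fun e he f hf => hC e (by simpa using he) f (by simpa using hf)⟩

/-- Every edge of `G` comes from an edge of a component. -/
lemma exists_component_edge {e : Sym2 V} (he : e ∈ G.edgeSet) :
    ∃ (c : G.ConnectedComponent) (e' : Sym2 c.supp), e' ∈ c.toSimpleGraph.edgeSet ∧
      e'.map Subtype.val = e := by
  induction e with | _ x y =>
  have hxy : G.Adj x y := he
  exact ⟨G.connectedComponentMk x, s(⟨x, rfl⟩, ⟨y, SimpleGraph.ConnectedComponent.sound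
    hxy.symm.reachable⟩), hxy, rfl⟩

/-- Conflicting edges lie in the same component. -/
lemma component_eq_of_strongConflict {c d : G.ConnectedComponent} {e : Sym2 c.supp}
    {f : Sym2 d.supp} (h : StrongConflict G (e.map Subtype.val) (f.map Subtype.val)) : c = d := by
  rcases h with ⟨v, h1, h2⟩ | ⟨u, v, h1, h2, h3⟩
  · obtain ⟨⟨a, ha⟩, -, rfl⟩ := Sym2.mem_map.mp h1
    obtain ⟨⟨b, hb⟩, -, rfl⟩ := Sym2.mem_map.mp h2
    exact ha.symm.trans hb
  · obtain ⟨⟨a, ha⟩, -, rfl⟩ := Sym2.mem_map.mp h1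
    obtain ⟨⟨b, hb⟩, -, rfl⟩ := Sym2.mem_map.mp h2
    exact ha.symm.trans ((SimpleGraph.ConnectedComponent.sound h3.reachable).trans hb)

lemma StrongConflict.of_map {c : G.ConnectedComponent} {e f : Sym2 c.supp}
    (h : StrongConflict G (e.map Subtype.val) (f.map Subtype.val)) :
    StrongConflict c.toSimpleGraph e f := by
  rcases h with ⟨v, h1, h2⟩ | ⟨u, v, h1, h2, h3⟩
  · obtain ⟨a, ha, rfl⟩ := Sym2.mem_map.mp h1
    obtain ⟨b, hb, hab⟩ := Sym2.mem_map.mp h2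
    exact Or.inl ⟨a, ha, Subtype.val_injective hab ▸ hb⟩
  · obtain ⟨a, ha, rfl⟩ := Sym2.mem_map.mp h1
    obtain ⟨b, hb, rfl⟩ := Sym2.mem_map.mp h2
    exact Or.inr ⟨a, b, ha, hb, h3⟩

lemma exists_isStrongEdgeColoring (hdeg : ∀ v, (nbrs G v).card ≤ 4) :
    ∃ C : G.edgeSet → Fin 21, IsStrongEdgeColoring G C := by
  choose Cc hCc using exists_coloring_of_component (G := G) hdeg
  choose c e' he' hmap using fun e : G.edgeSet => exists_component_edge e.2
  have key : ∀ (c d : G.ConnectedComponent) (e : Sym2 c.supp) (f : Sym2 d.supp),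
      e ∈ c.toSimpleGraph.edgeSet → f ∈ d.toSimpleGraph.edgeSet →
      e.map Subtype.val ≠ f.map Subtype.val →
      StrongConflict G (e.map Subtype.val) (f.map Subtype.val) → Cc c e ≠ Cc d f := by
    intro c d e f he hf hne hcon
    obtain rfl := component_eq_of_strongConflict hcon
    exact hCc c e he f hf (fun h => hne (h ▸ rfl)) hcon.of_map
  refine ⟨fun e => Cc (c e) (e' e), fun e f hne hcon => key _ _ _ _ (he' e) (he' f) ?_ ?_⟩
  · rw [hmap, hmap]
    exact fun h => hne (Subtype.ext h)
  · rwa [hmap, hmap]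

end Main

/-- Every simple graph with maximum degree at most 4 having a vertex of degree
at most 3 has a strong edge-coloring with at most 21 colors. -/
theorem strong_edge_coloring_low_degree_vertex {V : Type*} [Fintype V]
    (G : SimpleGraph V) [DecidableRel G.Adj]
    (hdeg : ∀ v, G.degree v ≤ 4) (hlow : ∃ v, G.degree v ≤ 3) :
    ∃ C : G.edgeSet → Fin 21, IsStrongEdgeColoring G C := by
  refine exists_isStrongEdgeColoring fun v => le_of_eq_of_le (congrArg Finset.card ?_) (hdeg v)
  ext w
  simp
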